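/- Let F be an algebraically closed field and let f₁, …, f_r ∈ F[x₁, …, x_n] be commutative polynomials with no common zero in F^n. Let d_i = deg f_i, assume d₁ ≥ d₂ ≥ … ≥ d_r ≥ 1. Then there exist polynomials h₁, …, h_r ∈ F[x₁, …, x_n] satisfying 1 = h₁f₁ + ⋯ + h_rf_r and deg(h_i f_i) ≤ N'(n, d₁, …, d_r) for all 1 ≤ i ≤ r. -/

import Mathlib

/-- The Kollár–Jelonek bound `N(n, d₁, …, d_r)`, where `d 0, …, d (r-1)` are the
degrees in (weakly) decreasing order. -/
def KJboundN (n r : ℕ) (d : ℕ → ℕ) : ℕ :=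
  if r ≤ n then ∏ i ∈ Finset.range r, d i
  else if 1 < n then (∏ i ∈ Finset.range (n - 1), d i) * d (r - 1)
  else d 0 + d (r - 1) - 1

/-- The Kollár–Jelonek bound `N'(n, d₁, …, d_r)`. -/
def KJboundN' (n r : ℕ) (d : ℕ → ℕ) : ℕ :=
  if r ≤ n then KJboundN n r d
  else if 2 < d (r - 1) then KJboundN n r d
  else if 1 < n then 2 * KJboundN n r d - 1
  else 2 * d 0 - 1

set_option linter.all false

namespace EN
open MvPolynomial

noncomputable def wh {σ K : Type*} [Field K] (w : σ → ℕ) :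
    MvPolynomial σ K →ₐ[K] Polynomial (MvPolynomial σ K) :=
  aeval (fun i => Polynomial.monomial (w i) (X i))

lemma wh_monomial {σ K : Type*} [Field K] (w : σ → ℕ) (a : σ →₀ ℕ) (c : K) :
    wh w (monomial a c) = Polynomial.monomial (Finsupp.weight w a) (monomial a c) := by
  have h1 : ∀ a : σ →₀ ℕ, wh w (monomial a (1:K)) =
      Polynomial.monomial (Finsupp.weight w a) (monomial a 1) := by
    intro a
    induction a using Finsupp.induction_linear with
    | zero =>
      have : (monomial (0 : σ →₀ ℕ)) (1:K) = 1 := rfl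
      rw [this, map_one, map_zero]; rfl
    | add f g hf hg =>
      have : monomial (f+g) (1:K) = monomial f 1 * monomial g 1 := by simp [monomial_mul]
      rw [this, map_mul, hf, hg, Polynomial.monomial_mul_monomial, map_add]
    | single i k =>
      rw [← X_pow_eq_monomial, map_pow]
      simp only [wh, aeval_X, Polynomial.monomial_pow, Finsupp.weight_single, smul_eq_mul]
      rw [mul_comm]
  have : monomial a c = c • monomial a (1:K) := by simp [smul_monomial]
  rw [this, map_smul, h1, Polynomial.smul_monomial]

lemma wh_coeff {σ K : Type*} [Field K] (w : σ → ℕ) (p : MvPolynomial σ K) (k : ℕ) (a : σ →₀ ℕ) :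
    coeff a ((wh w p).coeff k) = if Finsupp.weight w a = k then coeff a p else 0 := by
  classical
  induction p using MvPolynomial.induction_on' with
  | monomial b c =>
    rw [wh_monomial, Polynomial.coeff_monomial]
    split_ifs with h1 h2 h2
    · rfl
    · rw [coeff_monomial, if_neg]; rintro rfl; exact h2 h1
    · rw [coeff_monomial, if_neg]
      · simp
      · rintro rfl; exact h1 h2
    · simp
  | add p q hp hq =>
    rw [map_add, Polynomial.coeff_add, coeff_add, hp, hq, coeff_add]
    split_ifs <;> simp

lemma wh_le_iff {σ K : Type*} [Field K] (w : σ → ℕ) (p : MvPolynomial σ K) (m : ℕ) :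
    (wh w p).natDegree ≤ m ↔ ∀ a ∈ p.support, Finsupp.weight w a ≤ m := by
  rw [Polynomial.natDegree_le_iff_coeff_eq_zero]
  constructor
  · intro h a ha
    by_contra! hlt
    have := congrArg (coeff a) (h _ hlt)
    rw [wh_coeff, if_pos rfl] at this
    exact (mem_support_iff.mp ha) (by simpa using this)
  · intro h k hk
    ext a
    rw [wh_coeff]
    split_ifs with h1
    · by_contra hne
      have := h a (mem_support_iff.mpr (by simpa using hne))
      omega
    · simp

lemma wh_ne {σ K : Type*} [Field K] (w : σ → ℕ) {p : MvPolynomial σ K} (hp : p ≠ 0) :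
    wh w p ≠ 0 := by
  intro h
  obtain ⟨a, ha⟩ := ne_zero_iff.mp hp
  have := wh_coeff w p (Finsupp.weight w a) a
  rw [h, if_pos rfl] at this
  exact ha (by simpa using this.symm)

lemma wh_mul {σ K : Type*} [Field K] (w : σ → ℕ) {p q : MvPolynomial σ K} (hp : p ≠ 0)
    (hq : q ≠ 0) : (wh w (p * q)).natDegree = (wh w p).natDegree + (wh w q).natDegree := by
  rw [map_mul, Polynomial.natDegree_mul (wh_ne w hp) (wh_ne w hq)]

/-- exponents of weight at most `m` -/
def wset {τ : Type*} (w : τ → ℕ) (m : ℕ) : Set (τ →₀ ℕ) := {a | Finsupp.weight w a ≤ m}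

noncomputable def wcnt {τ : Type*} (w : τ → ℕ) (m : ℕ) : ℕ := Nat.card (wset w m)

def wset2 {τ : Type*} (w : τ → ℕ) (m q : ℕ) : Set (Option τ →₀ ℕ) :=
  {a | Finsupp.weight w a.some ≤ m ∧ a none ≤ q}

instance wset_finite {τ : Type*} [Finite τ] (w : τ → ℕ) [hw : Fact (∀ x, w x ≠ 0)] (m : ℕ) :
    Finite (wset w m) := Finsupp.finite_of_nat_weight_le w hw.out m

noncomputable def wset2Equiv {τ : Type*} (w : τ → ℕ) (m q : ℕ) :
    wset2 w m q ≃ wset w m × Fin (q+1) where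
  toFun a := (⟨a.1.some, a.2.1⟩, ⟨a.1 none, Nat.lt_succ_of_le a.2.2⟩)
  invFun b := ⟨b.1.1.optionElim b.2, by
    constructor
    · have h := b.1.2
      change Finsupp.weight w _ ≤ m at h
      convert h
      ext i; simp [Finsupp.optionElim_apply_some]
    · rw [Finsupp.optionElim_apply_none]; exact Nat.lt_succ_iff.mp b.2.2⟩
  left_inv a := by
    ext i; cases i <;> simp [Finsupp.optionElim_apply_none, Finsupp.optionElim_apply_some]
  right_inv b := by
    ext <;> simp [Finsupp.optionElim_apply_none, Finsupp.optionElim_apply_some]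

instance wset2_finite {τ : Type*} [Finite τ] (w : τ → ℕ) [hw : Fact (∀ x, w x ≠ 0)] (m q : ℕ) :
    Finite (wset2 w m q) := Finite.of_equiv _ (wset2Equiv w m q).symm

lemma card_wset2 {τ : Type*} (w : τ → ℕ) (m q : ℕ) :
    Nat.card (wset2 w m q) = wcnt w m * (q+1) := by
  rw [Nat.card_congr (wset2Equiv w m q), Nat.card_prod, Nat.card_fin]; rfl

lemma finrank_rs {σ K : Type*} [Field K] (s : Set (σ →₀ ℕ)) :
    Module.finrank K (restrictSupport K s) = Nat.card s := by
  rw [Module.finrank_eq_nat_card_basis (basisRestrictSupport K s)]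

lemma weight_opt {τ : Type*} (w : Option τ → ℕ) (a : Option τ →₀ ℕ) :
    Finsupp.weight w a = Finsupp.weight (fun i => w (some i)) a.some + a none * w none := by
  simp only [Finsupp.weight_apply]
  rw [Finsupp.sum_option_index] <;> simp [add_mul, add_comm]

/-- main counting inequality -/
lemma count_ineq {τ ν K : Type*} [Finite τ] [Finite ν] [Field K] (w : τ → ℕ) (hw : ∀ x, w x ≠ 0)
    (ev : MvPolynomial (Option τ) K →ₐ[K] MvPolynomial (Option ν) K)
    (W : MvPolynomial (Option τ) K) (hW : W ≠ 0)
    (hker : ∀ U, ev U = 0 → W ∣ U)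
    (hdeg : ∀ a : Option τ →₀ ℕ, ev (monomial a 1) ∈
      restrictSupport K (wset2 (fun _ : ν => 1) (Finsupp.weight w a.some)
        (Finsupp.weight w a.some + a none)))
    (E M : ℕ) (hE : E = (wh (fun i => i.elim 0 w) W).natDegree)
    (hM : M = (wh (fun i => i.elim 1 (fun _ => 0)) W).natDegree)
    (m q : ℕ) (hm : E ≤ m) (hq : M ≤ q) :
    wcnt w m * (q+1) ≤ wcnt w (m-E) * (q - M +1) + wcnt (fun _ : ν => 1) m * (m+q+1) := by
  haveI : Fact (∀ x, w x ≠ 0) := ⟨hw⟩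
  haveI : Fact (∀ x : ν, (fun _ : ν => 1) x ≠ 0) := ⟨by simp⟩
  set D := restrictSupport K (wset2 w m q) with hD
  set D' := restrictSupport K (wset2 w (m-E) (q-M)) with hD'
  set T := restrictSupport K (wset2 (fun _ : ν => 1) m (m+q)) with hT
  have fD : Module.finrank K D = wcnt w m * (q+1) := by rw [finrank_rs, card_wset2]
  have fD' : Module.finrank K D' = wcnt w (m-E) * (q-M+1) := by rw [finrank_rs, card_wset2]
  have fT : Module.finrank K T = wcnt (fun _ : ν => 1) m * (m+q+1) := by
    rw [finrank_rs, card_wset2]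
  haveI : FiniteDimensional K D := Module.Finite.of_basis (basisRestrictSupport K _)
  haveI : FiniteDimensional K D' := Module.Finite.of_basis (basisRestrictSupport K _)
  haveI : FiniteDimensional K T := Module.Finite.of_basis (basisRestrictSupport K _)
  let L : D →ₗ[K] MvPolynomial (Option ν) K := ev.toLinearMap ∘ₗ D.subtype
  have hrange : LinearMap.range L ≤ T := by
    rw [LinearMap.range_comp, Submodule.range_subtype, hD, restrictSupport_eq_span,
      Submodule.map_span, Submodule.span_le]
    rintro _ ⟨_, ⟨a, ha, rfl⟩, rfl⟩
    refine restrictSupport_mono K ?_ (hdeg a)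
    intro b hb
    exact ⟨hb.1.trans ha.1, hb.2.trans (by have := ha.1; have := ha.2; omega)⟩
  have hkerle : (LinearMap.ker L).map D.subtype ≤ D'.map (LinearMap.mulLeft K W) := by
    rintro _ ⟨U, hU, rfl⟩
    have hU' : ev (U : MvPolynomial (Option τ) K) = 0 := hU
    obtain ⟨V, hV⟩ := hker _ hU'
    refine ⟨V, ?_, hV.symm⟩
    by_cases hV0 : V = 0
    · rw [hV0]; exact zero_mem _
    have hUD : (U : MvPolynomial (Option τ) K) ∈ restrictSupport K (wset2 w m q) := U.2
    rw [mem_restrictSupport_iff, hV] at hUD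
    have h1 : (wh (fun i => i.elim 0 w) (W * V)).natDegree ≤ m := by
      rw [wh_le_iff]
      intro a ha
      rw [weight_opt]; simpa using (hUD ha).1
    have h2 : (wh (fun i => i.elim 1 (fun _ => 0)) (W * V)).natDegree ≤ q := by
      rw [wh_le_iff]
      intro a ha
      rw [weight_opt]
      simpa [Finsupp.weight_apply] using (hUD ha).2
    rw [wh_mul _ hW hV0] at h1 h2
    have h1' : (wh (fun i => i.elim 0 w) V).natDegree ≤ m - E := by omega
    have h2' : (wh (fun i => i.elim 1 (fun _ => 0)) V).natDegree ≤ q - M := by omega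
    rw [wh_le_iff] at h1' h2'
    change V ∈ restrictSupport K _
    rw [mem_restrictSupport_iff]
    intro a ha
    have e1 := h1' a ha
    have e2 := h2' a ha
    rw [weight_opt] at e1 e2
    exact ⟨by simpa using e1, by simpa [Finsupp.weight_apply] using e2⟩
  have k1 : Module.finrank K (LinearMap.ker L) ≤ Module.finrank K D' := by
    calc _ = Module.finrank K ((LinearMap.ker L).map D.subtype) :=
          (LinearEquiv.finrank_eq (Submodule.equivMapOfInjective D.subtype D.subtype_injective _))
      _ ≤ Module.finrank K (D'.map (LinearMap.mulLeft K W)) := Submodule.finrank_mono hkerle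
      _ ≤ _ := Submodule.finrank_map_le _ _
  have k2 : Module.finrank K (LinearMap.range L) ≤ Module.finrank K T :=
    Submodule.finrank_mono hrange
  have := LinearMap.finrank_range_add_finrank_ker L
  omega
end EN

namespace EN
open MvPolynomial

lemma num_lim (a b c m M : ℕ) (h : ∀ q, M ≤ q → a * (q+1) ≤ b * (q - M + 1) + c * (m+q+1)) :
    a ≤ b + c := by
  by_contra! hlt
  have h1 := h (M + c*m) (by omega)
  have h2 : (b+c+1) * (M + c*m+1) ≤ a * (M + c*m+1) := Nat.mul_le_mul_right _ hlt
  have h3 : b * (M + c * m - M + 1) ≤ b * (M + c*m + 1) := Nat.mul_le_mul_left _ (by omega)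
  nlinarith

lemma wcnt_mono_bound {ν : Type*} [Fintype ν] (m : ℕ) :
    wcnt (fun _ : ν => 1) m ≤ (m+1)^(Fintype.card ν) := by
  classical
  have h : Function.Injective
      (fun (a : wset (fun _ : ν => 1) m) (i : ν) => (⟨a.1 i, by
        have h := a.2
        change Finsupp.weight _ _ ≤ m at h
        have := Finsupp.le_weight (fun _ : ν => 1) (s := i) one_ne_zero a.1
        omega⟩ : Fin (m+1))) := by
    intro a b hab
    ext i
    have := congrFun hab i
    simpa using this
  have := Nat.card_le_card_of_injective _ h
  rw [wcnt]
  simpa using this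

lemma wcnt_zero_pos {ν : Type*} [Finite ν] (m : ℕ) : 1 ≤ wcnt (fun _ : ν => 1) m := by
  haveI : Fact (∀ x : ν, (fun _ : ν => 1) x ≠ 0) := ⟨by simp⟩
  haveI : Nonempty (wset (fun _ : ν => 1) m) := ⟨⟨0, by simp [wset]⟩⟩
  exact Nat.card_pos

lemma wcnt_div {ν : Type*} [Fintype ν] (w : ν → ℕ) (hw : ∀ i, w i ≠ 0) (m : ℕ) :
    wcnt (fun _ : ν => 1) m ≤ wcnt w m * ∏ i, w i := by
  classical
  haveI : Fact (∀ x, w x ≠ 0) := ⟨hw⟩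
  have hmem : ∀ a : wset (fun _ : ν => 1) m,
      (Finsupp.equivFunOnFinite.symm (fun i => a.1 i / w i)) ∈ wset w m := by
    intro a
    have h := a.2
    change Finsupp.weight _ _ ≤ m at h
    change Finsupp.weight _ _ ≤ m
    refine le_trans ?_ h
    rw [Finsupp.weight_apply, Finsupp.weight_apply, Finsupp.sum_fintype _ _ (by simp),
      Finsupp.sum_fintype _ _ (by simp)]
    refine Finset.sum_le_sum fun i _ => ?_
    simpa using Nat.div_mul_le_self _ _
  let g : wset (fun _ : ν => 1) m → wset w m × (∀ i, Fin (w i)) := fun a =>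
    (⟨_, hmem a⟩, fun i => ⟨a.1 i % w i, Nat.mod_lt _ (Nat.pos_of_ne_zero (hw i))⟩)
  have hg : Function.Injective g := by
    intro a b hab
    ext i
    have h1 := congrArg (fun p => p.1.1 i) hab
    have h2 := congrArg (fun p => ((p.2 i : Fin (w i)) : ℕ)) hab
    simp only [g, Finsupp.equivFunOnFinite_symm_apply_apply] at h1 h2
    rw [← Nat.div_add_mod (a.1 i) (w i), ← Nat.div_add_mod (b.1 i) (w i), h1, h2]
  have := Nat.card_le_card_of_injective _ hg
  rw [Nat.card_prod] at this
  simpa [wcnt] using this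

lemma wcnt_split {ν : Type*} [Finite ν] (w : ν → ℕ) (hw : ∀ i, w i ≠ 0) (m E : ℕ) (hm : E ≤ m) :
    wcnt (fun i : Option ν => i.elim 1 w) (m - E) + E * wcnt w (m-E) ≤
      wcnt (fun i : Option ν => i.elim 1 w) m := by
  classical
  haveI : Fact (∀ x, w x ≠ 0) := ⟨hw⟩
  haveI : Fact (∀ x, (fun i : Option ν => i.elim 1 w) x ≠ 0) := ⟨by
    rintro (_ | i) <;> simp [hw]⟩
  have hwt : ∀ (k : ℕ) (a : ν →₀ ℕ), Finsupp.weight (fun i : Option ν => i.elim 1 w)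
      (Finsupp.optionElim k a) = Finsupp.weight w a + k := by
    intro k a
    rw [weight_opt]
    have : (Finsupp.optionElim k a).some = a := by
      ext i; simp [Finsupp.optionElim_apply_some]
    rw [this]; simp [Finsupp.optionElim_apply_none]
  have hinj : ∀ {k l : ℕ} {a b : ν →₀ ℕ}, Finsupp.optionElim k a = Finsupp.optionElim l b →
      k = l ∧ a = b := by
    intro k l a b h
    refine ⟨by simpa [Finsupp.optionElim_apply_none] using DFunLike.congr_fun h none, ?_⟩
    ext i
    simpa [Finsupp.optionElim_apply_some] using DFunLike.congr_fun h (some i)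
  have hrep : ∀ a : Option ν →₀ ℕ, a = Finsupp.optionElim (a none) a.some := by
    intro a
    ext i; cases i <;> simp [Finsupp.optionElim_apply_none, Finsupp.optionElim_apply_some]
  let g : (wset (fun i : Option ν => i.elim 1 w) (m - E)) ⊕ (Fin E × wset w (m-E)) →
      wset (fun i : Option ν => i.elim 1 w) m := fun x => match x with
    | .inl a => ⟨Finsupp.optionElim (a.1 none + E) a.1.some, by
        have h : Finsupp.weight (fun i : Option ν => i.elim 1 w) a.1 ≤ m - E := a.2
        rw [hrep a.1, hwt] at h
        change Finsupp.weight (fun i : Option ν => i.elim 1 w) _ ≤ m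
        rw [hwt]; omega⟩
    | .inr (i, a) => ⟨Finsupp.optionElim i a.1, by
        have h : Finsupp.weight w a.1 ≤ m - E := a.2
        change Finsupp.weight (fun i : Option ν => i.elim 1 w) _ ≤ m
        rw [hwt]; omega⟩
  have hg : Function.Injective g := by
    rintro (a | ⟨i, a⟩) (b | ⟨j, b⟩) hab
    · have := hinj (congrArg Subtype.val hab)
      congr 1; ext1
      rw [hrep a.1, hrep b.1, this.2]
      congr 1; omega
    · have := (hinj (congrArg Subtype.val hab)).1
      omega
    · have := (hinj (congrArg Subtype.val hab)).1
      omega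
    · have := hinj (congrArg Subtype.val hab)
      congr 1
      ext1
      · exact Fin.ext this.1
      · exact Subtype.ext this.2
  have := Nat.card_le_card_of_injective _ hg
  rw [Nat.card_sum, Nat.card_prod, Nat.card_fin] at this
  exact this

lemma num_growth (c : ℕ → ℕ) (n D E : ℕ) (hD : 0 < D) (hc : ∀ m, c m ≤ (m+1)^n)
    (hc0 : 1 ≤ c 0) (h : ∀ m, E ≤ m → E * c (m-E) ≤ D * c m) : E ≤ D := by
  by_contra! hlt
  have hpow : ∀ k, E^k ≤ D^k * c (k*E) := by
    intro k
    induction k with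
    | zero => simpa using hc0
    | succ k ih =>
      have h1 := h ((k+1)*E) (by nlinarith)
      have : (k+1)*E - E = k * E := by rw [add_mul, one_mul]; simp
      rw [this] at h1
      calc E^(k+1) = E * E^k := by ring
        _ ≤ E * (D^k * c (k*E)) := Nat.mul_le_mul_left _ ih
        _ = D^k * (E * c (k*E)) := by ring
        _ ≤ D^k * (D * c ((k+1)*E)) := Nat.mul_le_mul_left _ h1
        _ = _ := by ring
  have hE : 0 < E := by omega
  set r : ℝ := (E:ℝ)/D with hr
  have hr1 : 1 < r := by
    rw [hr, lt_div_iff₀ (by exact_mod_cast hD)]; simpa using (by exact_mod_cast hlt : (D:ℝ) < E)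
  have hlim := tendsto_pow_const_div_const_pow_of_one_lt n hr1
  have hlim2 := hlim.const_mul ((2*E : ℝ)^n)
  rw [mul_zero] at hlim2
  have := (hlim2.eventually (gt_mem_nhds (by norm_num : (0:ℝ) < 1))).and (Filter.eventually_ge_atTop 1)
  obtain ⟨k, hk1, hk⟩ := this.exists
  have h2 : r^k ≤ ((k*E+1 : ℕ) : ℝ)^n := by
    rw [hr, div_pow, div_le_iff₀ (by positivity)]
    have := (hpow k).trans (Nat.mul_le_mul_left _ (hc (k*E)))
    rw [mul_comm]
    exact_mod_cast this
  have h3 : ((k*E+1 : ℕ) : ℝ)^n ≤ (2*E*k : ℝ)^n := by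
    gcongr
    have : k * E + 1 ≤ 2*E*k := by nlinarith
    exact_mod_cast this
  have h4 : (2*E : ℝ)^n * ((k:ℝ)^n / r^k) ≥ 1 := by
    rw [← mul_div_assoc, ge_iff_le, le_div_iff₀ (by positivity), one_mul, ← mul_pow]
    exact h2.trans h3
  linarith

lemma weight_bound {ν K : Type*} [Fintype ν] [Field K] (w : ν → ℕ) (hw : ∀ x, w x ≠ 0)
    (ev : MvPolynomial (Option (Option ν)) K →ₐ[K] MvPolynomial (Option ν) K)
    (W : MvPolynomial (Option (Option ν)) K) (hW : W ≠ 0)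
    (hker : ∀ U, ev U = 0 → W ∣ U)
    (hdeg : ∀ a : Option (Option ν) →₀ ℕ, ev (monomial a 1) ∈
      restrictSupport K (wset2 (fun _ : ν => 1)
        (Finsupp.weight (fun i : Option ν => i.elim 1 w) a.some)
        (Finsupp.weight (fun i : Option ν => i.elim 1 w) a.some + a none))) :
    (wh (fun i => i.elim 0 (fun i : Option ν => i.elim 1 w)) W).natDegree ≤ ∏ i, w i := by
  have hw' : ∀ x, (fun i : Option ν => i.elim 1 w) x ≠ 0 := by rintro (_ | i) <;> simp [hw]
  set E := (wh (fun i => i.elim 0 (fun i : Option ν => i.elim 1 w)) W).natDegree with hE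
  refine num_growth (fun m => wcnt (fun _ : ν => 1) m) (Fintype.card ν) _ E
    (Finset.prod_pos fun i _ => Nat.pos_of_ne_zero (hw i))
    wcnt_mono_bound (wcnt_zero_pos 0) ?_
  intro m hm
  have h1 := num_lim _ _ _ _ _ (fun q hq => count_ineq _ hw' ev W hW hker hdeg E _ hE rfl m q hm hq)
  have h2 := wcnt_split w hw m E hm
  have h3 := wcnt_div w hw (m-E)
  have h4 : E * wcnt w (m-E) ≤ wcnt (fun _ : ν => 1) m := by omega
  calc E * wcnt (fun _ : ν => 1) (m-E) ≤ E * (wcnt w (m-E) * ∏ i, w i) := Nat.mul_le_mul_left _ h3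
    _ = (∏ i, w i) * (E * wcnt w (m-E)) := by ring
    _ ≤ _ := Nat.mul_le_mul_left _ h4
end EN

namespace EN
open MvPolynomial

lemma lin_subst {σ K R : Type*} [Field K] [CommRing R] [Algebra K R] (a : σ → R) (c : σ → K)
    (m : σ →₀ ℕ) :
    let q := aeval (fun i => Polynomial.C (a i) + Polynomial.C (algebraMap K R (c i)) * Polynomial.X)
      (monomial m (1:K))
    q.natDegree ≤ m.degree ∧ q.coeff m.degree = algebraMap K R (eval c (monomial m (1:K))) := by
  induction m using Finsupp.induction_linear with
  | zero => 
    have : (monomial (0 : σ →₀ ℕ)) (1:K) = 1 := rfl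
    simp only [this, map_one, map_zero]
    simp
  | add f g hf hg =>
    have : monomial (f+g) (1:K) = monomial f 1 * monomial g 1 := by simp [monomial_mul]
    simp only [this, map_mul, map_add]
    refine ⟨(Polynomial.natDegree_mul_le).trans (add_le_add hf.1 hg.1), ?_⟩
    rw [Polynomial.coeff_mul_add_eq_of_natDegree_le hf.1 hg.1, hf.2, hg.2]
  | single i k =>
    rw [← X_pow_eq_monomial]
    simp only [map_pow, aeval_X, eval_X, Finsupp.degree_single]
    have h1 : (Polynomial.C (a i) + Polynomial.C (algebraMap K R (c i)) * Polynomial.X).natDegree ≤ 1 := by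
      compute_degree
    refine ⟨(Polynomial.natDegree_pow_le_of_le k h1).trans (by simp), ?_⟩
    have := Polynomial.coeff_pow_of_natDegree_le (m := k) h1
    rw [mul_one] at this
    rw [this]
    simp

lemma lin_subst' {σ K R : Type*} [Field K] [CommRing R] [Algebra K R] (a : σ → R) (c : σ → K)
    (Q : MvPolynomial σ K) (D : ℕ) (hD : Q.totalDegree ≤ D) :
    let q := aeval (fun i => Polynomial.C (a i) + Polynomial.C (algebraMap K R (c i)) * Polynomial.X) Q
    q.natDegree ≤ D ∧ q.coeff D = algebraMap K R (eval c (homogeneousComponent D Q)) := by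
  intro q
  have hq : q = ∑ m ∈ Q.support, coeff m Q • aeval (fun i => Polynomial.C (a i) + Polynomial.C (algebraMap K R (c i)) * Polynomial.X) (monomial m (1:K)) := by
    conv_lhs => rw [show q = aeval (fun i => Polynomial.C (a i) + Polynomial.C (algebraMap K R (c i)) * Polynomial.X) Q from rfl, Q.as_sum]
    rw [map_sum]
    refine Finset.sum_congr rfl fun m _ => ?_
    rw [← map_smul, smul_monomial, smul_eq_mul, mul_one]
  have hd : ∀ m ∈ Q.support, m.degree ≤ D := fun m hm => (by
    have := le_totalDegree hm
    rw [Finsupp.degree_apply]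
    exact this.trans hD)
  constructor
  · rw [hq]
    refine Polynomial.natDegree_sum_le_of_forall_le _ _ fun m hm => ?_
    exact (Polynomial.natDegree_smul_le _ _).trans ((lin_subst a c m).1.trans (hd m hm))
  · rw [hq, Polynomial.finset_sum_coeff, homogeneousComponent_apply, map_sum, map_sum,
      Finset.sum_filter]
    refine Finset.sum_congr rfl fun m hm => ?_
    rw [Polynomial.coeff_smul]
    split_ifs with h
    · rw [← h, (lin_subst a c m).2, ← mul_one (coeff m Q), ← smul_eq_mul, ← smul_monomial]
      rw [smul_eq_mul, mul_one, smul_eval, map_mul, Algebra.smul_def]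
    · rw [Polynomial.coeff_eq_zero_of_natDegree_lt, smul_zero]
      exact lt_of_le_of_lt (lin_subst a c m).1 (lt_of_le_of_ne (hd m hm) h)

lemma noether_step {σ K B : Type*} [Field K] [CommRing B] [Algebra K B] (Q : MvPolynomial σ K)
    (y : σ → B) (hQ : aeval y Q = 0) (s : σ) (c : σ → K)
    (hc : eval c (homogeneousComponent Q.totalDegree Q) ≠ 0) :
    IsIntegral (Algebra.adjoin K (Set.range (fun i => y i - c i • y s))) (y s) := by
  set S := Algebra.adjoin K (Set.range (fun i => y i - c i • y s)) with hS
  let a : σ → S := fun i => ⟨y i - c i • y s, Algebra.subset_adjoin ⟨i, rfl⟩⟩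
  set q := aeval (fun i => Polynomial.C (a i) + Polynomial.C (algebraMap K S (c i)) * Polynomial.X) Q with hq
  obtain ⟨h1, h2⟩ := lin_subst' a c Q _ le_rfl
  rw [← hq] at h1 h2
  set e := eval c (homogeneousComponent Q.totalDegree Q)
  refine ⟨Polynomial.C (algebraMap K S e⁻¹) * q, ?_, ?_⟩
  · refine Polynomial.monic_of_natDegree_le_of_coeff_eq_one Q.totalDegree ?_ ?_
    · exact (Polynomial.natDegree_C_mul_le _ _).trans h1
    · rw [Polynomial.coeff_C_mul, h2, ← map_mul, inv_mul_cancel₀ hc, map_one]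
  · rw [Polynomial.eval₂_mul]
    have : Polynomial.eval₂ (algebraMap S B) (y s) q = aeval y Q := by
      rw [hq]
      have : Polynomial.eval₂ (algebraMap S B) (y s) = (Polynomial.aeval (R := S) (y s)) := by
        ext; rfl
      rw [this]
      change ((Polynomial.aeval (R := S) (y s)).restrictScalars K) _ = _
      rw [← AlgHom.comp_apply]
      congr 1
      apply MvPolynomial.algHom_ext
      intro i
      simp only [AlgHom.comp_apply, aeval_X, AlgHom.coe_restrictScalars', map_add, map_mul,
        Polynomial.aeval_C, Polynomial.aeval_X]
      simp only [a, ← IsScalarTower.algebraMap_apply K S B]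
      rw [← Algebra.smul_def]
      change y i - c i • y s + _ = _
      simp
    rw [this, hQ, mul_zero]

lemma integral_trans' {K B : Type*} [Field K] [CommRing B] [Algebra K B] {S S' : Subalgebra K B}
    (h : ∀ x ∈ S, IsIntegral S' x) {x : B} (hx : IsIntegral S x) : IsIntegral S' x := by
  have : IsIntegral (integralClosure S' B) x := by
    let f : S →+* integralClosure S' B :=
      { toFun := fun z => ⟨z.1, h z.1 z.2⟩
        map_one' := rfl
        map_zero' := rfl
        map_add' := fun _ _ => rfl
        map_mul' := fun _ _ => rfl }
    obtain ⟨p, hp, hp0⟩ := hx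
    refine ⟨p.map f, hp.map f, ?_⟩
    rw [Polynomial.eval₂_map]
    exact hp0
  exact isIntegral_trans (R := S') (A := integralClosure S' B) x this

lemma integral_adjoin {K B : Type*} [Field K] [CommRing B] [Algebra K B] {s : Set B}
    {S' : Subalgebra K B} (h : ∀ x ∈ s, IsIntegral S' x) {x : B}
    (hx : IsIntegral (Algebra.adjoin K s) x) : IsIntegral S' x := by
  refine integral_trans' (fun z hz => ?_) hx
  have : Algebra.adjoin K s ≤ (integralClosure S' B).restrictScalars K :=
    Algebra.adjoin_le fun z hz => h z hz
  exact this hz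
end EN

namespace EN
open MvPolynomial

lemma homog_eval_smul {σ K : Type*} [Field K] {p : MvPolynomial σ K} {d : ℕ}
    (hp : p.IsHomogeneous d) (t : K) (c : σ → K) :
    eval (fun i => t * c i) p = t ^ d * eval c p := by
  rw [eval_eq, eval_eq, Finset.mul_sum]
  refine Finset.sum_congr rfl fun m hm => ?_
  have h := hp (mem_support_iff.mp hm)
  rw [Finsupp.weight_apply, Finsupp.sum] at h
  simp only [Pi.one_apply, smul_eq_mul, mul_one] at h
  simp only [mul_pow, Finset.prod_mul_distrib]
  rw [Finset.prod_pow_eq_pow_sum, h]; ring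

lemma homogComp_top_ne {σ K : Type*} [Field K] {p : MvPolynomial σ K} (hp : p ≠ 0) :
    homogeneousComponent p.totalDegree p ≠ 0 := by
  obtain ⟨m, hm, hm'⟩ := Finset.exists_mem_eq_sup p.support (support_nonempty.mpr hp)
    (fun s => s.sum fun _ e => e)
  intro h
  have := congrArg (coeff m) h
  rw [coeff_homogeneousComponent, if_pos] at this
  · exact (mem_support_iff.mp hm) (by simpa using this)
  · rw [Finsupp.degree_apply]; exact hm'.symm

lemma exists_eval_ne {σ K : Type*} [Field K] [Infinite K] {p : MvPolynomial σ K} (hp : p ≠ 0) :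
    ∃ c, eval c p ≠ 0 := by
  by_contra! h
  exact hp (MvPolynomial.funext fun c => by simpa using h c)

/-- linear form with coefficients `v`-/
noncomputable def lf {n : ℕ} {K : Type*} [Field K] (v : Fin n → K) : MvPolynomial (Fin n) K :=
  ∑ i, C (v i) * X i

lemma eval_lf {n : ℕ} {K : Type*} [Field K] (v p : Fin n → K) : eval p (lf v) = ∑ i, v i * p i := by
  simp [lf]

lemma lf_sub_smul {n : ℕ} {K : Type*} [Field K] (v u : Fin n → K) (c : K) :
    lf (v - c • u) = lf v - c • lf u := by
  simp only [lf, Finset.smul_sum, ← Finset.sum_sub_distrib]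
  refine Finset.sum_congr rfl fun i _ => ?_
  simp [smul_eq_C_mul, map_sub, map_mul]; ring

noncomputable def incl {n : ℕ} {K : Type*} [Field K] :
    MvPolynomial (Fin n) K →ₐ[K] MvPolynomial (Option (Fin n)) K := rename some

lemma not_algInd {ι : Type*} [Fintype ι] {n : ℕ} {K : Type*} [Field K]
    (y : ι → MvPolynomial (Option (Fin n)) K) (h : n + 1 < Fintype.card ι) :
    ∃ Q : MvPolynomial ι K, Q ≠ 0 ∧ aeval y Q = 0 := by
  by_contra! hcon
  have hind : AlgebraicIndependent K y := by
    rw [algebraicIndependent_iff]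
    intro p hp; by_contra hne; exact hcon p hne hp
  have := hind.lift_cardinalMk_le_trdeg
  rw [MvPolynomial.trdeg_of_isDomain] at this
  simp only [Cardinal.mk_fintype, Cardinal.lift_natCast, Nat.cast_le, Fintype.card_option,
    Fintype.card_fin] at this
  omega

/-- The generators after eliminating down to `m` linear forms. -/
noncomputable def gens {n m : ℕ} {K : Type*} [Field K] (F : Fin n → MvPolynomial (Fin n) K)
    (u : Fin n → Fin n → K) (l : Fin m → Fin n → K) : Fin n ⊕ Fin m → MvPolynomial (Option (Fin n)) K :=
  Sum.elim (fun i => incl (F i) * X none - incl (lf (u i))) (fun j => incl (lf (l j)))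

lemma elim_step {n m : ℕ} {K : Type*} [Field K] [Infinite K] {β : Type*} [Fintype β]
    (F : β → Fin n → MvPolynomial (Fin n) K) (W : Finset (Fin n → K)) (hm : 1 ≤ m)
    (u : β → Fin n → Fin n → K) (l : Fin (m+1) → Fin n → K)
    (hint : ∀ b j, IsIntegral (Algebra.adjoin K (Set.range (gens (F b) (u b) l)))
      (X (some j) : MvPolynomial (Option (Fin n)) K))
    (hsep : ∀ p ∈ W, ∀ q ∈ W, p ≠ q → ∃ j, eval p (lf (l j)) ≠ eval q (lf (l j))) :
    ∃ (u' : β → Fin n → Fin n → K) (l' : Fin m → Fin n → K),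
      (∀ b j, IsIntegral (Algebra.adjoin K (Set.range (gens (F b) (u' b) l')))
      (X (some j) : MvPolynomial (Option (Fin n)) K)) ∧
      (∀ p ∈ W, ∀ q ∈ W, p ≠ q → ∃ j, eval p (lf (l' j)) ≠ eval q (lf (l' j))) := by
  classical
  have hQ : ∀ b, ∃ Q : MvPolynomial (Fin n ⊕ Fin (m+1)) K, Q ≠ 0 ∧
      aeval (gens (F b) (u b) l) Q = 0 := fun b => not_algInd _ (by simp; omega)
  choose Q hQ0 hQ using hQ
  let γ := (β × Fin n) ⊕ Fin (m+1)
  let em : β → Fin n ⊕ Fin (m+1) → γ := fun b => Sum.map (fun i => (b, i)) id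
  have hem : ∀ b, Function.Injective (em b) := fun b =>
    Function.Injective.sumMap (fun i j h => (Prod.mk.inj h).2) Function.injective_id
  let v : (Fin n → K) → (Fin n → K) → Fin (m+1) → K := fun p q j =>
    eval p (lf (l j)) - eval q (lf (l j))
  let sf : (Fin n → K) × (Fin n → K) → MvPolynomial γ K := fun pq =>
    if v pq.1 pq.2 (Fin.last m) = 0 then 1 else
      X (.inr 0) * C (v pq.1 pq.2 (Fin.last m)) - X (.inr (Fin.last m)) * C (v pq.1 pq.2 0)
  have h0l : (0 : Fin (m+1)) ≠ Fin.last m := by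
    intro h; have := congrArg Fin.val h; simp at this; omega
  have hsf : ∀ pq, sf pq ≠ 0 := by
    intro pq
    simp only [sf]
    split_ifs with h
    · exact one_ne_zero
    · intro h0
      have := congrArg (eval (fun i : γ => if i = .inr 0 then (1:K) else 0)) h0
      have hne : (Sum.inr (Fin.last m) : γ) ≠ Sum.inr 0 := fun h => h0l (Sum.inr.inj h).symm
      simp [hne] at this
      exact h this
  let G : MvPolynomial γ K := (∏ b, rename (em b) (homogeneousComponent (Q b).totalDegree (Q b))) *
    X (.inr (Fin.last m)) * ∏ pq ∈ W ×ˢ W, sf pq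
  have hG : G ≠ 0 := by
    refine mul_ne_zero (mul_ne_zero ?_ (X_ne_zero _)) ?_
    · refine Finset.prod_ne_zero_iff.mpr fun b _ => ?_
      intro h
      exact homogComp_top_ne (hQ0 b) (rename_injective _ (hem b) (by simpa using h))
    · exact Finset.prod_ne_zero_iff.mpr fun pq _ => hsf pq
  obtain ⟨c, hc⟩ := exists_eval_ne hG
  simp only [G, map_mul, map_prod, eval_X, eval_rename] at hc
  have hc2 : c (.inr (Fin.last m)) ≠ 0 := by
    intro h; rw [h] at hc; simp at hc
  have hc1 : ∀ b, eval (c ∘ em b) (homogeneousComponent (Q b).totalDegree (Q b)) ≠ 0 := fun b h => by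
    apply hc; rw [Finset.prod_eq_zero (Finset.mem_univ b) h]; simp
  have hc3 : ∀ p ∈ W, ∀ q ∈ W, eval c (sf (p,q)) ≠ 0 := fun p hp q hq h => by
    apply hc; rw [Finset.prod_eq_zero (Finset.mk_mem_product hp hq) h]; simp
  set t := (c (.inr (Fin.last m)))⁻¹ with ht
  refine ⟨fun b i => u b i + (t * c (.inl (b, i))) • l (Fin.last m),
    fun j => l j.castSucc - (t * c (.inr j.castSucc)) • l (Fin.last m), ?_, ?_⟩
  · intro b j
    have key := noether_step (Q b) (gens (F b) (u b) l) (hQ b) (.inr (Fin.last m))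
      (fun i => t * (c ∘ em b) i) (by
        rw [homog_eval_smul (homogeneousComponent_isHomogeneous _ _)]
        exact mul_ne_zero (pow_ne_zero _ (inv_ne_zero hc2)) (hc1 b))
    set y := gens (F b) (u b) l with hy
    set S' := Algebra.adjoin K (Set.range (gens (F b) (fun i => u b i + (t * c (.inl (b, i))) • l (Fin.last m))
      (fun j : Fin m => l j.castSucc - (t * c (.inr j.castSucc)) • l (Fin.last m)))) with hS'
    have hmem : ∀ i, y i - (t * (c ∘ em b) i) • y (.inr (Fin.last m)) ∈ S' := by
      rintro (i | j)
      · refine Algebra.subset_adjoin ⟨.inl i, ?_⟩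
        simp only [hy, gens, Sum.elim_inl, Sum.elim_inr]
        have : u b i + (t * c (.inl (b, i))) • l (Fin.last m) =
          u b i - (-(t * c (.inl (b, i)))) • l (Fin.last m) := by simp
        rw [this, lf_sub_smul, map_sub, map_smul]
        simp [em]; ring
      · induction j using Fin.lastCases with
        | last =>
          have : t * (c ∘ em b) (.inr (Fin.last m)) = 1 := by
            simp [em, ht, hc2]
          rw [this, one_smul, sub_self]; exact zero_mem _
        | cast j =>
          refine Algebra.subset_adjoin ⟨.inr j, ?_⟩
          simp only [hy, gens, Sum.elim_inr]
          rw [lf_sub_smul, map_sub, map_smul]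
          simp [em]
    have hlast : IsIntegral S' (y (.inr (Fin.last m))) := by
      refine integral_adjoin ?_ key
      rintro _ ⟨i, rfl⟩
      exact isIntegral_algebraMap (R := S') (x := ⟨_, hmem i⟩)
    refine integral_adjoin ?_ (hint b j)
    rintro _ ⟨i, rfl⟩
    have e : y i = (y i - (t * (c ∘ em b) i) • y (.inr (Fin.last m))) +
      (algebraMap K S' (t * (c ∘ em b) i)) • y (.inr (Fin.last m)) := by
      rw [algebraMap_smul]; simp
    change IsIntegral S' (y i)
    rw [e]
    exact (isIntegral_algebraMap (R := S') (x := ⟨_, hmem i⟩)).add (hlast.smul _)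
  · intro p hp q hq hpq
    have hv' : ∀ j : Fin m, eval p (lf (l j.castSucc - (t * c (.inr j.castSucc)) • l (Fin.last m))) -
        eval q (lf (l j.castSucc - (t * c (.inr j.castSucc)) • l (Fin.last m))) =
        v p q j.castSucc - t * c (.inr j.castSucc) * v p q (Fin.last m) := by
      intro j; rw [lf_sub_smul]; simp [v, smul_eval]; ring
    by_cases hv : v p q (Fin.last m) = 0
    · obtain ⟨j, hj⟩ := hsep p hp q hq hpq
      induction j using Fin.lastCases with
      | last => exact absurd (sub_eq_zero.mp hv) hj
      | cast j =>
        refine ⟨j, ?_⟩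
        rw [← sub_ne_zero, hv', hv, mul_zero, sub_zero]
        exact sub_ne_zero.mpr hj
    · refine ⟨⟨0, hm⟩, ?_⟩
      have h0 : (⟨0, hm⟩ : Fin m).castSucc = 0 := rfl
      rw [← sub_ne_zero, hv', h0]
      have := hc3 p hp q hq
      simp only [sf, if_neg hv, map_sub, map_mul, eval_X, eval_C] at this
      intro h
      apply this
      have e : c (.inr (Fin.last m)) * (v p q 0 - t * c (.inr 0) * v p q (Fin.last m)) = 0 := by
        rw [h, mul_zero]
      rw [mul_sub, ← mul_assoc, ← mul_assoc, ht, mul_inv_cancel₀ hc2, one_mul] at e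
      linear_combination -e

lemma elim_all {n : ℕ} (hn : 1 ≤ n) {K : Type*} [Field K] [Infinite K] {β : Type*} [Fintype β]
    (F : β → Fin n → MvPolynomial (Fin n) K) (W : Finset (Fin n → K)) :
    ∃ (u : β → Fin n → Fin n → K) (l : Fin 1 → Fin n → K),
      (∀ b j, IsIntegral (Algebra.adjoin K (Set.range (gens (F b) (u b) l)))
      (X (some j) : MvPolynomial (Option (Fin n)) K)) ∧
      (∀ p ∈ W, ∀ q ∈ W, p ≠ q → ∃ j, eval p (lf (l j)) ≠ eval q (lf (l j))) := by
  have main : ∀ k, k + 1 ≤ n → ∃ (u : β → Fin n → Fin n → K) (l : Fin (n-k) → Fin n → K),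
      (∀ b j, IsIntegral (Algebra.adjoin K (Set.range (gens (F b) (u b) l)))
      (X (some j) : MvPolynomial (Option (Fin n)) K)) ∧
      (∀ p ∈ W, ∀ q ∈ W, p ≠ q → ∃ j, eval p (lf (l j)) ≠ eval q (lf (l j))) := by
    intro k
    induction k with
    | zero =>
      intro _
      have hl : ∀ j : Fin n, lf (Pi.single j (1:K)) = X j := by
        intro j
        rw [lf, Finset.sum_eq_single j]
        · simp
        · intro i _ hij; simp [Pi.single_eq_of_ne hij]
        · simp
      refine ⟨0, fun j => Pi.single j 1, ?_, ?_⟩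
      · intro b j
        refine isIntegral_algebraMap (R := Algebra.adjoin K (Set.range (gens (F b) ((0 : β → Fin n → Fin n → K) b) (fun j => Pi.single j 1)))) (x := ⟨X (some j), ?_⟩)
        refine Algebra.subset_adjoin ⟨.inr j, ?_⟩
        simp only [gens, Sum.elim_inr]
        rw [hl, incl, rename_X]
      · intro p hp q hq hpq
        obtain ⟨j, hj⟩ := Function.ne_iff.mp hpq
        refine ⟨j, ?_⟩
        rw [hl]; simpa using hj
    | succ k ih =>
      intro hk
      obtain ⟨m, hm⟩ : ∃ m, n - k = m + 1 := ⟨n-k-1, by omega⟩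
      have hm' : n - (k+1) = m := by omega
      rw [hm'] 
      rw [hm] at ih
      obtain ⟨u, l, h1, h2⟩ := ih (by omega)
      exact elim_step F W (by omega) u l h1 h2
  have := main (n-1) (by omega)
  rwa [show n - (n-1) = 1 by omega] at this
end EN

namespace EN
open MvPolynomial

lemma gauss_ker {P B : Type*} [CommRing P] [IsDomain P] [UniqueFactorizationMonoid P]
    [CommRing B] [IsDomain B] (φ : P →+* B) (hφ : Function.Injective φ) (z : B) (σ : P)
    (hσ : σ ≠ 0) (g : Polynomial P) (hg : g.Monic) (hgz : Polynomial.eval₂ φ (φ σ * z) g = 0) :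
    ∃ W : Polynomial P, W ≠ 0 ∧ Polynomial.eval₂ φ z W = 0 ∧
      (∀ U, Polynomial.eval₂ φ z U = 0 → W ∣ U) ∧ ∃ k, W.leadingCoeff ∣ σ ^ k := by
  classical
  letI : NormalizedGCDMonoid P := Classical.choice inferInstance
  have hC : ∀ c : P, Polynomial.eval₂ φ z (Polynomial.C c) = 0 → c = 0 := by
    intro c hc
    rw [Polynomial.eval₂_C] at hc
    exact hφ (by rw [hc, map_zero])
  let I := RingHom.ker (Polynomial.eval₂RingHom φ z)
  set U0 := g.comp (Polynomial.C σ * Polynomial.X) with hU0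
  have hdeg1 : (Polynomial.C σ * Polynomial.X : Polynomial P).natDegree = 1 :=
    Polynomial.natDegree_C_mul_X _ hσ
  have hU0I : Polynomial.eval₂ φ z U0 = 0 := by
    rw [hU0, Polynomial.eval₂_comp]
    simpa using hgz
  have hlc : U0.leadingCoeff = σ ^ g.natDegree := by
    rw [hU0, Polynomial.leadingCoeff_comp (by rw [hdeg1]; exact one_ne_zero), hg.leadingCoeff]
    simp
  have hU0ne : U0 ≠ 0 := by
    intro h; rw [h] at hlc; simp at hlc
    exact pow_ne_zero _ hσ hlc.symm
  have hI : I ≠ ⊥ := by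
    intro h
    have : U0 ∈ I := hU0I
    rw [h] at this
    exact hU0ne this
  haveI : I.IsPrime := RingHom.ker_isPrime _
  obtain ⟨W, hWI, hW⟩ := Ideal.IsPrime.exists_mem_prime_of_ne_bot this hI
  have hWz : Polynomial.eval₂ φ z W = 0 := hWI
  have hWdeg : W.natDegree ≠ 0 := by
    intro h
    rw [Polynomial.eq_C_of_natDegree_eq_zero h] at hWz
    have := hC _ hWz
    apply hW.ne_zero
    rw [Polynomial.eq_C_of_natDegree_eq_zero h, this, map_zero]
  have hprim : W.IsPrimitive := hW.irreducible.isPrimitive hWdeg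
  let K' := FractionRing P
  let L := FractionRing B
  let ψ : K' →+* L := IsFractionRing.map (K := K') (L := L) hφ
  letI := ψ.toAlgebra
  have hirr : Irreducible (W.map (algebraMap P K')) :=
    (hprim.irreducible_iff_irreducible_map_fraction_map).mp hW.irreducible
  have hzero : ∀ U, Polynomial.eval₂ φ z U = 0 →
      Polynomial.aeval (algebraMap B L z) (U.map (algebraMap P K')) = 0 := by
    intro U hU
    rw [Polynomial.aeval_def, Polynomial.eval₂_map]
    have : (algebraMap K' L).comp (algebraMap P K') = (algebraMap B L).comp φ := by
      ext c
      change ψ (algebraMap P K' c) = _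
      simp only [ψ, IsFractionRing.map]
      rw [IsLocalization.map_eq]; rfl
    rw [this, ← Polynomial.hom_eval₂, hU, map_zero]
  have hdvd : ∀ U, Polynomial.eval₂ φ z U = 0 → W ∣ U := by
    intro U hU
    apply hprim.dvd_of_fraction_map_dvd_fraction_map (K := K')
    have h1 : minpoly K' (algebraMap B L z) ∣ W.map (algebraMap P K') := minpoly.dvd _ _ (hzero W hWz)
    have h2 : minpoly K' (algebraMap B L z) ∣ U.map (algebraMap P K') := minpoly.dvd _ _ (hzero U hU)
    have hint : IsIntegral K' (algebraMap B L z) := by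
      rw [← isAlgebraic_iff_isIntegral]
      exact ⟨_, hirr.ne_zero, hzero W hWz⟩
    have h3 : Associated (minpoly K' (algebraMap B L z)) (W.map (algebraMap P K')) :=
      (minpoly.irreducible hint).associated_of_dvd hirr h1
    exact h3.symm.dvd.trans h2
  refine ⟨W, hW.ne_zero, hWz, hdvd, g.natDegree, ?_⟩
  obtain ⟨V, hV⟩ := hdvd U0 hU0I
  rw [← hlc, hV, Polynomial.leadingCoeff_mul]
  exact dvd_mul_right _ _

lemma algInd_of {n : ℕ} {K : Type*} [Field K]
    (g : Option (Fin n) → MvPolynomial (Option (Fin n)) K)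
    (hx : ∀ j, IsIntegral (Algebra.adjoin K (Set.range g)) (X (some j) : MvPolynomial (Option (Fin n)) K))
    (c : MvPolynomial (Option (Fin n)) K) (hc : c ∈ Algebra.adjoin K (Set.range g)) (hc0 : c ≠ 0)
    (hz : IsIntegral (Algebra.adjoin K (Set.range g)) (c * X none)) :
    AlgebraicIndependent K g := by
  set S := Algebra.adjoin K (Set.range g) with hS
  haveI : Algebra.IsAlgebraic (Algebra.adjoin K (Set.range g)) (MvPolynomial (Option (Fin n)) K) := by
    constructor
    intro p
    have hcc : ∀ s : S, IsAlgebraic S (s : MvPolynomial (Option (Fin n)) K) := fun s =>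
      isAlgebraic_algebraMap (A := MvPolynomial (Option (Fin n)) K) s
    have hX : ∀ i, IsAlgebraic S (X i : MvPolynomial (Option (Fin n)) K) := by
      rintro (_ | j)
      · exact IsAlgebraic.of_mul (mem_nonZeroDivisors_of_ne_zero hc0) (hcc ⟨c, hc⟩) hz.isAlgebraic
      · exact (hx j).isAlgebraic
    induction p using MvPolynomial.induction_on with
    | C a => exact hcc (algebraMap K S a)
    | add p q hp hq => exact hp.add hq
    | mul_X p i hp => exact hp.mul (hX i)
  refine (Algebra.IsAlgebraic.isTranscendenceBasis_of_lift_le_trdeg_of_finite K g ?_).1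
  rw [MvPolynomial.trdeg_of_isDomain]
  simp

lemma divisor_uni {n : ℕ} {K : Type*} [Field K] (c : MvPolynomial (Option (Fin n)) K)
    (s : Polynomial K) (hs : s ≠ 0) (h : c ∣ Polynomial.aeval (X none) s) :
    ∃ φ : Polynomial K, φ ∣ s ∧ c = Polynomial.aeval (X none) φ := by
  let e := optionEquivRight K (Fin n)
  have he : ∀ p : Polynomial K, e (Polynomial.aeval (X none) p) = C p := by
    intro p
    induction p using Polynomial.induction_on' with
    | add p q hp hq => simp [hp, hq]
    | monomial k a =>
      rw [Polynomial.aeval_monomial, map_mul, map_pow]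
      have h1 : e (X none) = C Polynomial.X := by simp [e]
      have h2 : e (algebraMap K _ a) = C (Polynomial.C a) := by
        rw [← optionEquivRight_C]; rfl
      rw [h1, h2, ← map_pow, ← map_mul, Polynomial.C_mul_X_pow_eq_monomial]
  obtain ⟨c', hc'⟩ := h
  have h1 : C s = e c * e c' := by rw [← map_mul, ← hc', he]
  have hne : e c * e c' ≠ 0 := by rw [← h1]; simpa using hs
  have hd := totalDegree_mul_of_isDomain (left_ne_zero_of_mul hne) (right_ne_zero_of_mul hne)
  rw [← h1, totalDegree_C] at hd
  obtain hd1 : (e c).totalDegree = 0 := by omega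
  obtain hd2 : (e c').totalDegree = 0 := by omega
  rw [totalDegree_eq_zero_iff_eq_C] at hd1 hd2
  refine ⟨coeff 0 (e c), ⟨coeff 0 (e c'), ?_⟩, ?_⟩
  · rw [hd1, hd2, ← C_mul] at h1
    simpa using C_injective _ _ h1
  · apply e.injective
    rw [he, ← hd1]
end EN

namespace EN
open MvPolynomial

/-- `g ∈ (F)_{≤ m}` -/
def IFm {n : ℕ} {K ι : Type*} [Field K] [Fintype ι] (F : ι → MvPolynomial (Fin n) K) (m : ℕ)
    (g : MvPolynomial (Fin n) K) : Prop :=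
  ∃ h : ι → MvPolynomial (Fin n) K, g = ∑ i, h i * F i ∧ ∀ i, (h i * F i).totalDegree ≤ m

section IFm
variable {n : ℕ} {K ι : Type*} [Field K] [Fintype ι] {F : ι → MvPolynomial (Fin n) K} {m m' : ℕ}
  {g g' : MvPolynomial (Fin n) K}

lemma IFm.zero : IFm F m 0 := ⟨0, by simp, by simp⟩

lemma IFm.add (h : IFm F m g) (h' : IFm F m g') : IFm F m (g + g') := by
  obtain ⟨a, ha, hd⟩ := h
  obtain ⟨b, hb, hd'⟩ := h'
  refine ⟨a + b, ?_, fun i => ?_⟩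
  · rw [ha, hb, ← Finset.sum_add_distrib]
    exact Finset.sum_congr rfl fun i _ => by simp [add_mul]
  · rw [Pi.add_apply, add_mul]
    exact (totalDegree_add _ _).trans (max_le (hd i) (hd' i))

lemma IFm.sum {κ : Type*} (s : Finset κ) (f : κ → MvPolynomial (Fin n) K)
    (h : ∀ k ∈ s, IFm F m (f k)) : IFm F m (∑ k ∈ s, f k) := by
  classical
  induction s using Finset.induction_on with
  | empty => simpa using IFm.zero
  | insert a s ha ih =>
    rw [Finset.sum_insert ha]
    exact (h a (Finset.mem_insert_self _ _)).add (ih fun k hk => h k (Finset.mem_insert_of_mem hk))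

lemma IFm.mul (h : IFm F m g) (h' : g'.totalDegree ≤ m') : IFm F (m + m') (g * g') := by
  obtain ⟨a, ha, hd⟩ := h
  refine ⟨fun i => a i * g', ?_, fun i => ?_⟩
  · rw [ha, Finset.sum_mul]; exact Finset.sum_congr rfl fun i _ => by ring
  · rw [mul_right_comm]; exact (totalDegree_mul _ _).trans (add_le_add (hd i) h')

lemma IFm.mul' (h : IFm F m g) (h' : g'.totalDegree ≤ m') : IFm F (m' + m) (g' * g) := by
  rw [add_comm, mul_comm]; exact h.mul h'

lemma IFm.mono (h : IFm F m g) (hm : m ≤ m') : IFm F m' g := by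
  obtain ⟨a, ha, hd⟩ := h
  exact ⟨a, ha, fun i => (hd i).trans hm⟩

lemma IFm.neg (h : IFm F m g) : IFm F m (-g) := by
  have := h.mul' (g' := C (-1 : K)) (m' := 0) (by simp)
  simpa using this

lemma IFm.totalDegree_le (h : IFm F m g) : g.totalDegree ≤ m := by
  obtain ⟨a, ha, hd⟩ := h
  rw [ha]
  exact totalDegree_finsetSum_le fun i _ => hd i

lemma IFm.of_mem (i : ι) (h : (F i).totalDegree ≤ m) : IFm F m (F i) := by
  classical
  refine ⟨Pi.single i 1, ?_, fun j => ?_⟩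
  · rw [Finset.sum_eq_single i] <;> simp +contextual [Pi.single_eq_of_ne]
  · by_cases hj : j = i
    · subst hj; simpa using h
    · simp [Pi.single_eq_of_ne hj]

/-- `good` elements -/
def good (F : ι → MvPolynomial (Fin n) K) (m : ℕ) (p : Polynomial (MvPolynomial (Fin n) K)) : Prop :=
  (p.coeff 0).totalDegree ≤ m ∧ ∀ i, 1 ≤ i → IFm F m (p.coeff i)

lemma good.mul {p q : Polynomial (MvPolynomial (Fin n) K)} (hp : good F m p) (hq : good F m' q) :
    good F (m + m') (p * q) := by
  constructor
  · rw [Polynomial.mul_coeff_zero]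
    exact (totalDegree_mul _ _).trans (add_le_add hp.1 hq.1)
  · intro i hi
    rw [Polynomial.coeff_mul]
    refine IFm.sum _ _ fun k hk => ?_
    rw [Finset.HasAntidiagonal.mem_antidiagonal] at hk
    by_cases h1 : 1 ≤ k.1
    · refine (hp.2 _ h1).mul ?_
      by_cases h2 : 1 ≤ k.2
      · exact (hq.2 _ h2).totalDegree_le
      · rw [show k.2 = 0 by omega]; exact hq.1
    · refine (hq.2 _ (by omega)).mul' ?_
      rw [show k.1 = 0 by omega]; exact hp.1

lemma good.one : good F 0 1 := by
  constructor
  · simp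
  · intro i hi
    rw [Polynomial.coeff_one, if_neg (by omega)]; exact IFm.zero

lemma good.pow {p : Polynomial (MvPolynomial (Fin n) K)} (hp : good F m p) (k : ℕ) :
    good F (k * m) (p ^ k) := by
  induction k with
  | zero => simpa using good.one
  | succ k ih => rw [pow_succ, add_mul, one_mul]; exact ih.mul hp

lemma good.mono {p : Polynomial (MvPolynomial (Fin n) K)} (hp : good F m p) (h : m ≤ m') :
    good F m' p := ⟨hp.1.trans h, fun i hi => (hp.2 i hi).mono h⟩

lemma good.sum {κ : Type*} (s : Finset κ) (f : κ → Polynomial (MvPolynomial (Fin n) K))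
    (h : ∀ k ∈ s, good F m (f k)) : good F m (∑ k ∈ s, f k) := by
  constructor
  · rw [Polynomial.finset_sum_coeff]
    exact totalDegree_finsetSum_le fun i hi => (h i hi).1
  · intro i hi
    rw [Polynomial.finset_sum_coeff]
    exact IFm.sum _ _ fun k hk => (h k hk).2 i hi

lemma good.C (a : K) : good F 0 (Polynomial.C (MvPolynomial.C a)) := by
  constructor
  · simp
  · intro i hi
    rw [Polynomial.coeff_C, if_neg (by omega)]; exact IFm.zero

lemma good_aeval {σ : Type*} (w : σ → ℕ) (y : σ → Polynomial (MvPolynomial (Fin n) K))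
    (hy : ∀ i, good F (w i) (y i)) (p : MvPolynomial σ K) (E : ℕ)
    (hp : ∀ a ∈ p.support, Finsupp.weight w a ≤ E) : good F E (aeval y p) := by
  classical
  rw [p.as_sum, map_sum]
  refine good.sum _ _ fun a ha => ?_
  rw [aeval_monomial]
  have h1 : good F (Finsupp.weight w a) (a.prod fun i k => y i ^ k) := by
    rw [Finsupp.weight_apply, Finsupp.prod, Finsupp.sum]
    have : ∀ s : Finset σ, good F (∑ i ∈ s, a i • w i) (∏ i ∈ s, y i ^ a i) := by
      intro s
      induction s using Finset.induction_on with
      | empty => simpa using good.one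
      | insert i s hi ih =>
        rw [Finset.sum_insert hi, Finset.prod_insert hi]
        exact ((hy i).pow _).mul ih
    exact this _
  have := (good.C (F := F) (coeff a p)).mul h1
  rw [zero_add] at this
  exact this.mono (hp a ha)
end IFm

lemma lf_totalDegree {n : ℕ} {K : Type*} [Field K] (v : Fin n → K) : (lf v).totalDegree ≤ 1 := by
  refine totalDegree_finsetSum_le fun i _ => ?_
  refine (totalDegree_mul _ _).trans ?_
  simp

lemma eval_aeval_lf {n : ℕ} {K : Type*} [Field K] (l p : Fin n → K) (s : Polynomial K) :
    eval p (Polynomial.aeval (lf l) s) = s.eval (eval p (lf l)) := by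
  have := Polynomial.hom_eval₂ s (algebraMap K _) (eval p) (lf l)
  rw [Polynomial.aeval_def, this]
  have h : (eval p).comp (algebraMap K (MvPolynomial (Fin n) K)) = RingHom.id K := by
    ext a; simp [MvPolynomial.algebraMap_eq]
  rw [h]; rfl

lemma natDegree_hom_monomial {σ K R : Type*} [Field K] [CommRing R] [Algebra K R]
    (h : MvPolynomial σ K →ₐ[K] Polynomial R) (w : σ → ℕ)
    (hw : ∀ i, (h (X i)).natDegree ≤ w i) (a : σ →₀ ℕ) :
    (h (monomial a 1)).natDegree ≤ Finsupp.weight w a := by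
  induction a using Finsupp.induction_linear with
  | zero =>
    have : (monomial (0 : σ →₀ ℕ)) (1:K) = 1 := rfl
    simp [this]
  | add f g hf hg =>
    have : monomial (f+g) (1:K) = monomial f 1 * monomial g 1 := by simp [monomial_mul]
    rw [this, map_mul, map_add]
    exact Polynomial.natDegree_mul_le.trans (add_le_add hf hg)
  | single i k =>
    rw [← X_pow_eq_monomial, map_pow, Finsupp.weight_single]
    exact Polynomial.natDegree_pow_le_of_le _ (hw i)

lemma mem_rs_iff {ν K : Type*} [Field K] (U : MvPolynomial (Option ν) K) (m q : ℕ) :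
    U ∈ restrictSupport K (wset2 (fun _ : ν => 1) m q) ↔
    (wh (fun i => i.elim 0 (fun _ => 1)) U).natDegree ≤ m ∧
    (wh (fun i => i.elim 1 (fun _ => 0)) U).natDegree ≤ q := by
  rw [mem_restrictSupport_iff, wh_le_iff, wh_le_iff]
  constructor
  · intro h
    refine ⟨fun a ha => ?_, fun a ha => ?_⟩
    · rw [weight_opt]; simpa using (h ha).1
    · rw [weight_opt]; simpa [Finsupp.weight_apply] using (h ha).2
  · rintro ⟨h1, h2⟩ a ha
    have e1 := h1 a ha
    have e2 := h2 a ha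
    rw [weight_opt] at e1 e2
    exact ⟨by simpa using e1, by simpa [Finsupp.weight_apply] using e2⟩

lemma wh_incl_one {n : ℕ} {K : Type*} [Field K] (p : MvPolynomial (Fin n) K) :
    (wh (fun i : Option (Fin n) => i.elim 0 (fun _ => 1)) (incl p)).natDegree ≤ p.totalDegree := by
  classical
  rw [wh_le_iff]
  intro a ha
  rw [incl, support_rename_of_injective (Option.some_injective _)] at ha
  obtain ⟨b, hb, rfl⟩ := Finset.mem_image.mp ha
  have := le_totalDegree hb
  refine le_trans (le_of_eq ?_) this
  rw [Finsupp.weight_apply, Finsupp.sum_mapDomain_index (by simp) (by intros; simp [add_mul])]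
  simp

lemma wh_incl_two {n : ℕ} {K : Type*} [Field K] (p : MvPolynomial (Fin n) K) :
    (wh (fun i : Option (Fin n) => i.elim 1 (fun _ => 0)) (incl p)).natDegree ≤ 0 := by
  classical
  rw [wh_le_iff]
  intro a ha
  rw [incl, support_rename_of_injective (Option.some_injective _)] at ha
  obtain ⟨b, hb, rfl⟩ := Finset.mem_image.mp ha
  rw [Finsupp.weight_apply, Finsupp.sum_mapDomain_index (by simp) (by intros; simp [add_mul])]
  simp
end EN

namespace EN
open MvPolynomial

lemma coeff_aeval_X {σ K : Type*} [Field K] (i : σ) (φ : Polynomial K) (k : ℕ) :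
    coeff (Finsupp.single i k) (Polynomial.aeval (X i : MvPolynomial σ K) φ) = φ.coeff k := by
  classical
  induction φ using Polynomial.induction_on' with
  | add p q hp hq => simp [hp, hq]
  | monomial m a =>
    rw [Polynomial.aeval_monomial, MvPolynomial.algebraMap_eq, coeff_C_mul, X_pow_eq_monomial,
      coeff_monomial, Polynomial.coeff_monomial]
    by_cases h : m = k
    · simp [h]
    · rw [if_neg, if_neg h, mul_zero]
      intro h'; exact h (Finsupp.single_injective i h')

noncomputable def ett (n : ℕ) (K : Type*) [Field K] :
    MvPolynomial (Option (Fin n)) K →ₐ[K] Polynomial (MvPolynomial (Fin n) K) :=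
  (optionEquivLeft K (Fin n)).toAlgHom

lemma ett_incl {n : ℕ} {K : Type*} [Field K] (p : MvPolynomial (Fin n) K) :
    ett n K (incl p) = Polynomial.C p := by
  have : (ett n K).comp incl = (Algebra.ofId (MvPolynomial (Fin n) K) (Polynomial (MvPolynomial (Fin n) K))).restrictScalars K := by
    apply MvPolynomial.algHom_ext
    intro i
    simp [ett, incl, Algebra.ofId_apply]
  exact DFunLike.congr_fun this p

lemma ett_X_none {n : ℕ} {K : Type*} [Field K] : ett n K (X none) = Polynomial.X := by
  simp [ett]

lemma lift_monic {σ K B : Type*} [Field K] [CommRing B] [Algebra K B] (g : σ → B) (b : B)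
    (h : IsIntegral (Algebra.adjoin K (Set.range g)) b) :
    ∃ q : Polynomial (MvPolynomial σ K), q.Monic ∧
      Polynomial.eval₂ (aeval g : MvPolynomial σ K →ₐ[K] B).toRingHom b q = 0 := by
  obtain ⟨p, hp, hpb⟩ := h
  have hl : p.map (algebraMap (Algebra.adjoin K (Set.range g)) B) ∈
      Polynomial.lifts (aeval g : MvPolynomial σ K →ₐ[K] B).toRingHom := by
    rw [Polynomial.lifts_iff_coeff_lifts]
    intro k
    rw [Polynomial.coeff_map]
    obtain ⟨y, hy⟩ := (Algebra.adjoin_range_eq_range_aeval K g).le (p.coeff k).2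
    exact ⟨y, hy⟩
  obtain ⟨q, hq, -, hqm⟩ := Polynomial.lifts_and_natDegree_eq_and_monic hl (hp.map _)
  refine ⟨q, hqm, ?_⟩
  rw [← Polynomial.eval_map, hq, Polynomial.eval_map]
  exact hpb

lemma thmJ1 {n : ℕ} {K : Type*} [Field K] [Infinite K]
    (F : Fin n → MvPolynomial (Fin n) K) (w : Fin n → ℕ) (hw : ∀ i, w i ≠ 0)
    (hF : ∀ i, (F i).totalDegree ≤ w i) (u : Fin n → Fin n → K) (l : Fin 1 → Fin n → K)
    (hint : ∀ j, IsIntegral (Algebra.adjoin K (Set.range (gens F u l)))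
      (X (some j) : MvPolynomial (Option (Fin n)) K)) (hl : l 0 ≠ 0)
    (s : Polynomial K) (hs : s ≠ 0)
    (hmem : Polynomial.aeval (lf (l 0)) s ∈ Ideal.span (Set.range F)) :
    ∃ φ : Polynomial K, φ ≠ 0 ∧ (∃ k, φ ∣ s ^ k) ∧ φ.natDegree ≤ ∏ i, w i ∧
      IFm F (∏ i, w i) (Polynomial.aeval (lf (l 0)) φ) := by
  classical
  set g : Option (Fin n) → MvPolynomial (Option (Fin n)) K :=
    fun o => o.elim (incl (lf (l 0))) (fun i => incl (F i) * X none - incl (lf (u i))) with hg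
  have hrange : Set.range (gens F u l) = Set.range g := by
    ext x; constructor
    · rintro ⟨i | j, rfl⟩
      · exact ⟨some i, rfl⟩
      · exact ⟨none, by rw [Subsingleton.elim j 0]; rfl⟩
    · rintro ⟨_ | i, rfl⟩
      · exact ⟨Sum.inr 0, rfl⟩
      · exact ⟨Sum.inl i, rfl⟩
  rw [hrange] at hint
  set S := Algebra.adjoin K (Set.range g) with hS
  set evP : MvPolynomial (Option (Fin n)) K →ₐ[K] MvPolynomial (Option (Fin n)) K := aeval g with hevP
  have hev_uni : ∀ p : Polynomial K, evP (Polynomial.aeval (X none) p) =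
      incl (Polynomial.aeval (lf (l 0)) p) := by
    intro p
    rw [← Polynomial.aeval_algHom_apply, ← Polynomial.aeval_algHom_apply]
    simp [hevP, hg]
  have hincl_inj : Function.Injective (incl : MvPolynomial (Fin n) K →ₐ[K] MvPolynomial (Option (Fin n)) K) :=
    rename_injective _ (Option.some_injective _)
  have hne : ∀ p : Polynomial K, p ≠ 0 → Polynomial.aeval (lf (l 0)) p ≠ 0 := by
    intro p hp h0
    obtain ⟨t, ht⟩ : ∃ t, p.eval t ≠ 0 := by
      by_contra! h; exact hp (Polynomial.funext fun t => by simpa using h t)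
    obtain ⟨i, hi⟩ : ∃ i, l 0 i ≠ 0 := by
      by_contra! h; exact hl (funext h)
    have := eval_aeval_lf (l 0) (Pi.single i (t / l 0 i)) p
    rw [h0, map_zero, eval_lf, Finset.sum_eq_single i] at this
    · rw [Pi.single_eq_same, mul_div_cancel₀ _ hi] at this
      exact ht this.symm
    · intro j _ hj; simp [Pi.single_eq_of_ne hj]
    · simp
  -- integrality of elements
  have hgS : ∀ o, g o ∈ S := fun o => Algebra.subset_adjoin ⟨o, rfl⟩
  have hintg : ∀ o, IsIntegral S (g o) := fun o => by
    have := isIntegral_algebraMap (R := S) (A := MvPolynomial (Option (Fin n)) K) (x := ⟨g o, hgS o⟩)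
    exact this
  have hintincl : ∀ p : MvPolynomial (Fin n) K, IsIntegral S (incl p) := by
    intro p
    induction p using MvPolynomial.induction_on with
    | C a =>
      have := isIntegral_algebraMap (R := S) (A := MvPolynomial (Option (Fin n)) K) (x := algebraMap K S a)
      have h2 : (incl (C a) : MvPolynomial (Option (Fin n)) K) = algebraMap S (MvPolynomial (Option (Fin n)) K) (algebraMap K S a) := by
        rw [incl, rename_C]; rfl
      rw [h2]; exact this
    | add p q hp hq => rw [map_add]; exact hp.add hq
    | mul_X p i hp =>
      rw [map_mul]
      refine hp.mul ?_
      have : (incl (X i) : MvPolynomial (Option (Fin n)) K) = X (some i) := by simp [incl]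
      rw [this]; exact hint i
  have hz : IsIntegral S (incl (Polynomial.aeval (lf (l 0)) s) * X none) := by
    obtain ⟨h, hh⟩ := (Submodule.mem_span_range_iff_exists_fun _).mp hmem
    rw [← hh, map_sum, Finset.sum_mul]
    refine IsIntegral.sum _ fun i _ => ?_
    have : (incl (h i • F i) * X none : MvPolynomial (Option (Fin n)) K) = incl (h i) * (g (some i) + incl (lf (u i))) := by
      simp only [hg, smul_eq_mul, map_mul, Option.elim_some]; ring
    rw [this]
    exact (hintincl _).mul ((hintg _).add (hintincl _))
  have hsS : (incl (Polynomial.aeval (lf (l 0)) s) : MvPolynomial (Option (Fin n)) K) ∈ S := by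
    rw [← hev_uni, hS, Algebra.adjoin_range_eq_range_aeval]
    exact ⟨_, rfl⟩
  have hsne : (incl (Polynomial.aeval (lf (l 0)) s) : MvPolynomial (Option (Fin n)) K) ≠ 0 := by
    rw [Ne, map_eq_zero_iff _ hincl_inj]; exact hne s hs
  have hinj : Function.Injective evP :=
    algInd_of g hint _ hsS hsne hz
  obtain ⟨q, hqm, hq0⟩ := lift_monic g _ hz
  have hσ : (Polynomial.aeval (X none) s : MvPolynomial (Option (Fin n)) K) ≠ 0 := by
    intro h; apply hsne; rw [← hev_uni, h, map_zero]
  obtain ⟨W, hW0, hWz, hWker, k, hk⟩ := gauss_ker evP.toRingHom hinj (X none) _ hσ q hqm (by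
    have : evP.toRingHom (Polynomial.aeval (X none) s) = incl (Polynomial.aeval (lf (l 0)) s) :=
      hev_uni s
    rw [this]; exact hq0)
  set W' := (optionEquivLeft K (Option (Fin n))).symm W with hW'
  have hWW' : optionEquivLeft K (Option (Fin n)) W' = W := by simp [hW']
  set ev : MvPolynomial (Option (Option (Fin n))) K →ₐ[K] MvPolynomial (Option (Fin n)) K := aeval (fun o => o.elim (X none) g) with hev
  have hevev : ∀ U, ev U = Polynomial.eval₂ evP.toRingHom (X none) (optionEquivLeft K (Option (Fin n)) U) := by
    intro U
    induction U using MvPolynomial.induction_on with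
    | C a => simp [hev, hevP]
    | add p q hp hq => rw [map_add, map_add, Polynomial.eval₂_add, hp, hq]
    | mul_X p i hp =>
      rw [map_mul, map_mul, Polynomial.eval₂_mul, hp]
      congr 1
      rcases i with _ | i
      · simp [hev]
      · simp [hev, hevP]
  have hE := weight_bound w hw ev W' (by simp [hW', hW0]) (by
    intro U hU
    rw [hevev] at hU
    obtain ⟨V, hV⟩ := hWker _ hU
    refine ⟨(optionEquivLeft K (Option (Fin n))).symm V, ?_⟩
    apply (optionEquivLeft K (Option (Fin n))).injective
    rw [map_mul, hWW', hV]; simp) (by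
    intro a
    rw [mem_rs_iff]
    constructor
    · refine (natDegree_hom_monomial ((wh _).comp ev) (fun i => i.elim 0 (fun i => i.elim 1 w)) ?_ a).trans ?_
      · rintro (_ | _ | i)
        · simp [hev, wh]
        · simp only [AlgHom.comp_apply, hev, aeval_X, Option.elim_some, Option.elim_none, hg]
          exact (wh_incl_one _).trans (lf_totalDegree _)
        · simp only [AlgHom.comp_apply, hev, aeval_X, Option.elim_some, hg, map_sub, map_mul]
          refine (Polynomial.natDegree_sub_le _ _).trans (max_le ?_ ?_)
          · refine Polynomial.natDegree_mul_le.trans ?_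
            have h1 := (wh_incl_one (F i)).trans (hF i)
            have h2 : (wh (fun i : Option (Fin n) => i.elim 0 (fun _ => 1)) (X none : MvPolynomial (Option (Fin n)) K)).natDegree ≤ 0 := by
              simp [wh]
            omega
          · exact ((wh_incl_one _).trans (lf_totalDegree _)).trans (Nat.one_le_iff_ne_zero.mpr (hw i))
      · rw [weight_opt]; simp
    · refine (natDegree_hom_monomial ((wh _).comp ev) (fun i => i.elim 1 (fun i => i.elim 1 w)) ?_ a).trans ?_
      · rintro (_ | _ | i)
        · simp only [AlgHom.comp_apply, hev, aeval_X, Option.elim_none]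
          simp only [wh, aeval_X]
          exact Polynomial.natDegree_monomial_le _
        · simp only [AlgHom.comp_apply, hev, aeval_X, Option.elim_some, Option.elim_none, hg]
          exact (wh_incl_two _).trans (by omega)
        · simp only [AlgHom.comp_apply, hev, aeval_X, Option.elim_some, hg, map_sub, map_mul]
          have hwi := Nat.one_le_iff_ne_zero.mpr (hw i)
          refine (Polynomial.natDegree_sub_le _ _).trans (max_le ?_ ?_)
          · refine Polynomial.natDegree_mul_le.trans ?_
            have h1 := (wh_incl_two (F i))
            have h2 : (wh (fun i : Option (Fin n) => i.elim 1 (fun _ => 0)) (X none : MvPolynomial (Option (Fin n)) K)).natDegree ≤ 1 := by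
              simp only [wh, aeval_X]
              exact Polynomial.natDegree_monomial_le _
            omega
          · exact (wh_incl_two _).trans (by omega)
      · rw [weight_opt]; simp)
  set E := ∏ i, w i with hEdef
  rw [wh_le_iff] at hE
  -- weights of coefficients of `W`
  have hWc : ∀ j, ∀ a ∈ (W.coeff j).support, Finsupp.weight (fun i : Option (Fin n) => i.elim 1 w) a ≤ E := by
    intro j a ha
    rw [← hWW', mem_support_coeff_optionEquivLeft] at ha
    have := hE _ ha
    rw [weight_opt] at this
    simpa using this
  obtain ⟨φ, hφs, hφ⟩ := divisor_uni W.leadingCoeff (s ^ k) (pow_ne_zero _ hs) (by simpa using hk)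
  have hφ0 : φ ≠ 0 := by
    rintro rfl
    rw [map_zero, Polynomial.leadingCoeff_eq_zero] at hφ
    exact hW0 hφ
  refine ⟨φ, hφ0, ⟨k, hφs⟩, ?_, ?_⟩
  · have : Finsupp.single none φ.natDegree ∈ W.leadingCoeff.support := by
      rw [mem_support_iff, hφ, coeff_aeval_X]
      simpa using hφ0
    have := hWc _ _ this
    simpa [Finsupp.weight_single] using this
  · have hgood : ∀ j, good F E (ett n K (evP (W.coeff j))) := by
      intro j
      have : ett n K (evP (W.coeff j)) = aeval (fun o => ett n K (g o)) (W.coeff j) := by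
        rw [hevP, ← AlgHom.comp_apply, comp_aeval]
      rw [this]
      refine good_aeval (fun i : Option (Fin n) => i.elim 1 w) _ ?_ _ _ (hWc j)
      rintro (_ | i)
      · simp only [hg, Option.elim_none, ett_incl]
        constructor
        · rw [Polynomial.coeff_C_zero]; exact lf_totalDegree _
        · intro i hi; rw [Polynomial.coeff_C, if_neg (by omega)]; exact IFm.zero
      · simp only [hg, Option.elim_some, map_sub, map_mul, ett_incl, ett_X_none]
        have hwi := Nat.one_le_iff_ne_zero.mpr (hw i)
        constructor
        · simpa using (lf_totalDegree (u i)).trans hwi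
        · intro j hj
          rw [Polynomial.coeff_sub, Polynomial.coeff_C, if_neg (by omega), sub_zero,
            Polynomial.coeff_C_mul, Polynomial.coeff_X]
          split_ifs with h1
          · rw [mul_one]; exact IFm.of_mem i (hF i)
          · rw [mul_zero]; exact IFm.zero
    have hsum := congrArg (fun p => (ett n K p).coeff W.natDegree) hWz
    simp only [Polynomial.eval₂_eq_sum_range, map_sum, map_mul, map_pow, ett_X_none, map_zero,
      Polynomial.finset_sum_coeff, Polynomial.coeff_mul_X_pow', Polynomial.coeff_zero] at hsum
    rw [Finset.sum_range_succ, if_pos le_rfl, Nat.sub_self] at hsum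
    have h1 : evP.toRingHom (W.coeff W.natDegree) = incl (Polynomial.aeval (lf (l 0)) φ) := by
      rw [Polynomial.coeff_natDegree, hφ]; exact hev_uni φ
    rw [h1, ett_incl, Polynomial.coeff_C_zero, add_comm] at hsum
    rw [eq_neg_of_add_eq_zero_left hsum]
    refine IFm.neg (IFm.sum _ _ fun j hj => ?_)
    have hj := Finset.mem_range.mp hj
    rw [if_pos hj.le]
    exact (hgood j).2 _ (by omega)

end EN

namespace EN
open MvPolynomial

lemma thmJ {n : ℕ} (hn : 1 ≤ n) {K : Type*} [Field K] [IsAlgClosed K] {β : Type*} [Fintype β]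
    (F : β → Fin n → MvPolynomial (Fin n) K) (w : β → Fin n → ℕ) (hw : ∀ b i, w b i ≠ 0)
    (hF : ∀ b i, (F b i).totalDegree ≤ w b i) (V : β → Finset (Fin n → K))
    (hV : ∀ b x, (∀ i, eval x (F b i) = 0) → x ∈ V b) :
    ∃ (l : Fin n → K) (φ : β → Polynomial K),
      (∀ b b', ∀ p ∈ V b, ∀ q ∈ V b', eval p (lf l) = eval q (lf l) → p = q) ∧
      ∀ b, φ b ≠ 0 ∧ (φ b).natDegree ≤ ∏ i, w b i ∧
      (∀ t, (φ b).eval t = 0 → ∃ p ∈ V b, eval p (lf l) = t) ∧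
      IFm (F b) (∏ i, w b i) (Polynomial.aeval (lf l) (φ b)) := by
  classical
  haveI : Infinite K := IsAlgClosed.instInfinite
  set e1 : Fin n → K := Pi.single ⟨0, hn⟩ 1
  obtain ⟨u, l, hint, hsep⟩ := elim_all hn F ({0, e1} ∪ Finset.univ.biUnion V)
  have hmemV : ∀ b, ∀ p ∈ V b, p ∈ ({0, e1} ∪ Finset.univ.biUnion V : Finset (Fin n → K)) := by
    intro b p hp
    exact Finset.mem_union_right _ (Finset.mem_biUnion.mpr ⟨b, Finset.mem_univ _, hp⟩)
  have hl : l 0 ≠ 0 := by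
    intro h
    obtain ⟨j, hj⟩ := hsep 0 (by simp) e1 (by simp) (by
      intro h; have := congrFun h ⟨0, hn⟩; simp [e1] at this)
    rw [Subsingleton.elim j 0, h, eval_lf, eval_lf] at hj
    simp at hj
  have key : ∀ b, ∃ φ : Polynomial K, φ ≠ 0 ∧ φ.natDegree ≤ ∏ i, w b i ∧
      (∀ t, φ.eval t = 0 → ∃ p ∈ V b, eval p (lf (l 0)) = t) ∧
      IFm (F b) (∏ i, w b i) (Polynomial.aeval (lf (l 0)) φ) := by
    intro b
    set s : Polynomial K := ∏ p ∈ V b, (Polynomial.X - Polynomial.C (eval p (lf (l 0)))) with hs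
    have hs0 : s ≠ 0 := Finset.prod_ne_zero_iff.mpr fun p _ => Polynomial.X_sub_C_ne_zero _
    have hrad : Polynomial.aeval (lf (l 0)) s ∈ (Ideal.span (Set.range (F b))).radical := by
      rw [← vanishingIdeal_zeroLocus_eq_radical (K := K), mem_vanishingIdeal_iff]
      intro x hx
      have hx' : x ∈ V b := hV b x fun i => by
        have := hx (F b i) (Ideal.subset_span ⟨i, rfl⟩)
        simpa [coe_aeval_eq_eval] using this
      have := eval_aeval_lf (l 0) x s
      have h0 : s.eval (eval x (lf (l 0))) = 0 := by
        rw [hs, Polynomial.eval_prod]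
        exact Finset.prod_eq_zero hx' (by simp only [Polynomial.eval_sub, Polynomial.eval_X, Polynomial.eval_C, sub_self])
      rw [h0] at this
      simpa [coe_aeval_eq_eval] using this
    obtain ⟨a, ha⟩ := hrad
    obtain ⟨φ, h1, ⟨k, h2⟩, h3, h4⟩ := thmJ1 (F b) (w b) (hw b) (hF b) (u b) l (hint b) hl (s ^ a)
      (pow_ne_zero _ hs0) (by rw [map_pow]; exact ha)
    refine ⟨φ, h1, h3, fun t ht => ?_, h4⟩
    have h5 : ((s ^ a) ^ k).eval t = 0 := by
      obtain ⟨c, hc⟩ := h2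
      rw [hc, Polynomial.eval_mul, ht, zero_mul]
    rw [Polynomial.eval_pow, Polynomial.eval_pow] at h5
    have h6 := eq_zero_of_pow_eq_zero (eq_zero_of_pow_eq_zero h5)
    rw [hs, Polynomial.eval_prod, Finset.prod_eq_zero_iff] at h6
    obtain ⟨p, hp, hp'⟩ := h6
    refine ⟨p, hp, ?_⟩
    simp only [Polynomial.eval_sub, Polynomial.eval_X, Polynomial.eval_C] at hp'
    exact (sub_eq_zero.mp hp').symm
  choose φ hφ using key
  refine ⟨l 0, φ, ?_, hφ⟩
  intro b b' p hp q hq he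
  by_contra hne
  obtain ⟨j, hj⟩ := hsep p (hmemV b p hp) q (hmemV b' q hq) hne
  rw [Subsingleton.elim j 0] at hj
  exact hj he

lemma const_one {n : ℕ} {K ι : Type*} [Field K] [IsAlgClosed K] [Fintype ι] (F : ι → MvPolynomial (Fin n) K)
    (m : ℕ) (l : Fin n → K) (φ : Polynomial K) (h0 : φ ≠ 0) (hd : φ.natDegree = 0)
    (h : IFm F m (Polynomial.aeval (lf l) φ)) : IFm F m 1 := by
  obtain ⟨c, rfl⟩ := Polynomial.natDegree_eq_zero.mp hd
  have hc : c ≠ 0 := by rintro rfl; simp at h0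
  have := h.mul' (g' := C c⁻¹) (m' := 0) (by simp)
  rw [Polynomial.aeval_C, MvPolynomial.algebraMap_eq, ← C_mul, inv_mul_cancel₀ hc, C_1, zero_add] at this
  exact this

lemma thmJ_empty {n : ℕ} (hn : 1 ≤ n) {K : Type*} [Field K] [IsAlgClosed K]
    (F : Fin n → MvPolynomial (Fin n) K) (w : Fin n → ℕ) (hw : ∀ i, w i ≠ 0)
    (hF : ∀ i, (F i).totalDegree ≤ w i) (hV : ∀ x, ∃ i, eval x (F i) ≠ 0) :
    IFm F (∏ i, w i) 1 := by
  obtain ⟨l, φ, -, h⟩ := thmJ hn (fun _ : Unit => F) (fun _ => w) (fun _ => hw) (fun _ => hF)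
    (fun _ => ∅) (by intro _ x hx; obtain ⟨i, hi⟩ := hV x; exact absurd (hx i) hi)
  obtain ⟨h1, h2, h3, h4⟩ := h ()
  refine const_one F _ l _ h1 ?_ h4
  by_contra hd
  obtain ⟨t, ht⟩ := IsAlgClosed.exists_root (φ ()) (by
    intro h; rw [Polynomial.natDegree_eq_of_degree_eq_some h] at hd; exact hd rfl)
  obtain ⟨p, hp, -⟩ := h3 t ht
  simp at hp

lemma aeval_lf_totalDegree {n : ℕ} {K : Type*} [Field K] (l : Fin n → K) (a : Polynomial K) :
    (Polynomial.aeval (lf l) a).totalDegree ≤ a.natDegree := by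
  rw [Polynomial.aeval_eq_sum_range]
  refine totalDegree_finsetSum_le fun i hi => ?_
  refine (totalDegree_smul_le _ _).trans ((totalDegree_pow _ _).trans ?_)
  have := lf_totalDegree l
  have hi := Finset.mem_range.mp hi
  nlinarith

lemma bezout_bdd {K : Type*} [Field K] (φ ψ : Polynomial K) (h : IsCoprime φ ψ) (hφ : φ.natDegree ≠ 0)
    (hψ : ψ.natDegree ≠ 0) : ∃ a b : Polynomial K, a * φ + b * ψ = 1 ∧ a.natDegree + 1 ≤ ψ.natDegree ∧
      b.natDegree + 1 ≤ φ.natDegree := by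
  obtain ⟨u, v, huv⟩ := h
  have hψ0 : ψ ≠ 0 := by rintro rfl; simp at hψ
  have hφ0 : φ ≠ 0 := by rintro rfl; simp at hφ
  have e : (u % ψ) * φ + (v + (u / ψ) * φ) * ψ = 1 := by
    have := EuclideanDomain.mod_add_div u ψ
    linear_combination huv + φ * this
  have ha : (u % ψ).natDegree + 1 ≤ ψ.natDegree := Polynomial.natDegree_mod_lt u hψ
  refine ⟨u % ψ, v + (u / ψ) * φ, e, ha, ?_⟩
  set b := v + (u / ψ) * φ
  by_cases hb : b = 0
  · rw [hb]; simp; omega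
  have h1 : b * ψ = 1 - (u % ψ) * φ := by linear_combination e
  have h2 : (b * ψ).natDegree = b.natDegree + ψ.natDegree := Polynomial.natDegree_mul hb hψ0
  have h3 : (1 - (u % ψ) * φ).natDegree ≤ (u % ψ).natDegree + φ.natDegree := by
    refine (Polynomial.natDegree_sub_le _ _).trans (max_le (by simp) Polynomial.natDegree_mul_le)
  rw [← h1] at h3
  omega

lemma thmJ_pair {n : ℕ} (hn : 1 ≤ n) {K : Type*} [Field K] [IsAlgClosed K]
    (F F' : Fin n → MvPolynomial (Fin n) K) (w w' : Fin n → ℕ) (hw : ∀ i, w i ≠ 0) (hw' : ∀ i, w' i ≠ 0)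
    (hF : ∀ i, (F i).totalDegree ≤ w i) (hF' : ∀ i, (F' i).totalDegree ≤ w' i)
    (hV : {x | ∀ i, eval x (F i) = 0}.Finite) (hV' : {x | ∀ i, eval x (F' i) = 0}.Finite)
    (hdis : ∀ x, (∀ i, eval x (F i) = 0) → ¬ (∀ i, eval x (F' i) = 0)) :
    ∃ a b, 1 = a + b ∧ IFm F (∏ i, w i + ∏ i, w' i - 1) a ∧ IFm F' (∏ i, w i + ∏ i, w' i - 1) b := by
  obtain ⟨l, φ, hinj, h⟩ := thmJ hn (fun b : Bool => if b then F else F') (fun b => if b then w else w')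
    (by rintro (_|_) i <;> simp [hw, hw']) (by rintro (_|_) i <;> simp [hF, hF'])
    (fun b => if b then hV.toFinset else hV'.toFinset)
    (by rintro (_|_) x hx <;> simpa using hx)
  have hp : 1 ≤ ∏ i, w i := Finset.prod_pos fun i _ => Nat.pos_of_ne_zero (hw i)
  have hp' : 1 ≤ ∏ i, w' i := Finset.prod_pos fun i _ => Nat.pos_of_ne_zero (hw' i)
  obtain ⟨h1, h2, h3, h4⟩ := h true
  obtain ⟨h1', h2', h3', h4'⟩ := h false
  simp only [if_true, Bool.false_eq_true, if_false] at h1 h2 h3 h4 h1' h2' h3' h4'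
  by_cases hd : (φ true).natDegree = 0
  · exact ⟨1, 0, by simp, (const_one F _ l _ h1 hd h4).mono (by omega), IFm.zero⟩
  by_cases hd' : (φ false).natDegree = 0
  · exact ⟨0, 1, by simp, IFm.zero, (const_one F' _ l _ h1' hd' h4').mono (by omega)⟩
  have hcop : IsCoprime (φ true) (φ false) := by
    rw [Polynomial.isCoprime_iff_aeval_ne_zero_of_isAlgClosed K K]
    intro t
    by_contra! hc
    obtain ⟨p, hp, hpt⟩ := h3 t (by simpa using hc.1)
    obtain ⟨q, hq, hqt⟩ := h3' t (by simpa using hc.2)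
    have := hinj true false p (by simpa using hp) q (by simpa using hq) (hpt.trans hqt.symm)
    subst this
    exact hdis p (by simpa using hp) (by simpa using hq)
  obtain ⟨a, b, hab, hda, hdb⟩ := bezout_bdd _ _ hcop hd hd'
  refine ⟨Polynomial.aeval (lf l) (a * φ true), Polynomial.aeval (lf l) (b * φ false), ?_, ?_, ?_⟩
  · rw [← map_add, hab, map_one]
  · rw [map_mul]
    exact (h4.mul' (aeval_lf_totalDegree l a)).mono (by omega)
  · rw [map_mul]
    exact (h4'.mul' (aeval_lf_totalDegree l b)).mono (by omega)

end EN

namespace EN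
open MvPolynomial

lemma generic {K A : Type*} [Field K] [CommRing A] [Algebra K A]
    (Ps : Set (Ideal A)) (hfin : Ps.Finite) (hprime : ∀ p ∈ Ps, p.IsPrime) (m : ℕ) (g : ℕ → A)
    (hg : ∀ p ∈ Ps, ∃ i < m, g i ∉ p) :
    {t : K | ∃ p ∈ Ps, ∑ i ∈ Finset.range m, algebraMap K A (t ^ i) * g i ∈ p}.Finite := by
  have : {t : K | ∃ p ∈ Ps, ∑ i ∈ Finset.range m, algebraMap K A (t ^ i) * g i ∈ p} =
      ⋃ p ∈ Ps, {t : K | ∑ i ∈ Finset.range m, algebraMap K A (t ^ i) * g i ∈ p} := by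
    ext t; simp
  rw [this]
  refine hfin.biUnion fun p hp => ?_
  haveI := hprime p hp
  set Q : Polynomial (A ⧸ p) := ∑ i ∈ Finset.range m, Polynomial.monomial i (Ideal.Quotient.mk p (g i)) with hQ
  have hQ0 : Q ≠ 0 := by
    obtain ⟨i, hi, hgi⟩ := hg p hp
    intro h
    have := congrArg (fun q => q.coeff i) h
    simp only [hQ, Polynomial.finset_sum_coeff, Polynomial.coeff_monomial, Polynomial.coeff_zero] at this
    rw [Finset.sum_ite_eq' , if_pos (Finset.mem_range.mpr hi)] at this
    exact hgi (Ideal.Quotient.eq_zero_iff_mem.mp this)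
  have hinj : Function.Injective (algebraMap K (A ⧸ p)) := (algebraMap K (A ⧸ p)).injective
  refine Set.Finite.subset ((Polynomial.finite_setOf_isRoot hQ0).preimage (hinj.injOn)) ?_
  intro t ht
  simp only [Set.mem_setOf_eq] at ht
  rw [← Ideal.Quotient.eq_zero_iff_mem] at ht
  simp only [Set.mem_preimage, Set.mem_setOf_eq, Polynomial.IsRoot.def, hQ, Polynomial.eval_finset_sum,
    Polynomial.eval_monomial]
  rw [← ht, map_sum]
  refine Finset.sum_congr rfl fun i _ => ?_
  rw [map_mul, mul_comm, ← map_pow]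
  rfl

lemma height_chain {A : Type*} [CommRing A] (F : ℕ → A) (n : ℕ)
    (hav : ∀ i < n, ∀ q ∈ (Ideal.span (F '' Set.Iio i)).minimalPrimes, F i ∉ q) :
    ∀ j ≤ n, ∀ p : Ideal A, p.IsPrime → Ideal.span (F '' Set.Iio j) ≤ p → (j : ℕ∞) ≤ p.height := by
  intro j
  induction j with
  | zero => intro _ p _ _; simp
  | succ j ih =>
    intro hj p hp hJ
    have hle : Ideal.span (F '' Set.Iio j) ≤ p :=
      (Ideal.span_mono (Set.image_mono (Set.Iio_subset_Iio (Nat.le_succ j)))).trans hJ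
    obtain ⟨q, hq, hqp⟩ := Ideal.exists_minimalPrimes_le hle
    have hqprime := hq.1.1
    have h1 := ih (by omega) q hqprime hq.1.2
    have hne : q < p := lt_of_le_of_ne hqp (by
      rintro rfl
      exact hav j (by omega) q hq (hJ (Ideal.subset_span ⟨j, by simp, rfl⟩)))
    have h2 := Ideal.height_add_one_le_of_lt_of_isPrime hne
    push_cast
    exact (add_le_add_left h1 1).trans h2

lemma finite_zeros {n : ℕ} {K : Type*} [Field K] (F : ℕ → MvPolynomial (Fin n) K)
    (hav : ∀ i < n, ∀ q ∈ (Ideal.span (F '' Set.Iio i)).minimalPrimes, F i ∉ q) :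
    {x | ∀ i < n, eval x (F i) = 0}.Finite := by
  have hdim : ringKrullDim (MvPolynomial (Fin n) K) = n := by
    rw [MvPolynomial.ringKrullDim_of_isNoetherianRing]; simp [ringKrullDim_eq_zero_of_field]
  haveI : FiniteRingKrullDim (MvPolynomial (Fin n) K) := by
    rw [finiteRingKrullDim_iff_ne_bot_and_top, hdim]
    exact ⟨WithBot.coe_ne_bot, fun h => ENat.coe_ne_top n (WithBot.coe_injective h)⟩
  set J := Ideal.span (F '' Set.Iio n) with hJ
  refine Set.Finite.of_finite_image (f := fun x => RingHom.ker (eval x : MvPolynomial (Fin n) K →+* K))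
    ((Ideal.finite_minimalPrimes_of_isNoetherianRing _ J).subset ?_) ?_
  · rintro _ ⟨x, hx, rfl⟩
    have hpr : (RingHom.ker (eval x : MvPolynomial (Fin n) K →+* K)).IsPrime := RingHom.ker_isPrime _
    have hle : J ≤ RingHom.ker (eval x : MvPolynomial (Fin n) K →+* K) := by
      rw [hJ, Ideal.span_le]
      rintro _ ⟨i, hi, rfl⟩
      exact hx i hi
    obtain ⟨q, hq, hqp⟩ := Ideal.exists_minimalPrimes_le hle
    haveI := hq.1.1
    have h1 := height_chain F n hav n le_rfl q hq.1.1 hq.1.2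
    have h2 : (q.height : WithBot ℕ∞) ≤ ringKrullDim _ := Ideal.height_le_ringKrullDim_of_isPrime
    have hmax : q.IsMaximal := by
      apply Ideal.isMaximal_of_height_eq_ringKrullDim
      refine le_antisymm h2 ?_
      rw [hdim]
      exact_mod_cast h1
    have : q = RingHom.ker (eval x : MvPolynomial (Fin n) K →+* K) := hmax.eq_of_le hpr.ne_top hqp
    simpa [this] using hq
  · intro x hx y hy hxy
    simp only at hxy
    funext i
    have : X i - C (x i) ∈ RingHom.ker (eval x : MvPolynomial (Fin n) K →+* K) := by
      simp [RingHom.mem_ker]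
    rw [hxy, RingHom.mem_ker] at this
    simp at this
    exact (sub_eq_zero.mp this).symm

lemma IFm.trans {n : ℕ} {K ι κ : Type*} [Field K] [Fintype ι] [Fintype κ]
    {F : ι → MvPolynomial (Fin n) K} {f : κ → MvPolynomial (Fin n) K} {m : ℕ} {a : MvPolynomial (Fin n) K}
    (h : IFm F m a) (hF : ∀ i, IFm f (F i).totalDegree (F i)) : IFm f m a := by
  obtain ⟨c, hc, hd⟩ := h
  rw [hc]
  refine IFm.sum _ _ fun i _ => ?_
  by_cases h0 : c i * F i = 0
  · rw [h0]; exact IFm.zero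
  · have h1 := (hF i).mul' (g' := c i) le_rfl
    rw [← totalDegree_mul_of_isDomain (left_ne_zero_of_mul h0) (right_ne_zero_of_mul h0)] at h1
    exact h1.mono (hd i)

end EN

namespace EN
open MvPolynomial

lemma span_top {n r : ℕ} {K : Type*} [Field K] [IsAlgClosed K] (f : Fin r → MvPolynomial (Fin n) K)
    (h : ∀ x, ∃ i, eval x (f i) ≠ 0) : Ideal.span (Set.range f) = ⊤ := by
  rw [← Ideal.radical_eq_top, ← vanishingIdeal_zeroLocus_eq_radical (K := K), Ideal.eq_top_iff_one,
    mem_vanishingIdeal_iff]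
  intro x hx
  obtain ⟨i, hi⟩ := h x
  exact absurd (by simpa [coe_aeval_eq_eval] using hx (f i) (Ideal.subset_span ⟨i, rfl⟩)) hi

lemma partJ_le {n r : ℕ} {K : Type*} [Field K] [IsAlgClosed K] (hn : 0 < n) (hrn : r ≤ n)
    (f : Fin r → MvPolynomial (Fin n) K) (d : ℕ → ℕ) (hdeg : ∀ i : Fin r, d i = (f i).totalDegree)
    (hd : ∀ i < r, 1 ≤ d i) (h : ∀ x, ∃ i, eval x (f i) ≠ 0) :
    IFm f (∏ i ∈ Finset.range r, d i) 1 := by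
  have := thmJ_empty hn (fun i : Fin n => if h : (i:ℕ) < r then f ⟨i, h⟩ else 0)
    (fun i => if (i:ℕ) < r then d i else 1) (by
      intro i
      split_ifs with h1
      · have := hd i h1; omega
      · omega) (by
      intro i
      split_ifs with h1
      · exact (hdeg ⟨i, h1⟩).ge
      · simp) (by
      intro x
      obtain ⟨i, hi⟩ := h x
      refine ⟨⟨i, by omega⟩, ?_⟩
      simpa using hi)
  have e : (∏ i : Fin n, (fun i : Fin n => if (i:ℕ) < r then d i else 1) i) = ∏ i ∈ Finset.range r, d i := by
    simp only
    rw [Fin.prod_univ_eq_prod_range (fun i => if i < r then d i else 1) n, ← Finset.prod_filter]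
    congr 1
    ext i; simp; omega
  rw [e] at this
  refine this.trans fun i => ?_
  split_ifs with h1
  · exact IFm.of_mem _ le_rfl
  · exact IFm.zero

noncomputable def ext {n r : ℕ} {K : Type*} [Field K] (f : Fin r → MvPolynomial (Fin n) K) (i : ℕ) :
    MvPolynomial (Fin n) K := if h : i < r then f ⟨i, h⟩ else 0

noncomputable def comb {n r : ℕ} {K : Type*} [Field K] (f : Fin r → MvPolynomial (Fin n) K) (j : ℕ) (t : K) :
    MvPolynomial (Fin n) K := ∑ i ∈ Finset.range (r - j), algebraMap K _ (t ^ i) * ext f (j + i)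

section
variable {n r : ℕ} {K : Type*} [Field K] (f : Fin r → MvPolynomial (Fin n) K) (d : ℕ → ℕ)

lemma ext_lt {i : ℕ} (h : i < r) : ext f i = f ⟨i, h⟩ := dif_pos h

lemma IFm_ext (hdeg : ∀ i : Fin r, d i = (f i).totalDegree) (i : ℕ) : IFm f (d i) (ext f i) := by
  unfold ext
  split_ifs with h
  · exact IFm.of_mem _ (hdeg ⟨i, h⟩).ge
  · exact IFm.zero

lemma IFm_comb (hdeg : ∀ i : Fin r, d i = (f i).totalDegree)
    (hsort : ∀ i j, i ≤ j → j < r → d j ≤ d i) (j : ℕ) (t : K) :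
    IFm f (d j) (comb f j t) := by
  refine IFm.sum _ _ fun i hi => ?_
  have hi := Finset.mem_range.mp hi
  have h1 := (IFm_ext f d hdeg (j+i)).mul' (g' := algebraMap K _ (t ^ i)) (m' := 0) (by
    rw [MvPolynomial.algebraMap_eq, totalDegree_C])
  exact h1.mono (by have := hsort j (j+i) (by omega) (by omega); omega)

lemma comb_step [Infinite K] (hdeg : ∀ i : Fin r, d i = (f i).totalDegree)
    (hsort : ∀ i j, i ≤ j → j < r → d j ≤ d i) (hd : ∀ i < r, 1 ≤ d i) (j : ℕ) (hj : j < r)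
    (Ps : Set (Ideal (MvPolynomial (Fin n) K))) (hfin : Ps.Finite) (hprime : ∀ p ∈ Ps, p.IsPrime)
    (hP : ∀ p ∈ Ps, ∃ k, j ≤ k ∧ ext f k ∉ p) :
    ∃ t : K, (comb f j t).totalDegree = d j ∧ ∀ p ∈ Ps, comb f j t ∉ p := by
  have hlt : ∀ k (p : Ideal (MvPolynomial (Fin n) K)), ext f k ∉ p → k < r := by
    intro k p hk
    by_contra hc
    rw [ext, dif_neg hc] at hk
    exact hk p.zero_mem
  have h1 := generic (K := K) Ps hfin hprime (r - j) (fun i => ext f (j+i)) (by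
    intro p hp
    obtain ⟨k, hk, hkp⟩ := hP p hp
    refine ⟨k - j, ?_, ?_⟩
    · have := hlt k p hkp; omega
    · simpa [Nat.add_sub_cancel' hk] using hkp)
  have hfj : f ⟨j, hj⟩ ≠ 0 := by
    intro h0
    have := hdeg ⟨j, hj⟩
    rw [h0, totalDegree_zero] at this
    have := hd j hj
    simp_all
  obtain ⟨a, ha, ha'⟩ := Finset.exists_mem_eq_sup (f ⟨j, hj⟩).support (support_nonempty.mpr hfj)
    (fun s => s.sum fun _ e => e)
  have h2 := generic (K := K) {(⊥ : Ideal K)} (Set.finite_singleton _) (by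
    rintro p rfl; exact Ideal.isPrime_bot) (r - j) (fun i => coeff a (ext f (j+i))) (by
    rintro p rfl
    refine ⟨0, by omega, ?_⟩
    rw [add_zero, ext_lt f hj, Ideal.mem_bot]
    exact mem_support_iff.mp ha)
  obtain ⟨t, ht⟩ := (h1.union h2).exists_notMem
  simp only [Set.mem_union, Set.mem_setOf_eq, not_or, not_exists, not_and] at ht
  refine ⟨t, ?_, ht.1⟩
  apply le_antisymm (IFm_comb f d hdeg hsort j t).totalDegree_le
  have h3 := ht.2 ⊥ rfl
  have h4 : a ∈ (comb f j t).support := by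
    rw [mem_support_iff]
    intro h0
    apply h3
    rw [Ideal.mem_bot, ← h0, comb, coeff_sum]
    refine Finset.sum_congr rfl fun i _ => ?_
    rw [MvPolynomial.algebraMap_eq, coeff_C_mul]; rfl
  have h5 := le_totalDegree h4
  rw [hdeg ⟨j, hj⟩, totalDegree]
  exact ha'.le.trans h5

lemma tri (p : Ideal (MvPolynomial (Fin n) K)) (t : ℕ → K) (j : ℕ) (hjr : j ≤ r)
    (hc : ∀ i < j, comb f i (t i) ∈ p) (hk : ∀ k, j ≤ k → ext f k ∈ p) : ∀ k, ext f k ∈ p := by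
  induction j with
  | zero => intro k; exact hk k (Nat.zero_le _)
  | succ j ih =>
    refine ih (by omega) (fun i hi => hc i (by omega)) fun k hkj => ?_
    rcases Nat.eq_or_lt_of_le hkj with rfl | h
    · have := hc j (by omega)
      rw [comb, show r - j = (r - j - 1) + 1 by omega, Finset.sum_range_succ'] at this
      have h2 := (Ideal.add_mem_iff_right p (Ideal.sum_mem p fun i _ => Ideal.mul_mem_left p _ (hk (j + (i+1)) (by omega)))).mp this
      simpa using h2
    · exact hk k h

noncomputable def Fseq (t : ℕ → K) : ℕ → MvPolynomial (Fin n) K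
  | 0 => ext f (r - 1)
  | j+1 => comb f j (t j)

lemma Fseq_congr (t t' : ℕ → K) (j : ℕ) (h : ∀ i < j, t i = t' i) :
    Fseq f t '' Set.Iio (j+1) = Fseq f t' '' Set.Iio (j+1) := by
  refine Set.image_congr fun i hi => ?_
  rcases i with _ | i
  · rfl
  · simp only [Fseq]; rw [h i (by simpa using hi)]

lemma not_all (hspan : Ideal.span (Set.range f) = ⊤) (p : Ideal (MvPolynomial (Fin n) K)) (hp : p.IsPrime)
    (t : ℕ → K) (j : ℕ) (hjr : j ≤ r)
    (hc : ∀ i < j, comb f i (t i) ∈ p) : ∃ k, j ≤ k ∧ ext f k ∉ p := by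
  by_contra! hcon
  have := tri f p t j hjr hc hcon
  apply hp.ne_top
  rw [eq_top_iff, ← hspan, Ideal.span_le]
  rintro _ ⟨i, rfl⟩
  have := this i
  rwa [ext_lt f i.2] at this

lemma exists_seq [Infinite K] (hspan : Ideal.span (Set.range f) = ⊤)
    (hdeg : ∀ i : Fin r, d i = (f i).totalDegree)
    (hsort : ∀ i j, i ≤ j → j < r → d j ≤ d i) (hd : ∀ i < r, 1 ≤ d i) (m : ℕ) (hm : m ≤ r) :
    ∃ t : ℕ → K, ∀ j < m, (comb f j (t j)).totalDegree = d j ∧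
      ∀ q ∈ (Ideal.span (Fseq f t '' Set.Iio (j+1))).minimalPrimes, comb f j (t j) ∉ q := by
  induction m with
  | zero => exact ⟨0, by simp⟩
  | succ m ih =>
    obtain ⟨t, ht⟩ := ih (by omega)
    obtain ⟨t0, h0, h0'⟩ := comb_step f d hdeg hsort hd m (by omega)
      (Ideal.span (Fseq f t '' Set.Iio (m+1))).minimalPrimes
      (Ideal.finite_minimalPrimes_of_isNoetherianRing _ _) (fun p hp => hp.1.1) (by
        intro p hp
        refine not_all f hspan p hp.1.1 t m (by omega) fun i hi => ?_
        exact hp.1.2 (Ideal.subset_span ⟨i+1, by simpa using hi, rfl⟩))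
    refine ⟨Function.update t m t0, fun j hj => ?_⟩
    have hcg : Fseq f (Function.update t m t0) '' Set.Iio (j+1) = Fseq f t '' Set.Iio (j+1) :=
      Fseq_congr f _ _ j fun i hi => Function.update_of_ne (by omega) _ _
    rw [hcg]
    rcases Nat.eq_or_lt_of_le (Nat.lt_succ_iff.mp hj) with rfl | h
    · rw [Function.update_self]; exact ⟨h0, h0'⟩
    · rw [Function.update_of_ne (by omega)]; exact ht j h

lemma partJ_gt [IsAlgClosed K] (hn : 0 < n) (hrn : n < r)
    (hdeg : ∀ i : Fin r, d i = (f i).totalDegree)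
    (hsort : ∀ i j, i ≤ j → j < r → d j ≤ d i) (hd : ∀ i < r, 1 ≤ d i)
    (h : ∀ x, ∃ i, eval x (f i) ≠ 0) :
    IFm f (d (r-1) * ∏ i ∈ Finset.range (n-1), d i +
      (if n = 1 then d 0 else d (r-1) * ∏ i ∈ Finset.range (n-1), d i) - 1) 1 := by
  haveI : Infinite K := IsAlgClosed.instInfinite
  have hspan := span_top f h
  obtain ⟨t, ht⟩ := exists_seq f d hspan hdeg hsort hd n hrn.le
  set F := Fseq f t with hF
  set δ : ℕ → ℕ := fun i => match i with
    | 0 => d (r-1)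
    | j+1 => d j with hδ
  have hF0 : (F 0).totalDegree = δ 0 := by
    simp only [hF, Fseq, hδ]; rw [ext_lt f (by omega)]; exact (hdeg ⟨r-1, by omega⟩).symm
  have hFδ : ∀ i < n, (F i).totalDegree = δ i := by
    rintro (_ | j) hj
    · exact hF0
    · exact (ht j (by omega)).1
  have hδ0 : ∀ i < n, δ i ≠ 0 := by
    rintro (_ | j) hj
    · have := hd (r-1) (by omega); simp only [hδ]; omega
    · have := hd j (by omega); simp only [hδ]; omega
  have hFI : ∀ i < n, IFm f (F i).totalDegree (F i) := by
    rintro (_ | j) hj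
    · rw [hF0]; exact IFm_ext f d hdeg _
    · rw [hFδ _ hj]; exact IFm_comb f d hdeg hsort j _
  have hav : ∀ i < n, ∀ q ∈ (Ideal.span (F '' Set.Iio i)).minimalPrimes, F i ∉ q := by
    rintro (_ | j) hj q hq
    · have hq : q ∈ minimalPrimes (MvPolynomial (Fin n) K) := by simpa [minimalPrimes] using hq
      rw [IsDomain.minimalPrimes_eq_singleton_bot] at hq
      rw [Set.mem_singleton_iff.mp hq, Ideal.mem_bot]
      intro h0
      rw [h0, totalDegree_zero] at hF0
      exact hδ0 0 hn hF0.symm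
    · exact (ht j (by omega)).2 q hq
  have hfin := finite_zeros F hav
  -- second choice
  obtain ⟨t0, h0, h0'⟩ := comb_step f d hdeg hsort hd (n-2) (by omega)
    ((Ideal.span (F '' Set.Iio (n-1))).minimalPrimes ∪
      (fun x => RingHom.ker (eval x : MvPolynomial (Fin n) K →+* K)) '' {x | ∀ i < n, eval x (F i) = 0})
    ((Ideal.finite_minimalPrimes_of_isNoetherianRing _ _).union (hfin.image _)) (by
      rintro p (hp | ⟨x, hx, rfl⟩)
      · exact hp.1.1
      · exact RingHom.ker_isPrime _) (by
      rintro p (hp | ⟨x, hx, rfl⟩)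
      · refine not_all f hspan p hp.1.1 t (n-2) (by omega) fun i hi => ?_
        exact hp.1.2 (Ideal.subset_span ⟨i+1, by simp; omega, rfl⟩)
      · refine not_all f hspan _ (RingHom.ker_isPrime _) t (n-2) (by omega) fun i hi => ?_
        exact hx (i+1) (by omega))
  set G := comb f (n-2) t0 with hG
  set F' : ℕ → MvPolynomial (Fin n) K := Function.update F (n-1) G with hF'
  have hF'lt : ∀ i < n - 1, F' i = F i := fun i hi => Function.update_of_ne (by omega) _ _
  have hF'last : F' (n-1) = G := Function.update_self _ _ _
  have hav' : ∀ i < n, ∀ q ∈ (Ideal.span (F' '' Set.Iio i)).minimalPrimes, F' i ∉ q := by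
    intro i hi q hq
    have e : F' '' Set.Iio i = F '' Set.Iio i := Set.image_congr fun k hk => hF'lt k (by
      have := Set.mem_Iio.mp hk; omega)
    rw [e] at hq
    rcases Nat.lt_or_ge i (n-1) with h1 | h1
    · rw [hF'lt i h1]; exact hav i hi q hq
    · obtain rfl : i = n-1 := by omega
      rw [hF'last]; exact h0' q (Or.inl hq)
  have hfin' := finite_zeros F' hav'
  set δ' : ℕ → ℕ := Function.update δ (n-1) (d (n-2)) with hδ'
  obtain ⟨a, b, hab, ha, hb⟩ := thmJ_pair hn (fun i : Fin n => F i) (fun i : Fin n => F' i)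
    (fun i => δ i) (fun i => δ' i) (fun i => hδ0 i i.2) (by
      intro i
      rcases Nat.lt_or_ge i (n-1) with h1 | h1
      · simp only [hδ']; rw [Function.update_of_ne (by omega)]; exact hδ0 i i.2
      · have : (i:ℕ) = n-1 := by omega
        simp only [hδ', this, Function.update_self]; have := hd (n-2) (by omega); omega)
    (fun i => (hFδ i i.2).le) (by
      intro i
      rcases Nat.lt_or_ge i (n-1) with h1 | h1
      · simp only [hδ', hF'lt i h1]; rw [Function.update_of_ne (by omega)]; exact (hFδ i i.2).le
      · have : (i:ℕ) = n-1 := by omega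
        simp only [hδ', this, Function.update_self, hF'last]; exact h0.le)
    (hfin.subset fun x hx i hi => hx ⟨i, hi⟩) (hfin'.subset fun x hx i hi => hx ⟨i, hi⟩) (by
      intro x hx hx'
      have h1 := hx' ⟨n-1, by omega⟩
      simp only [hF'last] at h1
      exact h0' _ (Or.inr ⟨x, fun i hi => hx ⟨i, hi⟩, rfl⟩) h1)
  have e1 : ∏ i : Fin n, δ i = d (r-1) * ∏ i ∈ Finset.range (n-1), d i := by
    rw [Fin.prod_univ_eq_prod_range (fun i => δ i) n]
    obtain ⟨k, rfl⟩ : ∃ k, n = k + 1 := ⟨n-1, by omega⟩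
    rw [Finset.prod_range_succ', mul_comm]
    rfl
  have e2 : ∏ i : Fin n, δ' i = (if n = 1 then d 0 else d (r-1) * ∏ i ∈ Finset.range (n-1), d i) := by
    rw [Fin.prod_univ_eq_prod_range (fun i => δ' i) n]
    split_ifs with h1
    · subst h1; simp [hδ']
    · rw [← e1, Fin.prod_univ_eq_prod_range (fun i => δ i) n]
      refine Finset.prod_congr rfl fun i hi => ?_
      by_cases h2 : i = n - 1
      · obtain ⟨k, rfl⟩ : ∃ k, n = k + 2 := ⟨n-2, by omega⟩
        subst h2
        simp [hδ', hδ]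
      · rw [hδ', Function.update_of_ne h2]
  rw [e1, e2] at ha hb
  rw [hab]
  refine (ha.trans fun i => hFI i i.2).add (hb.trans fun i => ?_)
  rcases Nat.lt_or_ge i (n-1) with h1 | h1
  · simp only [hF'lt i h1]; exact hFI i i.2
  · have : (i:ℕ) = n-1 := by omega
    simp only [this, hF'last, h0]
    exact IFm_comb f d hdeg hsort _ _
end

end EN

namespace EN
open CategoryTheory Abelian

universe u

/-- `x^c` kills `Ext^i(N,M)`. -/
def KE {S : Type u} [CommRing S] (x : S) (c : ℕ) (N M : Type u) [AddCommGroup N] [Module S N]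
    [AddCommGroup M] [Module S M] (i : ℕ) : Prop :=
  ∀ e : Ext (ModuleCat.of S N) (ModuleCat.of S M) i, x ^ c • e = 0

section
variable {S : Type u} [CommRing S] (x : S)
  {N A B C : Type u} [AddCommGroup N] [Module S N] [AddCommGroup A] [Module S A]
  [AddCommGroup B] [Module S B] [AddCommGroup C] [Module S C]

theorem KE.quot {p q i : ℕ} (f : A →ₗ[S] B) (g : B →ₗ[S] C) (hf : Function.Injective f)
    (hg : Function.Surjective g) (hfg : Function.Exact f g)
    (hB : KE x p N B i) (hA : KE x q N A (i+1)) : KE x (p+q) N C i := by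
  intro e
  have hS : (ModuleCat.shortComplexOfCompEqZero f g hfg.linearMap_comp_eq_zero).ShortExact :=
    ModuleCat.shortComplex_shortExact _ hfg hf hg
  have h1 : (x^q • e).comp hS.extClass rfl = 0 := by
    rw [Ext.smul_comp]; exact hA _
  obtain ⟨b, hb⟩ := Ext.covariant_sequence_exact₃ _ hS (x^q • e) rfl h1
  have h2 : x^p • (x^q • e) = (x^p • b).comp (Ext.mk₀ (ModuleCat.shortComplexOfCompEqZero f g hfg.linearMap_comp_eq_zero).g) (add_zero i) := by
    rw [Ext.smul_comp, hb]
  rw [pow_add, mul_smul, h2, hB b, Ext.zero_comp]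

theorem KE.of_ann {a i : ℕ} (h : ∀ t : A, x^a • t = 0) : KE x a N A i := by
  intro e
  rw [Ext.smul_eq_comp_mk₀]
  have : x^a • 𝟙 (ModuleCat.of S A) = 0 := by
    ext t
    exact h t
  rw [this]; simp

theorem KE.mono {p q i : ℕ} (h : p ≤ q) (hA : KE x p N A i) : KE x q N A i := by
  intro e
  obtain ⟨c, rfl⟩ := Nat.exists_eq_add_of_le h
  rw [pow_add, mul_comm, mul_smul, hA e, smul_zero]

theorem ext_vanish (L : List S) : ∀ (A : Type u) [AddCommGroup A] [Module S A],
    RingTheory.Sequence.IsWeaklyRegular A L → (∀ l ∈ L, ∀ t : N, l • t = 0) →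
    ∀ i < L.length, ∀ e : Ext (ModuleCat.of S N) (ModuleCat.of S A) i, e = 0 := by
  induction L with
  | nil => intro A _ _ _ _ i hi; simp at hi
  | cons l L ih =>
    intro A _ _ hreg hann i hi e
    rw [RingTheory.Sequence.isWeaklyRegular_cons_iff] at hreg
    have hS := IsSMulRegular.smulShortComplex_shortExact (M := ModuleCat.of S A) hreg.1
    have h0 : l • e = 0 := by
      have : l • e = (Ext.mk₀ (l • 𝟙 (ModuleCat.of S N))).comp e (zero_add i) := by
        simp [Ext.mk₀_smul]
      have h2 : l • 𝟙 (ModuleCat.of S N) = 0 := by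
        ext t
        exact hann l (by simp) t
      rw [this, h2]; simp
    rw [Ext.smul_eq_comp_mk₀] at h0
    cases i with
    | zero =>
      obtain ⟨g, rfl⟩ := Ext.addEquiv₀.symm.surjective e
      have := Ext.postcomp_mk₀_injective_of_mono (ModuleCat.of S N) (ModuleCat.smulShortComplex (ModuleCat.of S A) l).f
        (hf := hS.mono_f)
      apply this
      exact Eq.trans h0 (map_zero _).symm
    | succ i =>
      obtain ⟨x3, hx⟩ := Ext.covariant_sequence_exact₁ _ hS e h0 rfl
      have := ih _ hreg.2 (fun l' hl' => hann l' (by simp [hl'])) i (by simpa using hi) x3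
      have h3 : x3 = 0 := this
      rw [← hx, h3]
      exact Ext.zero_comp _ _ _ _ _

/-- the cohomology-killing property -/
def CP (x : S) (M : Type u) [AddCommGroup M] [Module S M] (j c : ℕ) : Prop :=
  ∀ (N : Type u) [AddCommGroup N] [Module S N] (s : ℕ),
    (∀ i < s, ∀ e : Ext (ModuleCat.of S N) (ModuleCat.of S S) i, e = 0) →
    ∀ i, i + j < s → KE x c N M i

theorem CP.base : CP x S 0 0 := by
  intro N _ _ s h i hi e
  rw [h i (by simpa using hi) e, smul_zero]

theorem CP.equiv {j c : ℕ} (e : A ≃ₗ[S] B) (h : CP x A j c) : CP x B j c := by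
  intro N _ _ s hs i hi
  have := KE.quot x (N := N) (p := c) (q := 0) (i := i) (A := PUnit.{u+1}) (0 : PUnit.{u+1} →ₗ[S] A) e.toLinearMap
    (fun _ _ _ => rfl) e.surjective (by
      intro t
      simp only [LinearEquiv.coe_coe, LinearEquiv.map_eq_zero_iff, LinearMap.zero_apply, Set.mem_range, exists_const]
      exact eq_comm) (h N s hs i hi) (KE.of_ann x (by intro t; rfl))
  exact this

theorem CP.step {j c a : ℕ} (F : S) (hF : IsSMulRegular A F) (h : CP x A j c)
    (g : A →ₗ[S] B) (hg : Function.Surjective g) (hgF : ∀ t, g (F • t) = 0)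
    (hk : ∀ t, g t = 0 → ∃ v, x^a • t = F • v) : CP x B (j+1) (2*c+a) := by
  intro N _ _ s hs i hi
  have h1 : KE x (c+c) N (QuotSMulTop F A) i := by
    refine KE.quot x (LinearMap.lsmul S A F) (Submodule.mkQ _) hF (Submodule.mkQ_surjective _)
      (LinearMap.exact_lsmul_mkQ_smul_top A F) (h N s hs i (by omega)) (h N s hs (i+1) (by omega))
  let g' : QuotSMulTop F A →ₗ[S] B := Submodule.liftQ _ g (by
    intro t ht
    obtain ⟨v, -, rfl⟩ := Submodule.mem_smul_pointwise_iff_exists _ _ _ |>.1 ht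
    exact hgF v)
  have hg' : Function.Surjective g' := by
    intro b
    obtain ⟨a, rfl⟩ := hg b
    exact ⟨Submodule.Quotient.mk a, rfl⟩
  rw [two_mul]
  refine KE.quot x (A := LinearMap.ker g') (Submodule.subtype _) g' (Submodule.subtype_injective _) hg'
    (by intro t; simp) h1 (KE.of_ann x ?_)
  rintro ⟨t, ht⟩
  obtain ⟨t, rfl⟩ := Submodule.Quotient.mk_surjective _ t
  obtain ⟨v, hv⟩ := hk t ht
  ext
  change x^a • Submodule.Quotient.mk t = _
  rw [← Submodule.Quotient.mk_smul, hv]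
  simp only [ZeroMemClass.coe_zero, Submodule.Quotient.mk_eq_zero]
  exact Submodule.smul_mem_pointwise_smul _ _ _ trivial

/-- degree zero consequence -/
theorem CP.hom {j c : ℕ} (h : CP x A j c) (L : List S)
    (hL : RingTheory.Sequence.IsWeaklyRegular S L) (hlen : j < L.length)
    (J : Ideal S) (hJ : ∀ l ∈ L, l ∈ J) (t : A) (ht : ∀ b ∈ J, b • t = 0) : x^c • t = 0 := by
  have hv := ext_vanish (N := S ⧸ J) L S hL (by
    intro l hl t
    obtain ⟨t, rfl⟩ := Ideal.Quotient.mk_surjective t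
    rw [← Ideal.Quotient.mk_eq_mk, ← Submodule.Quotient.mk_smul, Submodule.Quotient.mk_eq_zero]
    exact J.mul_mem_right _ (hJ l hl))
  have hk := h (S ⧸ J) L.length hv 0 (by simpa using hlen)
  let φ : (S ⧸ J) →ₗ[S] A := Submodule.liftQ J (LinearMap.toSpanSingleton S A t) (by
    intro b hb; simpa using ht b hb)
  have h1 := hk (Ext.mk₀ (ModuleCat.ofHom φ))
  rw [← Ext.mk₀_smul, Ext.mk₀_eq_zero_iff] at h1
  have h2 := congrArg (fun ψ => ψ.hom (Submodule.Quotient.mk 1)) h1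
  have h4 : x^c • φ (Submodule.Quotient.mk 1) = 0 := h2
  have h5 : φ (Submodule.Quotient.mk 1) = t := by
    simp only [φ, Submodule.liftQ_apply, LinearMap.toSpanSingleton_apply, one_smul]
  rwa [h5] at h4

theorem CP.ext1 {j c : ℕ} (h : CP x A j c) (L : List S)
    (hL : RingTheory.Sequence.IsWeaklyRegular S L) (hlen : j + 1 < L.length)
    (J : Ideal S) (hJ : ∀ l ∈ L, l ∈ J) (z : S) (hz : IsSMulRegular A z) (hzJ : z ∈ J)
    (t : A) (ht : ∀ b ∈ J, ∃ v, b • t = z • v) : ∃ v, x^c • t = z • v := by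
  have hv := ext_vanish (N := S ⧸ J) L S hL (by
    intro l hl t
    obtain ⟨t, rfl⟩ := Ideal.Quotient.mk_surjective t
    rw [← Ideal.Quotient.mk_eq_mk, ← Submodule.Quotient.mk_smul, Submodule.Quotient.mk_eq_zero]
    exact J.mul_mem_right _ (hJ l hl))
  have h1 := h (S ⧸ J) L.length hv 1 (by omega)
  have h0 : KE x 0 (S ⧸ J) A 0 := by
    intro e
    have := ext_vanish (N := S ⧸ J) [z] A
      ((RingTheory.Sequence.isWeaklyRegular_singleton_iff _ _).2 hz) (by
      intro l hl t
      obtain ⟨t, rfl⟩ := Ideal.Quotient.mk_surjective t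
      rw [← Ideal.Quotient.mk_eq_mk, ← Submodule.Quotient.mk_smul, Submodule.Quotient.mk_eq_zero]
      simp only [List.mem_singleton] at hl
      exact J.mul_mem_right _ (hl ▸ hzJ)) 0 (by simp) e
    rw [this, smul_zero]
  have hq : KE x (0+c) (S ⧸ J) (QuotSMulTop z A) 0 :=
    KE.quot x (LinearMap.lsmul S A z) (Submodule.mkQ _) hz (Submodule.mkQ_surjective _)
      (LinearMap.exact_lsmul_mkQ_smul_top A z) h0 h1
  let φ : (S ⧸ J) →ₗ[S] (QuotSMulTop z A) := Submodule.liftQ J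
    (LinearMap.toSpanSingleton S _ (Submodule.Quotient.mk t)) (by
    intro b hb
    obtain ⟨v, hv⟩ := ht b hb
    rw [LinearMap.mem_ker, LinearMap.toSpanSingleton_apply, ← Submodule.Quotient.mk_smul, hv,
      Submodule.Quotient.mk_eq_zero]
    exact Submodule.smul_mem_pointwise_smul _ _ _ trivial)
  rw [zero_add] at hq
  have h1 := hq (Ext.mk₀ (ModuleCat.ofHom φ))
  rw [← Ext.mk₀_smul, Ext.mk₀_eq_zero_iff] at h1
  have h2 := congrArg (fun ψ => ψ.hom (Submodule.Quotient.mk 1)) h1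
  have h3 : x^c • (Submodule.Quotient.mk t : QuotSMulTop z A) = 0 := by
    have h4 : x^c • φ (Submodule.Quotient.mk 1) = 0 := h2
    have h5 : φ (Submodule.Quotient.mk 1) = Submodule.Quotient.mk t := by
      simp only [φ, Submodule.liftQ_apply, LinearMap.toSpanSingleton_apply, one_smul]
    rwa [h5] at h4
  rw [← Submodule.Quotient.mk_smul, Submodule.Quotient.mk_eq_zero] at h3
  obtain ⟨v, -, hv⟩ := Submodule.mem_smul_pointwise_iff_exists _ _ _ |>.1 h3
  exact ⟨v, hv.symm⟩
end
end EN

namespace EN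
open scoped TensorProduct nonZeroDivisors

section norm
variable {P A : Type*} [CommRing P] [IsDomain P] [CommRing A] [Algebra P A]

theorem charpoly_integral {L V : Type*} [Field L] [Algebra P L] [AddCommGroup V] [Module L V]
    [FiniteDimensional L V] (f : V →ₗ[L] V) (p : Polynomial P) (hp : p.Monic)
    (hf : Polynomial.aeval f (p.map (algebraMap P L)) = 0) (i : ℕ) :
    IsIntegral P (f.charpoly.coeff i) := by
  let L' := AlgebraicClosure L
  have h1 : IsIntegral P ((f.charpoly.map (algebraMap L L')).coeff i) := by
    refine Polynomial.isIntegral_coeff_of_factors _ ?_ (IsAlgClosed.splits _) ?_ i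
    · rw [((LinearMap.charpoly_monic f).map _).leadingCoeff]; exact isIntegral_one
    intro x hx
    refine ⟨p, hp, ?_⟩
    rw [← LinearMap.charpoly_baseChange, ← Module.End.hasEigenvalue_iff_isRoot_charpoly] at hx
    obtain ⟨v, hv⟩ := hx.exists_hasEigenvector
    have h2 := Module.End.aeval_apply_of_hasEigenvector (p := (p.map (algebraMap P L)).map (algebraMap L L')) hv
    have h3 : Polynomial.aeval (f.baseChange L') ((p.map (algebraMap P L)).map (algebraMap L L'))
        = (Polynomial.aeval f (p.map (algebraMap P L))).baseChange L' := by
      rw [Polynomial.aeval_map_algebraMap]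
      have := Polynomial.aeval_algHom_apply (Module.End.baseChangeHom L L' V) f (p.map (algebraMap P L))
      exact this
    rw [h3, hf] at h2
    simp only [LinearMap.baseChange_zero, LinearMap.zero_apply] at h2
    have h4 := (smul_eq_zero.1 h2.symm).resolve_right hv.2
    rw [Polynomial.eval_map, Polynomial.eval₂_map] at h4
    rw [IsScalarTower.algebraMap_eq P L L']
    exact h4
  rw [Polynomial.coeff_map] at h1
  exact (isIntegral_algHom_iff (IsScalarTower.toAlgHom P L L') (algebraMap L L').injective).1 h1

/-- `b` is a generic basis of the `P`-module `A` -/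
def GB (P : Type*) {A : Type*} [CommRing P] [AddCommGroup A] [Module P A] {m : ℕ} (b : Fin m → A) : Prop :=
  LinearIndependent P b ∧ ∀ a, ∃ s : P, s ≠ 0 ∧ s • a ∈ Submodule.span P (Set.range b)

theorem norm_pkg [IsIntegrallyClosed P] [Module.Finite P A] [Module.IsTorsionFree P A] (F : A)
    (hF : ∀ a, F * a = 0 → a = 0) :
    ∃ c : P, c ≠ 0 ∧ (∃ g, algebraMap P A c = F * g) ∧ ∀ (m : ℕ) (b : Fin m → A), GB P b →
      ∀ (t : P) (M : Matrix (Fin m) (Fin m) P), t ≠ 0 → 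
      (∀ j, t • (F * b j) = ∑ i, M i j • b i) → t ^ m * c = M.det := by
  let L := FractionRing P
  let V := L ⊗[P] A
  let ι : A →ₗ[P] V := TensorProduct.mk P L A 1
  have hloc : IsLocalizedModule P⁰ ι := inferInstance
  have hι : Function.Injective ι := by
    rw [injective_iff_map_eq_zero]
    intro a ha
    obtain ⟨s, hs⟩ := (IsLocalizedModule.eq_zero_iff P⁰ ι).1 ha
    have : (s : P) • a = 0 := hs
    exact (smul_eq_zero.1 this).resolve_left (nonZeroDivisors.coe_ne_zero s)
  let f : V →ₗ[L] V := LinearMap.mulLeft L (ι F)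
  have hmul : ∀ a b, ι (a * b) = ι a * ι b := by
    intro a b; exact (Algebra.TensorProduct.includeRight : A →ₐ[P] V).map_mul a b
  have hfι : ∀ a, f (ι a) = ι (F * a) := by intro a; rw [hmul]; rfl
  obtain ⟨p, hp, hp0⟩ := Algebra.IsIntegral.isIntegral (R := P) F
  let ιA : A →ₐ[P] V := Algebra.TensorProduct.includeRight
  have hιA : ∀ a, ιA a = ι a := fun a => rfl
  have hint : ∀ i, IsIntegral P (f.charpoly.coeff i) := by
    refine charpoly_integral f p hp ?_
    have h1 : Polynomial.aeval (Algebra.lmul L V (ι F)) (p.map (algebraMap P L)) = 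
        Algebra.lmul L V (Polynomial.aeval (ι F) (p.map (algebraMap P L))) :=
      Polynomial.aeval_algHom_apply _ _ _
    have h2 : f = Algebra.lmul L V (ι F) := rfl
    rw [h2, h1, Polynomial.aeval_map_algebraMap, ← hιA, Polynomial.aeval_algHom_apply]
    have : Polynomial.aeval F p = 0 := hp0
    rw [this, map_zero, map_zero]
  have hlift : f.charpoly ∈ Polynomial.lifts (algebraMap P L) := by
    rw [Polynomial.lifts_iff_coeff_lifts]
    intro i
    obtain ⟨y, hy⟩ := IsIntegrallyClosed.isIntegral_iff.1 (hint i)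
    exact ⟨y, hy⟩
  obtain ⟨χ, hχ⟩ := (Polynomial.mem_lifts _).1 hlift
  have hχF : Polynomial.aeval F χ = 0 := by
    apply hι
    rw [map_zero, ← hιA, ← Polynomial.aeval_algHom_apply, hιA, ← Polynomial.aeval_map_algebraMap L, hχ]
    have h1 := LinearMap.aeval_self_charpoly f
    have h2 : f = Algebra.lmul L V (ι F) := rfl
    have h3 : Polynomial.aeval (Algebra.lmul L V (ι F)) f.charpoly = 
        Algebra.lmul L V (Polynomial.aeval (ι F) f.charpoly) :=
      Polynomial.aeval_algHom_apply _ _ _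
    rw [← h2, h1] at h3
    have h4 := congrArg (fun φ => φ 1) h3
    simpa using h4.symm
  have hdet : algebraMap P L ((-1)^(Module.finrank L V) * χ.coeff 0) = LinearMap.det f := by
    rw [LinearMap.det_eq_sign_charpoly_coeff, map_mul, map_pow, ← hχ, Polynomial.coeff_map]
    simp
  refine ⟨(-1)^(Module.finrank L V) * χ.coeff 0, ?_, ?_, ?_⟩
  · intro h0
    rw [h0, map_zero] at hdet
    have h1 := LinearMap.bot_lt_ker_of_det_eq_zero hdet.symm
    obtain ⟨v, hv, hv0⟩ := Submodule.exists_mem_ne_zero_of_ne_bot h1.ne'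
    obtain ⟨⟨a, s⟩, has⟩ := IsLocalizedModule.surj P⁰ ι v
    have h2 : ι (F * a) = 0 := by
      rw [← hfι, ← has]
      have : f (s • v) = (s : P) • f v := by
        exact (f.restrictScalars P).map_smul (s : P) v
      rw [this, LinearMap.mem_ker.1 hv, smul_zero]
    have h3 := hF a (hι (by rw [h2, map_zero]))
    dsimp only at has
    rw [h3, map_zero] at has
    have h4 : (algebraMap P L s) • v = 0 := by rw [algebraMap_smul]; exact has
    refine hv0 ((smul_eq_zero.1 h4).resolve_left ?_)
    simp
  · have h1 := Polynomial.divX_mul_X_add χ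
    have h2 := congrArg (Polynomial.aeval F) h1
    rw [hχF, map_add, map_mul, Polynomial.aeval_X, Polynomial.aeval_C] at h2
    refine ⟨- (algebraMap P A ((-1)^(Module.finrank L V)) * Polynomial.aeval F χ.divX), ?_⟩
    rw [map_mul, eq_neg_of_add_eq_zero_right h2]
    ring
  · intro m b hb t M ht hM
    have hli : LinearIndependent L (ι ∘ b) := LinearIndependent.of_isLocalizedModule L P⁰ ι hb.1
    have hsp : ⊤ ≤ Submodule.span L (Set.range (ι ∘ b)) := by
      rintro v -
      obtain ⟨⟨a, s⟩, has⟩ := IsLocalizedModule.surj P⁰ ι v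
      obtain ⟨s', hs', hsa⟩ := hb.2 a
      have h1 : ι (s' • a) ∈ Submodule.span L (Set.range (ι ∘ b)) := by
        have := Submodule.mem_map_of_mem (f := ι) hsa
        rw [Submodule.map_span, ← Set.range_comp] at this
        exact Submodule.span_le_restrictScalars P L _ this
      dsimp only at has
      have h2 : ι (s' • a) = algebraMap P L (s' * s) • v := by
        rw [map_smul, ← has, algebraMap_smul, mul_smul]; rfl
      rw [h2] at h1
      refine (Submodule.smul_mem_iff _ ?_).1 h1
      rw [Ne, FaithfulSMul.algebraMap_eq_zero_iff P L]
      exact mul_ne_zero hs' (nonZeroDivisors.coe_ne_zero s)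
    let B := Module.Basis.mk hli hsp
    have hB : ∀ i, B i = ι (b i) := fun i => by simp [B]
    apply FaithfulSMul.algebraMap_injective P L
    rw [map_mul, hdet, map_pow]
    have h5 : algebraMap P L t ^ m * LinearMap.det f = LinearMap.det (algebraMap P L t • f) := by
      rw [LinearMap.det_smul, Module.finrank_eq_card_basis B, Fintype.card_fin]
    rw [h5, ← LinearMap.det_toMatrix B, RingHom.map_det]
    congr 1
    ext i j
    rw [LinearMap.toMatrix_apply]
    have h6 : (algebraMap P L t • f) (B j) = ∑ i, algebraMap P L (M i j) • B i := by
      rw [LinearMap.smul_apply, hB, hfι, algebraMap_smul, ← map_smul, hM, map_sum]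
      refine Finset.sum_congr rfl fun i _ => ?_
      rw [map_smul, hB, algebraMap_smul]
    rw [h6, B.repr_sum_self]
    rfl

theorem GB.exists_gb (P A : Type*) [CommRing P] [IsDomain P] [AddCommGroup A] [Module P A] [Module.Finite P A] :
    ∃ (m : ℕ) (b : Fin m → A), GB P b := by
  obtain ⟨s, hs, hli⟩ := exists_finset_linearIndependent_of_le_finrank (le_refl (Module.finrank P A))
  let e := s.equivFin.trans (finCongr hs)
  let b : Fin (Module.finrank P A) → A := fun i => (e.symm i : A)
  have hb : LinearIndependent P b := hli.comp _ e.symm.injective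
  refine ⟨_, b, hb, ?_⟩
  intro a
  have h1 : ¬ LinearIndependent P (Fin.cons a b : Fin (Module.finrank P A + 1) → A) := by
    intro h
    have := h.fintype_card_le_finrank
    simp at this
  rw [Fintype.not_linearIndependent_iff] at h1
  obtain ⟨g, hg, i, hi⟩ := h1
  rw [Fin.sum_univ_succ] at hg
  simp only [Fin.cons_zero, Fin.cons_succ] at hg
  refine ⟨g 0, ?_, ?_⟩
  · intro h0
    rw [h0, zero_smul, zero_add] at hg
    have := Fintype.linearIndependent_iff.1 hb _ hg
    apply hi
    refine Fin.cases h0 (fun j => this j) i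
  · rw [eq_neg_of_add_eq_zero_left hg]
    refine Submodule.neg_mem _ (Submodule.sum_mem _ fun j _ => Submodule.smul_mem _ _ (Submodule.subset_span ⟨j, rfl⟩))

theorem GB.matrix {P A : Type*} [CommRing P] [IsDomain P] [AddCommGroup A] [Module P A] {m q : ℕ} {b : Fin m → A} (hb : GB P b)
    (u : Fin q → A) : ∃ (t : P) (M : Matrix (Fin m) (Fin q) P), t ≠ 0 ∧ ∀ j, t • u j = ∑ i, M i j • b i := by
  choose s hs hsu using fun j => hb.2 (u j)
  have h2 : ∀ j, (∏ i, s i) • u j ∈ Submodule.span P (Set.range b) := by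
    intro j
    rw [← Finset.prod_erase_mul _ _ (Finset.mem_univ j), mul_smul]
    exact Submodule.smul_mem _ _ (hsu j)
  choose N hN using fun j => (Submodule.mem_span_range_iff_exists_fun P).1 (h2 j)
  exact ⟨∏ i, s i, fun i j => N j i, Finset.prod_ne_zero_iff.2 fun i _ => hs i, fun j => (hN j).symm⟩

/-- semilinear invariance : a generic basis goes to a generic basis -/
theorem GB.map {P A P' A' : Type*} [CommRing P] [AddCommGroup A] [Module P A]
    [CommRing P'] [AddCommGroup A'] [Module P' A'] (τ : P ≃+* P') (e : A ≃+ A')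
    (he : ∀ p a, e (p • a) = τ p • e a) {m : ℕ} {b : Fin m → A} (hb : GB P b) :
    GB P' (fun i => e (b i)) := by
  constructor
  · rw [Fintype.linearIndependent_iff]
    intro g hg i
    have h1 : e (∑ i, τ.symm (g i) • b i) = 0 := by
      rw [map_sum, ← hg]
      refine Finset.sum_congr rfl fun i _ => ?_
      rw [he, RingEquiv.apply_symm_apply]
    have h2 := Fintype.linearIndependent_iff.1 hb.1 _ (e.map_eq_zero_iff.1 h1) i
    simpa using h2
  · intro a
    obtain ⟨s, hs, h⟩ := hb.2 (e.symm a)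
    obtain ⟨c, hc⟩ := (Submodule.mem_span_range_iff_exists_fun P).1 h
    refine ⟨τ s, by simpa using hs, ?_⟩
    have h3 : τ s • a = ∑ i, τ (c i) • e (b i) := by
      have := congrArg e hc
      rw [he, AddEquiv.apply_symm_apply, map_sum] at this
      rw [← this]
      exact Finset.sum_congr rfl fun i _ => (he _ _)
    rw [h3]
    exact Submodule.sum_mem _ fun i _ => Submodule.smul_mem _ _ (Submodule.subset_span ⟨i, rfl⟩)

/-- the hub property determines how `c` transforms -/
theorem hub_scale {K P A : Type*} [Field K] [CommRing P] [IsDomain P] [Algebra K P] [CommRing A] [Algebra P A]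
    (F : A) (c : P)
    (hub : ∀ (m : ℕ) (b : Fin m → A), GB P b →
      ∀ (t : P) (M : Matrix (Fin m) (Fin m) P), t ≠ 0 → 
      (∀ j, t • (F * b j) = ∑ i, M i j • b i) → t ^ m * c = M.det)
    {m : ℕ} {b : Fin m → A} (hb : GB P b)
    (τ : P ≃+* P) (e : A ≃+* A) (he : ∀ p a, e (p • a) = τ p • e a) (μ : P)
    (hF : e F = μ • F) : τ c = μ ^ m * c := by
  obtain ⟨t, M, ht, hM⟩ := hb.matrix (fun j => F * b j)
  have hμ : ∀ j, τ t • (μ • F * e (b j)) = ∑ i, τ (M i j) • e (b i) := by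
    intro j
    have := congrArg e (hM j)
    rw [he, map_mul, hF, map_sum] at this
    rw [this]
    exact Finset.sum_congr rfl fun i _ => (he _ _)
  have hgb := GB.map τ e.toAddEquiv he hb
  have h0 := hub m b hb t M ht hM
  by_cases hμ0 : μ = 0
  · subst hμ0
    have hF0 : F = 0 := by simpa using hF
    rcases Nat.eq_zero_or_pos m with rfl | hm
    · have h1 : c = 1 := by simpa using h0
      rw [h1]; simp
    · have h2 := hub m b hb 1 0 one_ne_zero (by intro j; simp [hF0])
      haveI : Nonempty (Fin m) := ⟨⟨0, hm⟩⟩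
      have h3 : c = 0 := by simpa [Matrix.det_zero] using h2
      rw [h3]; simp
  · have h1 := hub m _ hgb (τ t * μ) (M.map τ) (mul_ne_zero (by simpa using ht) hμ0) (by
      intro j
      rw [mul_smul]
      simpa [mul_smul_comm, smul_mul_assoc] using hμ j)
    have h2 : (M.map τ).det = τ M.det := by
      rw [← RingEquiv.coe_toRingHom, RingHom.map_det]; rfl
    rw [h2, ← h0, map_mul, map_pow, mul_pow, mul_assoc] at h1
    exact (mul_left_cancel₀ (pow_ne_zero _ (by simpa using ht)) h1).symm
end norm
end EN

namespace EN
open scoped TensorProduct nonZeroDivisors Polynomial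
open Submodule

section
variable {k V : Type*} [Field k] [AddCommGroup V] [Module k[X] V] [Module k V] [IsScalarTower k k[X] V]

theorem finrank_quot_det {m : ℕ} (b : Module.Basis (Fin m) k[X] V) (f : V →ₗ[k[X]] V)
    (hdet : LinearMap.det f ≠ 0) :
    Module.Finite k (V ⧸ LinearMap.range f) ∧
    Module.finrank k (V ⧸ LinearMap.range f) = (LinearMap.det f).natDegree := by
  have hinj : Function.Injective f := by
    have h := LinearMap.det_toMatrix b f
    rw [← h] at hdet
    intro x y hxy
    have h2 : Function.Injective (Matrix.mulVec (LinearMap.toMatrix b b f)) :=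
      Matrix.mulVec_injective_of_det_ne_zero hdet
    apply b.repr.injective
    apply DFunLike.coe_injective
    apply h2
    rw [LinearMap.toMatrix_mulVec_repr, LinearMap.toMatrix_mulVec_repr, hxy]
  let e0 := LinearEquiv.ofInjective f hinj
  have hr : Module.finrank k[X] (LinearMap.range f) = Module.finrank k[X] V := e0.finrank_eq.symm
  let a := smithNormalFormCoeffs b hr
  let b' := smithNormalFormTopBasis b hr
  let ab := smithNormalFormBotBasis b hr
  have ab_eq := smithNormalFormBotBasis_def b hr
  have ha : ∀ i, a i ≠ 0 := smithNormalFormCoeffs_ne_zero b hr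
  let e : V ≃ₗ[k[X]] V := (b'.equiv ab (Equiv.refl _)).trans e0.symm
  have hassoc : Associated (LinearMap.det f) (∏ i, a i) := by
    classical
    rw [← Matrix.det_diagonal, ← LinearMap.det_toLin b']
    refine (LinearMap.associated_det_of_eq_comp e _ _ ?_).symm
    intro x
    have : Matrix.toLin b' b' (Matrix.diagonal a) = f.comp e.toLinearMap := by
      refine b'.ext fun i => ?_
      have h1 : f (e (b' i)) = ab i := by
        have h2 : e0 (e (b' i)) = ab i := by simp [e]
        rw [← h2]; rfl
      rw [LinearMap.comp_apply]
      change _ = f (e (b' i))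
      rw [h1, ab_eq, Matrix.toLin_self]
      simp [Matrix.diagonal_apply, a, b']
    rw [this]; rfl
  have hfin : ∀ i, Module.Finite k (k[X] ⧸ Ideal.span {a i}) := fun i =>
    PowerBasis.finite <| AdjoinRoot.powerBasis <| ha i
  let E := (LinearMap.range f).quotientEquivPiSpan b hr
  constructor
  · exact Module.Finite.equiv (E.restrictScalars k).symm
  · rw [Polynomial.natDegree_eq_of_degree_eq (Polynomial.degree_eq_degree_of_associated hassoc),
      Polynomial.natDegree_prod _ _ fun i _ => ha i, (E.restrictScalars k).finrank_eq,
      Module.finrank_pi_fintype]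
    congr with i
    exact (AdjoinRoot.powerBasis <| ha i).finrank
end

attribute [local instance] Polynomial.algebra Polynomial.isLocalization in
theorem rank_le_aux {B A V : Type*} [CommRing B] [IsDomain B] [CommRing A] [Algebra B[X] A]
    [Module.Finite B[X] A] [Module.IsTorsionFree B[X] A] [CommRing V] [Algebra (FractionRing B)[X] V]
    [Algebra B[X] V] [IsScalarTower B[X] (FractionRing B)[X] V] [Algebra (FractionRing B) V]
    [IsScalarTower (FractionRing B) (FractionRing B)[X] V] [Module.Finite (FractionRing B)[X] V]
    (ι0 : A →ₐ[B[X]] V) [hloc0 : IsLocalizedModule (B⁰.map (Polynomial.C : B →+* B[X])) ι0.toLinearMap]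
    (F : A) (c : B[X]) (hc : c ≠ 0)
    (hub : ∀ (m : ℕ) (b : Fin m → A), GB B[X] b →
      ∀ (t : B[X]) (M : Matrix (Fin m) (Fin m) B[X]), t ≠ 0 → 
      (∀ j, t • (F * b j) = ∑ i, M i j • b i) → t ^ m * c = M.det) {q : ℕ} (u : Fin q → A)
    (hu : ∀ β : Fin q → B, (∃ s : B, s ≠ 0 ∧ ∃ v, (Polynomial.C s) • ∑ i, Polynomial.C (β i) • u i = F * v) → 
      ∀ i, β i = 0) : q ≤ c.natDegree := by
  let k := FractionRing B
  let T : Submonoid B[X] := B⁰.map Polynomial.C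
  have hT : T ≤ B[X]⁰ := by
    rintro _ ⟨s, hs, rfl⟩
    rw [mem_nonZeroDivisors_iff_ne_zero]
    simpa using nonZeroDivisors.ne_zero hs
  let ι : A →ₗ[B[X]] V := ι0.toLinearMap
  haveI hlocQ : IsLocalization T k[X] := Polynomial.isLocalization B⁰ k
  have hloc : IsLocalizedModule T ι := hloc0
  have hι : Function.Injective ι := by
    rw [injective_iff_map_eq_zero]
    intro a ha
    obtain ⟨s, hs⟩ := (IsLocalizedModule.eq_zero_iff T ι).1 ha
    have : (s : B[X]) • a = 0 := hs
    exact (smul_eq_zero.1 this).resolve_left (nonZeroDivisors.ne_zero (hT s.2))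
  haveI : Module.IsTorsionFree k[X] V := IsLocalizedModule.isTorsionFree (f := ι) T
  haveI : IsPrincipalIdealRing k[X] := inferInstance
  haveI : Module.Free k[X] V := Module.free_of_finite_type_torsion_free' (R := k[X]) (M := V)
  let f : V →ₗ[k[X]] V := LinearMap.mulLeft k[X] (ι F)
  have hmul : ∀ a b, ι (a * b) = ι a * ι b := by
    intro a b; exact ι0.map_mul a b
  have hfι : ∀ a, f (ι a) = ι (F * a) := by intro a; rw [hmul]; rfl
  have hsmul : ∀ (p : B[X]) (v : V), algebraMap B[X] k[X] p • v = p • v := fun p v => by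
    rw [Algebra.smul_def, Algebra.smul_def, ← IsScalarTower.algebraMap_apply]
  have hinjQ : Function.Injective (algebraMap B[X] k[X]) := IsLocalization.injective _ hT
  let m := Module.finrank k[X] V
  let b0 : Module.Basis (Fin m) k[X] V := Module.finBasis k[X] V
  choose as has using fun j => IsLocalizedModule.surj T ι (b0 j)
  have hunit : ∀ j, IsUnit (algebraMap B[X] k[X] ((as j).2 : B[X])) := fun j => IsLocalization.map_units _ _
  let b1 := b0.isUnitSMul hunit
  let b : Fin m → A := fun j => (as j).1
  have hb1 : ∀ j, b1 j = ι (b j) := by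
    intro j
    rw [Module.Basis.isUnitSMul_apply, hsmul]
    exact has j
  have hgb : GB B[X] b := by
    constructor
    · apply LinearIndependent.of_comp ι
      have h1 : LinearIndependent B[X] b1 := b1.linearIndependent.restrict_scalars (by
        intro x y hxy
        apply hinjQ
        simpa [Algebra.smul_def] using hxy)
      convert h1 using 1
      ext j; exact (hb1 j).symm
    · intro a
      obtain ⟨s, hs⟩ := IsLocalization.exist_integer_multiples_of_finite T (fun j => b1.repr (ι a) j)
      choose p hp using hs
      refine ⟨s, nonZeroDivisors.ne_zero (hT s.2), ?_⟩
      have h1 : (s : B[X]) • a = ∑ j, p j • b j := by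
        apply hι
        rw [map_smul, map_sum, ← b1.sum_repr (ι a), Finset.smul_sum]
        refine Finset.sum_congr rfl fun j _ => ?_
        rw [map_smul, ← hb1, ← hsmul (p j), hp j, smul_assoc]
      rw [h1]
      exact Submodule.sum_mem _ fun i _ => Submodule.smul_mem _ _ (Submodule.subset_span ⟨i, rfl⟩)
  have hdet : LinearMap.det f = algebraMap B[X] k[X] c := by
    obtain ⟨t, M, ht, hM⟩ := hgb.matrix (fun j => F * b j)
    have h0 := hub m b hgb t M ht hM
    have h5 : algebraMap B[X] k[X] t ^ m * LinearMap.det f = LinearMap.det (algebraMap B[X] k[X] t • f) := by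
      rw [LinearMap.det_smul]
    have h7 : LinearMap.det (algebraMap B[X] k[X] t • f) = algebraMap B[X] k[X] M.det := by
      rw [← LinearMap.det_toMatrix b1, RingHom.map_det]
      congr 1
      ext1 i j
      rw [LinearMap.toMatrix_apply]
      have h6 : (algebraMap B[X] k[X] t • f) (b1 j) = ∑ i, algebraMap B[X] k[X] (M i j) • b1 i := by
        rw [LinearMap.smul_apply, hb1, hfι, hsmul, ← map_smul, hM, map_sum]
        refine Finset.sum_congr rfl fun i _ => ?_
        rw [map_smul, hb1, hsmul]
      rw [h6, b1.repr_sum_self]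
      rfl
    rw [h7, ← h0, map_mul, map_pow] at h5
    exact mul_left_cancel₀ (pow_ne_zero _ (by simpa using (map_ne_zero_iff _ hinjQ).2 ht)) h5
  have hdeg : (algebraMap B[X] k[X] c).natDegree = c.natDegree := by
    have : algebraMap B[X] k[X] c = c.map (algebraMap B k) := rfl
    rw [this, Polynomial.natDegree_map_eq_of_injective (IsFractionRing.injective B k)]
  obtain ⟨hfin, hrk⟩ := finrank_quot_det b1 f (by rw [hdet]; exact (map_ne_zero_iff _ hinjQ).2 hc)
  rw [hdet, hdeg] at hrk
  rw [← hrk]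
  have hli : LinearIndependent k (fun j => (LinearMap.range f).mkQ (ι (u j))) := by
    rw [Fintype.linearIndependent_iff]
    intro κ hκ i
    obtain ⟨s, hs⟩ := IsLocalization.exist_integer_multiples_of_finite B⁰ κ
    choose β hβ using hs
    have h1 : (∑ j, κ j • ι (u j)) ∈ LinearMap.range f := by
      rw [← Submodule.ker_mkQ (LinearMap.range f), LinearMap.mem_ker, map_sum, ← hκ]
      refine Finset.sum_congr rfl fun j _ => ?_
      exact ((LinearMap.range f).mkQ.restrictScalars k).map_smul _ _
    obtain ⟨v, hv⟩ := h1
    obtain ⟨⟨w, s', hs'⟩, hw⟩ := IsLocalizedModule.surj T ι v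
    obtain ⟨s'', hs'', rfl⟩ := hs'
    have hw' : (Polynomial.C s'' : B[X]) • v = ι w := hw
    have hksmul : ∀ (a : k) (v : V), a • v = (Polynomial.C a : k[X]) • v := fun a v => by
      rw [Algebra.smul_def, Algebra.smul_def, IsScalarTower.algebraMap_apply k k[X] V]; rfl
    have h2 : (Polynomial.C (s : B) : B[X]) • ∑ j, κ j • ι (u j) = ι (∑ j, Polynomial.C (β j) • u j) := by
      rw [Finset.smul_sum, map_sum]
      refine Finset.sum_congr rfl fun j _ => ?_
      rw [map_smul, ← hsmul, ← hsmul, hksmul, Algebra.smul_def, Algebra.smul_def, Algebra.smul_def, ← mul_assoc, ← map_mul]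
      congr 2
      have e1 : ∀ z : B, algebraMap B[X] k[X] (Polynomial.C z) = Polynomial.C (algebraMap B k z) := fun z =>
        Polynomial.map_C _
      rw [e1, e1, ← Polynomial.C_mul, hβ j, Algebra.smul_def]
    have h3 : β i = 0 := by
      refine hu β ⟨s'', nonZeroDivisors.ne_zero hs'', (Polynomial.C (s : B) : B[X]) • w, ?_⟩ i
      apply hι
      have hfl : ∀ (p : B[X]) v, f (p • v) = p • f v := fun p v => (f.restrictScalars B[X]).map_smul p v
      rw [map_smul, ← h2, ← hv, ← hfl, ← hfl, smul_comm, hw', ← map_smul, hfι]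
    have h4 := hβ i
    rw [h3, map_zero, Algebra.smul_def] at h4
    refine (mul_eq_zero.1 h4.symm).resolve_left ?_
    simp
  have := hli.fintype_card_le_finrank
  simpa using this


attribute [local instance] Polynomial.algebra Polynomial.isLocalization in
theorem rank_le {B A : Type*} [CommRing B] [IsDomain B] [CommRing A] [Algebra B[X] A]
    [Module.Finite B[X] A] [Module.IsTorsionFree B[X] A] (F : A) (c : B[X]) (hc : c ≠ 0)
    (hub : ∀ (m : ℕ) (b : Fin m → A), GB B[X] b →
      ∀ (t : B[X]) (M : Matrix (Fin m) (Fin m) B[X]), t ≠ 0 → 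
      (∀ j, t • (F * b j) = ∑ i, M i j • b i) → t ^ m * c = M.det) {q : ℕ} (u : Fin q → A)
    (hu : ∀ β : Fin q → B, (∃ s : B, s ≠ 0 ∧ ∃ v, (Polynomial.C s) • ∑ i, Polynomial.C (β i) • u i = F * v) → 
      ∀ i, β i = 0) : q ≤ c.natDegree := by
  haveI hlocQ : IsLocalization (B⁰.map (Polynomial.C : B →+* B[X])) (FractionRing B)[X] := Polynomial.isLocalization B⁰ _
  haveI : IsLocalizedModule (B⁰.map (Polynomial.C : B →+* B[X]))
    (Algebra.TensorProduct.includeRight : A →ₐ[B[X]] (FractionRing B)[X] ⊗[B[X]] A).toLinearMap :=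
    inferInstanceAs (IsLocalizedModule (B⁰.map (Polynomial.C : B →+* B[X])) (TensorProduct.mk B[X] (FractionRing B)[X] A 1))
  exact rank_le_aux (V := (FractionRing B)[X] ⊗[B[X]] A) (Algebra.TensorProduct.includeRight : A →ₐ[B[X]] (FractionRing B)[X] ⊗[B[X]] A) F c hc hub u hu
end EN

namespace EN
open MvPolynomial

section graded
variable {σ K : Type*} [Field K]

attribute [local instance] MvPolynomial.gradedAlgebra in
theorem hc_mul {F : MvPolynomial σ K} {δ : ℕ} (hF : F.IsHomogeneous δ) (v : MvPolynomial σ K) (q : ℕ) :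
    homogeneousComponent q (F * v) = if δ ≤ q then F * homogeneousComponent (q - δ) v else 0 := by
  have := DirectSum.coe_decompose_mul_of_left_mem (𝒜 := homogeneousSubmodule σ K) (b := v) q hF
  have hd : ∀ (p : MvPolynomial σ K) i, ((DirectSum.decompose (homogeneousSubmodule σ K) p i : _) : MvPolynomial σ K) =
    homogeneousComponent i p := fun p i => decomposition.decompose'_apply p i
  rwa [hd, hd] at this

def HI (I : Ideal (MvPolynomial σ K)) : Prop := ∀ g ∈ I, ∀ q, homogeneousComponent q g ∈ I

theorem HI.bot : HI (⊥ : Ideal (MvPolynomial σ K)) := by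
  intro g hg q
  simp only [Ideal.mem_bot] at hg ⊢
  rw [hg, map_zero]

theorem HI.sup {I J : Ideal (MvPolynomial σ K)} (hI : HI I) (hJ : HI J) : HI (I ⊔ J) := by
  intro g hg q
  obtain ⟨a, ha, b, hb, rfl⟩ := Submodule.mem_sup.1 hg
  rw [map_add]
  exact Submodule.add_mem_sup (hI a ha q) (hJ b hb q)

attribute [local instance] MvPolynomial.gradedAlgebra in
theorem HI.span {s : Set (MvPolynomial σ K)} (hs : ∀ x ∈ s, ∃ d, x.IsHomogeneous d) : HI (Ideal.span s) := by
  intro g hg q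
  have h := Ideal.homogeneous_span (homogeneousSubmodule σ K) s (fun x hx => by
    obtain ⟨d, hd⟩ := hs x hx; exact ⟨d, hd⟩)
  exact homogeneousComponent_mem_of_mem h hg q

theorem HI.sup1 {I : Ideal (MvPolynomial σ K)} (hI : HI I) {F g : MvPolynomial σ K} {δ q : ℕ}
    (hF : F.IsHomogeneous δ) (hg : g.IsHomogeneous q) (h : g ∈ I ⊔ Ideal.span {F}) :
    ∃ v, g - F * v ∈ I ∧ v.IsHomogeneous (q - δ) ∧ (q < δ → v = 0) := by
  obtain ⟨a, ha, b, hb, hab⟩ := Submodule.mem_sup.1 h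
  obtain ⟨v, rfl⟩ := Ideal.mem_span_singleton'.1 hb
  have h1 := congrArg (homogeneousComponent q) hab
  rw [homogeneousComponent_eq_self hg, map_add, mul_comm v F, hc_mul hF] at h1
  split_ifs at h1 with hq
  · refine ⟨homogeneousComponent (q - δ) v, ?_, homogeneousComponent_isHomogeneous _ _, fun h => by omega⟩
    rw [← h1, add_sub_cancel_right]
    exact hI a ha q
  · refine ⟨0, ?_, isHomogeneous_zero _ _ _, fun _ => rfl⟩
    rw [← h1, mul_zero, sub_zero, add_zero]
    exact hI a ha q

theorem HI.sup_lin {I : Ideal (MvPolynomial σ K)} (hI : HI I) {ι : Type*} [Fintype ι] (y : ι → MvPolynomial σ K)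
    (hy : ∀ i, (y i).IsHomogeneous 1) {g : MvPolynomial σ K} {q : ℕ}
    (hg : g.IsHomogeneous (q+1)) (h : g ∈ I ⊔ Ideal.span (Set.range y)) :
    ∃ v : ι → MvPolynomial σ K, g - ∑ i, v i * y i ∈ I ∧ ∀ i, (v i).IsHomogeneous q := by
  obtain ⟨a, ha, b, hb, hab⟩ := Submodule.mem_sup.1 h
  obtain ⟨v, rfl⟩ := (Ideal.mem_span_range_iff_exists_fun).1 hb
  have h1 := congrArg (homogeneousComponent (q+1)) hab
  rw [homogeneousComponent_eq_self hg, map_add, map_sum] at h1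
  refine ⟨fun i => homogeneousComponent q (v i), ?_, fun i => homogeneousComponent_isHomogeneous _ _⟩
  have h2 : ∀ i, homogeneousComponent (q+1) (v i * y i) = homogeneousComponent q (v i) * y i := by
    intro i
    rw [mul_comm, hc_mul (hy i), if_pos (by omega), mul_comm]
    simp
  simp only [h2] at h1
  rw [← h1, add_sub_cancel_right]
  exact hI a ha _

/-- scaling -/
noncomputable def scal (a : K) : MvPolynomial σ K →ₐ[K] MvPolynomial σ K := aeval (fun i => C a * X i)

theorem scal_homog (a : K) {p : MvPolynomial σ K} {q : ℕ} (hp : p.IsHomogeneous q) :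
    scal a p = C (a^q) * p := by
  conv_lhs => rw [p.as_sum]
  conv_rhs => rw [p.as_sum]
  rw [map_sum, Finset.mul_sum]
  refine Finset.sum_congr rfl fun m hm => ?_
  have hd : m.degree = q := by
    by_contra h
    exact (mem_support_iff.1 hm) (hp.coeff_eq_zero h)
  rw [scal, aeval_monomial, Finsupp.prod]
  simp only [mul_pow, Finset.prod_mul_distrib]
  rw [Finset.prod_pow_eq_pow_sum, ← map_pow, monomial_eq, Finsupp.prod]
  have : ∑ i ∈ m.support, m i = q := hd
  rw [this, algebraMap_eq]; ring

theorem scal_comp (a b : K) (p : MvPolynomial σ K) : scal a (scal b p) = scal (a*b) p := by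
  have : (scal a).comp (scal b) = (scal (a*b) : MvPolynomial σ K →ₐ[K] _) := by
    apply algHom_ext; intro i; simp [scal]; ring
  exact DFunLike.congr_fun this p

theorem scal_one (p : MvPolynomial σ K) : scal 1 p = p := by
  have : (scal 1 : MvPolynomial σ K →ₐ[K] _) = AlgHom.id K _ := by
    apply algHom_ext; intro i; simp [scal]
  exact DFunLike.congr_fun this p

noncomputable def scalE (a : K) (ha : a ≠ 0) : MvPolynomial σ K ≃ₐ[K] MvPolynomial σ K :=
  AlgEquiv.ofAlgHom (scal a) (scal a⁻¹) (by ext1; simp [scal_comp, ha, scal_one])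
    (by ext1; simp [scal_comp, ha, scal_one])

theorem HI.scal {I : Ideal (MvPolynomial σ K)} (hI : HI I) (a : K) {g : MvPolynomial σ K} (hg : g ∈ I) :
    EN.scal a g ∈ I := by
  rw [← sum_homogeneousComponent g, map_sum]
  refine Ideal.sum_mem _ fun q _ => ?_
  rw [scal_homog a (homogeneousComponent_isHomogeneous q g)]
  exact I.mul_mem_left _ (hI g hg q)

theorem pow_eq_all [Infinite K] {a b : ℕ} (h : ∀ t : K, t ≠ 0 → t^a = t^b) : a = b := by
  have : (Polynomial.X * (Polynomial.X^a - Polynomial.X^b) : Polynomial K) = 0 := by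
    apply Polynomial.funext
    intro t
    by_cases ht : t = 0 <;> simp [ht, sub_eq_zero]
    exact h t ht
  have h2 := (mul_eq_zero.1 this).resolve_left Polynomial.X_ne_zero
  rw [sub_eq_zero] at h2
  simpa using congrArg Polynomial.natDegree h2

theorem homog_of_scal [Infinite K] {c : MvPolynomial σ K} {N : ℕ}
    (h : ∀ t : K, t ≠ 0 → scal t c = C (t^N) * c) : c.IsHomogeneous N := by
  have key : ∀ q, q ≠ N → homogeneousComponent q c = 0 := by
    intro q hq
    by_contra hne
    apply hq
    apply pow_eq_all (K := K)
    intro t ht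
    have h1 := congrArg (homogeneousComponent q) (h t ht)
    rw [homogeneousComponent_C_mul] at h1
    have h2 : homogeneousComponent q (scal t c) = C (t^q) * homogeneousComponent q c := by
      conv_lhs => rw [← sum_homogeneousComponent c]
      rw [map_sum, map_sum]
      have : ∀ i, homogeneousComponent q (scal t (homogeneousComponent i c)) =
          if i = q then C (t^q) * homogeneousComponent q c else 0 := by
        intro i
        rw [scal_homog t (homogeneousComponent_isHomogeneous i c), homogeneousComponent_C_mul,
          homogeneousComponent_of_mem (homogeneousComponent_mem i c)]
        split_ifs with h1 h2 h3
        · rw [h1]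
        · exact absurd h1.symm h2
        · exact absurd h3.symm h1
        · simp
      simp only [this]
      rw [Finset.sum_ite_eq']
      split_ifs with hh
      · rfl
      · rw [homogeneousComponent_eq_zero _ _ (by simpa using hh), mul_zero]
    rw [h2] at h1
    exact C_injective _ _ (mul_right_cancel₀ hne h1)
  have : c = homogeneousComponent N c := by
    conv_lhs => rw [← sum_homogeneousComponent c]
    by_cases hN : N ∈ Finset.range (c.totalDegree + 1)
    · exact Finset.sum_eq_single_of_mem N hN fun q _ hq => key q hq
    · rw [homogeneousComponent_eq_zero _ _ (by simpa using hN)]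
      exact Finset.sum_eq_zero fun q hq => key q (by rintro rfl; exact hN hq)
  rw [this]
  exact homogeneousComponent_isHomogeneous _ _

theorem homog_factor {i : σ} {c : MvPolynomial σ K} {e N : ℕ} (h : (X i ^ e * c).IsHomogeneous N) (hc : c ≠ 0) :
    ∃ D, e + D = N ∧ c.IsHomogeneous D := by
  have hX : (X i ^ e : MvPolynomial σ K).IsHomogeneous e := by simpa using isHomogeneous_X_pow i e
  have key : ∀ q, e + q ≠ N → homogeneousComponent q c = 0 := by
    intro q hq
    have h1 := hc_mul hX c (e+q)
    rw [homogeneousComponent_of_mem h, if_neg hq, if_pos (by omega)] at h1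
    have := (mul_eq_zero.1 h1.symm).resolve_left (pow_ne_zero _ (X_ne_zero i))
    simpa using this
  have hex : ∃ D, homogeneousComponent D c ≠ 0 := by
    by_contra hh
    push Not at hh
    apply hc
    rw [← sum_homogeneousComponent c]
    exact Finset.sum_eq_zero fun q _ => hh q
  obtain ⟨D, hD⟩ := hex
  have hDN : e + D = N := by by_contra hh; exact hD (key D hh)
  refine ⟨D, hDN, ?_⟩
  have : c = homogeneousComponent D c := by
    conv_lhs => rw [← sum_homogeneousComponent c]
    by_cases hN : D ∈ Finset.range (c.totalDegree + 1)
    · exact Finset.sum_eq_single_of_mem D hN fun q _ hq => key q (by omega)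
    · exact absurd (homogeneousComponent_eq_zero _ _ (by simpa using hN)) hD
  rw [this]
  exact homogeneousComponent_isHomogeneous _ _

theorem X_factor [Finite σ] (i : σ) {c : MvPolynomial σ K} (hc : c ≠ 0) :
    ∃ e c', c = X i ^ e * c' ∧ ¬ X i ∣ c' := by
  have hf : FiniteMultiplicity (X i : MvPolynomial σ K) c :=
    FiniteMultiplicity.of_not_isUnit (X_prime (R := K)).not_unit hc
  obtain ⟨c', h1, h2⟩ := hf.exists_eq_pow_mul_and_not_dvd
  exact ⟨_, c', h1, h2⟩

end graded
end EN

namespace EN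
open MvPolynomial RingTheory.Sequence
open scoped Pointwise

theorem reg_monic {B : Type*} [CommRing B] (p : Polynomial B) (hp : p.Monic) {z : List B}
    (hz : IsWeaklyRegular B z) : IsWeaklyRegular (Polynomial B) (p :: z.map Polynomial.C) := by
  rw [isWeaklyRegular_cons_iff]
  constructor
  · intro a b hab
    have : p * (a - b) = 0 := by rw [mul_sub, sub_eq_zero]; exact hab
    exact sub_eq_zero.1 ((hp.mul_right_eq_zero_iff).1 this)
  · haveI : Module.Free B (AdjoinRoot p) := Module.Free.of_basis (AdjoinRoot.powerBasis' hp).basis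
    have h1 : IsWeaklyRegular (AdjoinRoot p) (z.map (algebraMap B (AdjoinRoot p))) := hz.of_flat
    have heq : (p • ⊤ : Submodule (Polynomial B) (Polynomial B)) = Ideal.span {p} := by
      ext x
      rw [Submodule.mem_smul_pointwise_iff_exists, Ideal.mem_span_singleton']
      constructor
      · rintro ⟨b, -, rfl⟩; exact ⟨b, mul_comm _ _⟩
      · rintro ⟨b, rfl⟩; exact ⟨b, trivial, mul_comm _ _⟩
    let e : QuotSMulTop p (Polynomial B) ≃+ AdjoinRoot p := (Submodule.quotEquivOfEq _ _ heq).toAddEquiv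
    refine (e.isWeaklyRegular_congr ?_).2 h1
    rw [List.forall₂_map_left_iff, List.forall₂_map_right_iff]
    refine List.forall₂_same.mpr fun b _ x => ?_
    obtain ⟨x, rfl⟩ := Submodule.Quotient.mk_surjective _ x
    rw [← Submodule.Quotient.mk_smul]
    exact (AdjoinRoot.mk p).map_mul (Polynomial.C b) x

theorem reg_equiv {P Q : Type*} [CommRing P] [CommRing Q] (e : P ≃+* Q) {z : List P}
    (hz : IsWeaklyRegular P z) : IsWeaklyRegular Q (z.map e) := by
  refine (e.toAddEquiv.isWeaklyRegular_congr ?_).1 hz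
  rw [List.forall₂_map_right_iff]
  exact List.forall₂_same.mpr fun b _ x => e.map_mul b x

theorem reg_one {P : Type*} [CommRing P] [IsDomain P] {t : P} (ht : t ≠ 0) : IsWeaklyRegular P [t] := by
  rw [isWeaklyRegular_singleton_iff]
  intro a b hab
  exact mul_left_cancel₀ ht hab

theorem reg_two {P : Type*} [CommRing P] [IsDomain P] {t s : P} (ht : t ≠ 0)
    (hs : ∀ a, t ∣ s * a → t ∣ a) : IsWeaklyRegular P [t, s] := by
  rw [isWeaklyRegular_cons_iff, isWeaklyRegular_singleton_iff]
  refine ⟨fun a b hab => mul_left_cancel₀ ht hab, ?_⟩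
  intro x y hxy
  obtain ⟨x, rfl⟩ := Submodule.Quotient.mk_surjective _ x
  obtain ⟨y, rfl⟩ := Submodule.Quotient.mk_surjective _ y
  have h1 : (Submodule.Quotient.mk (s • x) : QuotSMulTop t P) = Submodule.Quotient.mk (s • y) := hxy
  rw [Submodule.Quotient.eq, Submodule.mem_smul_pointwise_iff_exists] at h1
  obtain ⟨b, -, hb⟩ := h1
  obtain ⟨c, hc⟩ := hs (x - y) ⟨b, by rw [mul_sub]; exact hb.symm⟩
  rw [Submodule.Quotient.eq, Submodule.mem_smul_pointwise_iff_exists]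
  exact ⟨c, trivial, hc.symm⟩

theorem pow_dvd_of_not_dvd {P : Type*} [CommRing P] [IsDomain P] {x s : P} (hx : Prime x) (hs : ¬ x ∣ s) (k : ℕ) :
    ∀ a, x^k ∣ s * a → x^k ∣ a := by
  intro a h
  exact hx.pow_dvd_of_dvd_mul_left k hs h

theorem dvd_of_pow {P : Type*} [CommRing P] [IsDomain P] {x s : P} (hx : Prime x) (hs : ¬ x ∣ s) (hsp : Prime s) (k : ℕ)
    (hsx : ¬ s ∣ x) : ∀ a, s ∣ x^k * a → s ∣ a := by
  intro a h
  exact (hsp.dvd_or_dvd h).resolve_left (fun h => hsx (hsp.dvd_of_dvd_pow h))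

section
variable {σ K R : Type*} [Field K] [CommRing R] [Algebra K R]

theorem homog_line {c : MvPolynomial σ K} {D : ℕ} (hc : c.IsHomogeneous D) (a : σ → K) (y : R) :
    aeval (fun i => algebraMap K R (a i) * y) c = algebraMap K R (eval a c) * y ^ D := by
  rw [aeval_def, eval₂_eq, eval_eq, map_sum, Finset.sum_mul]
  refine Finset.sum_congr rfl fun m hm => ?_
  have hd : ∑ i ∈ m.support, m i = D := by
    by_contra h
    exact (mem_support_iff.1 hm) (hc.coeff_eq_zero h)
  simp only [mul_pow, Finset.prod_mul_distrib]
  rw [Finset.prod_pow_eq_pow_sum, hd, map_mul, map_prod]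
  simp only [map_pow]
  ring
end

theorem subst_zero_dvd {σ K : Type*} [Field K] [DecidableEq σ] (l : σ) (p : MvPolynomial σ K)
    (h : aeval (fun i => if i = l then 0 else (X i : MvPolynomial σ K)) p = 0) : X l ∣ p := by
  rw [← Ideal.mem_span_singleton, ← Ideal.Quotient.eq_zero_iff_mem]
  have : (Ideal.Quotient.mkₐ K (Ideal.span {(X l : MvPolynomial σ K)})).comp
      (aeval (fun i => if i = l then 0 else (X i : MvPolynomial σ K))) = Ideal.Quotient.mkₐ K (Ideal.span {(X l : MvPolynomial σ K)}) := by
    apply algHom_ext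
    intro i
    simp only [AlgHom.comp_apply, aeval_X]
    split_ifs with hi
    · rw [map_zero, hi]
      exact (Ideal.Quotient.eq_zero_iff_mem.2 (Ideal.mem_span_singleton_self _)).symm
    · rfl
  have h2 := DFunLike.congr_fun this p
  rw [AlgHom.comp_apply, h, map_zero] at h2
  exact h2.symm

theorem exists_point {k : ℕ} {K : Type*} [Field K] [Infinite K] {c : MvPolynomial (Fin (k+2)) K} {D : ℕ}
    (hc : c.IsHomogeneous D) (hx : ¬ X (Fin.last (k+1)) ∣ c) :
    ∃ a : Fin (k+2) → K, a 0 = 1 ∧ a (Fin.last (k+1)) = 0 ∧ eval a c ≠ 0 := by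
  have h1 : aeval (fun i => if i = Fin.last (k+1) then 0 else (X i : MvPolynomial (Fin (k+2)) K)) (c * X 0) ≠ 0 := by
    intro h
    have h2 := subst_zero_dvd _ _ h
    rcases (X_prime (R := K)).dvd_or_dvd h2 with h3 | h3
    · exact hx h3
    · rw [X_dvd_X] at h3
      have := congrArg Fin.val h3
      simp at this
  obtain ⟨b, hb⟩ := exists_eval_ne h1
  let b' : Fin (k+2) → K := fun i => if i = Fin.last (k+1) then 0 else b i
  have h2 : eval b (aeval (fun i => if i = Fin.last (k+1) then 0 else (X i : MvPolynomial (Fin (k+2)) K)) (c * X 0)) = eval b' (c * X 0) := by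
    rw [← aeval_eq_eval, ← aeval_eq_eval, ← AlgHom.comp_apply]
    congr 1
    apply algHom_ext
    intro i
    simp only [AlgHom.comp_apply, aeval_X, b']
    split_ifs <;> simp
  rw [h2, map_mul, eval_X] at hb
  have h0 : b' 0 ≠ 0 := right_ne_zero_of_mul hb
  refine ⟨fun i => (b' 0)⁻¹ * b' i, by simp [h0], by simp [b'], ?_⟩
  rw [homog_eval_smul hc]
  exact mul_ne_zero (pow_ne_zero _ (inv_ne_zero h0)) (left_ne_zero_of_mul hb)

/-- shear -/
noncomputable def shear {k : ℕ} {K : Type*} [Field K] (a : Fin (k+1) → K) :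
    MvPolynomial (Fin (k+2)) K →ₐ[K] MvPolynomial (Fin (k+2)) K :=
  aeval (Fin.cons (X 0) (fun i => X i.succ + C (a i) * X 0))

theorem shear_comp {k : ℕ} {K : Type*} [Field K] (a b : Fin (k+1) → K) (h : ∀ i, a i + b i = 0) :
    (shear a).comp (shear b) = AlgHom.id K _ := by
  apply algHom_ext
  intro i
  refine Fin.cases ?_ (fun i => ?_) i
  · simp [shear]
  · simp only [shear, AlgHom.comp_apply, aeval_X, Fin.cons_succ, map_add, map_mul, Fin.cons_zero, AlgHom.id_apply, algHom_C, algebraMap_eq]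
    rw [add_assoc, ← add_mul, ← C_add, h]; simp

noncomputable def shearE {k : ℕ} {K : Type*} [Field K] (a : Fin (k+1) → K) :
    MvPolynomial (Fin (k+2)) K ≃ₐ[K] MvPolynomial (Fin (k+2)) K :=
  AlgEquiv.ofAlgHom (shear a) (shear (-a)) (shear_comp _ _ (by simp)) (shear_comp _ _ (by simp))

theorem coord {k : ℕ} {K : Type*} [Field K] [Infinite K] {c : MvPolynomial (Fin (k+2)) K} {D : ℕ}
    (hc : c.IsHomogeneous D) (hx : ¬ X (Fin.last (k+1)) ∣ c) :
    ∃ ψ : MvPolynomial (Fin (k+2)) K ≃ₐ[K] Polynomial (MvPolynomial (Fin (k+1)) K),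
      ψ (X (Fin.last (k+1))) = Polynomial.C (X (Fin.last k)) ∧
      (∀ i, (ψ.symm (Polynomial.C (X i))).IsHomogeneous 1) ∧
      (∀ i, X i ∈ Ideal.span {X 0} ⊔ Ideal.span (Set.range fun i => ψ.symm (Polynomial.C (X i)))) ∧
      ∃ (a : K) (p : Polynomial (MvPolynomial (Fin (k+1)) K)), a ≠ 0 ∧ p.Monic ∧ p.natDegree = D ∧
        ψ c = Polynomial.C (C a) * p ∧
        c - C a * X 0 ^ D ∈ Ideal.span (Set.range fun i => ψ.symm (Polynomial.C (X i))) := by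
  obtain ⟨a, ha0, hal, hae⟩ := exists_point hc hx
  let ψ := (shearE (fun i => a i.succ)).trans (finSuccEquiv K (k+1))
  have hψd : ∀ p, ψ p = finSuccEquiv K (k+1) (shear (fun i => a i.succ) p) := fun p => rfl
  clear_value ψ
  have hψ : ∀ i : Fin (k+1), ψ (X i.succ) = Polynomial.C (X i) + Polynomial.C (C (a i.succ)) * Polynomial.X := by
    intro i
    have hC : finSuccEquiv K (k+1) (C (a i.succ)) = Polynomial.C (C (a i.succ)) :=
      (finSuccEquiv K (k+1)).commutes (a i.succ)
    rw [hψd, shear, aeval_X, Fin.cons_succ, map_add, map_mul, finSuccEquiv_X_succ, finSuccEquiv_X_zero, hC]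
  have hψ0 : ψ (X 0) = Polynomial.X := by
    rw [hψd, shear, aeval_X, Fin.cons_zero, finSuccEquiv_X_zero]
  have hs : ∀ i, ψ.symm (Polynomial.C (X i)) = X i.succ - C (a i.succ) * X 0 := by
    intro i
    rw [AlgEquiv.symm_apply_eq, map_sub, map_mul, hψ, hψ0]
    have : ψ (C (a i.succ)) = Polynomial.C (C (a i.succ)) := ψ.commutes _
    rw [this, add_sub_cancel_right]
  have hh : ∀ i, (ψ.symm (Polynomial.C (X i))).IsHomogeneous 1 := by
    intro i
    rw [hs]
    exact (isHomogeneous_X _ _).sub (isHomogeneous_C_mul_X _ _)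
  have hspan : ∀ i, X i - C (a i) * X 0 ∈ Ideal.span (Set.range fun i => ψ.symm (Polynomial.C (X i))) := by
    intro i
    refine Fin.cases ?_ (fun i => ?_) i
    · rw [ha0]; simp
    · rw [← hs]; exact Ideal.subset_span ⟨i, rfl⟩
  have hred : c - C (eval a c) * X 0 ^ D ∈ Ideal.span (Set.range fun i => ψ.symm (Polynomial.C (X i))) := by
    rw [← Ideal.Quotient.eq_zero_iff_mem, map_sub, sub_eq_zero]
    set J := Ideal.span (Set.range fun i => ψ.symm (Polynomial.C (X i)))
    have h1 := homog_line (R := MvPolynomial (Fin (k+2)) K) hc a (X 0)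
    rw [algebraMap_eq] at h1
    rw [← h1]
    have h2 : Ideal.Quotient.mkₐ K J = (Ideal.Quotient.mkₐ K J).comp (aeval fun i => C (a i) * X 0) := by
      apply algHom_ext
      intro i
      simp only [AlgHom.comp_apply, aeval_X]
      exact Ideal.Quotient.eq.2 (hspan i)
    exact DFunLike.congr_fun h2 c
  have hσ : ((shear (fun i => a i.succ)) c).IsHomogeneous D := by
    have := hc.aeval (Fin.cons (X 0) (fun i => X i.succ + C (a i.succ) * X 0) : Fin (k+2) → MvPolynomial (Fin (k+2)) K) (n := 1) (by
      intro i
      refine Fin.cases ?_ (fun i => ?_) i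
      · exact isHomogeneous_X _ _
      · exact (isHomogeneous_X _ _).add (isHomogeneous_C_mul_X _ _))
    rwa [one_mul] at this
  have hnd : (ψ c).natDegree ≤ D := by
    rw [hψd, natDegree_finSuccEquiv]
    exact (degreeOf_le_totalDegree _ _).trans hσ.totalDegree_le
  have hlc : (ψ c).coeff D = C (eval a c) := by
    have h1 : ((ψ c).coeff D).IsHomogeneous 0 := by
      rw [hψd]; exact hσ.finSuccEquiv_coeff_isHomogeneous D 0 (by simp)
    have h2 : (Polynomial.mapAlgHom (aeval (fun _ => (0:K)) : MvPolynomial (Fin (k+1)) K →ₐ[K] K)).comp ψ.toAlgHom =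
        aeval (fun i => algebraMap K _ (a i) * Polynomial.X) := by
      apply algHom_ext
      intro i
      simp only [AlgHom.comp_apply, aeval_X]
      refine Fin.cases ?_ (fun i => ?_) i
      · have : ψ.toAlgHom (X 0) = Polynomial.X := hψ0
        rw [this, ha0]; simp
      · have : ψ.toAlgHom (X i.succ) = _ := hψ i
        rw [this]; simp
    have h3 := DFunLike.congr_fun h2 c
    rw [homog_line hc] at h3
    have h4 := congrArg (fun p => Polynomial.coeff p D) h3
    simp only [AlgHom.comp_apply, Polynomial.coe_mapAlgHom, Polynomial.coeff_map] at h4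
    rw [← totalDegree_zero_iff_isHomogeneous, totalDegree_eq_zero_iff_eq_C] at h1
    have h5 : ψ.toAlgHom c = ψ c := rfl
    rw [h5, h1] at h4
    rw [h1]
    congr 1
    simpa [Polynomial.algebraMap_apply] using h4
  have hinv : (C (eval a c) : MvPolynomial (Fin (k+1)) K) * C (eval a c)⁻¹ = 1 := by
    rw [← C_mul, mul_inv_cancel₀ hae, C_1]
  have hmon : (Polynomial.C (C (eval a c)⁻¹) * ψ c).Monic := by
    apply Polynomial.monic_of_natDegree_le_of_coeff_eq_one D
    · exact (Polynomial.natDegree_C_mul_le _ _).trans hnd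
    · rw [Polynomial.coeff_C_mul, hlc, mul_comm, hinv]
  refine ⟨ψ, ?_, hh, ?_, eval a c, Polynomial.C (C (eval a c)⁻¹) * ψ c, hae, hmon, ?_, ?_, hred⟩
  · have := hψ (Fin.last k)
    rw [Fin.succ_last, hal] at this
    simpa using this
  · intro i
    have := Submodule.add_mem_sup (Ideal.mul_mem_left (Ideal.span {X 0}) (C (a i)) (Ideal.mem_span_singleton_self (X 0 : MvPolynomial (Fin (k+2)) K))) (hspan i)
    simpa using this
  · apply le_antisymm ((Polynomial.natDegree_C_mul_le _ _).trans hnd)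
    apply Polynomial.le_natDegree_of_ne_zero
    rw [Polynomial.coeff_C_mul, hlc, mul_comm, hinv]
    exact one_ne_zero
  · rw [← mul_assoc, ← Polynomial.C_mul, hinv, Polynomial.C_1, one_mul]
end EN

namespace EN
open MvPolynomial RingTheory.Sequence
universe u

structure Stage {K : Type u} [Field K] {n : ℕ} (k j : ℕ) (I : Ideal (MvPolynomial (Fin (n+1)) K))
    (θ : MvPolynomial (Fin (k+1)) K →ₐ[K] MvPolynomial (Fin (n+1)) K) (β D c : ℕ) : Prop where
  hom : HI I
  sat : ∀ g, X (Fin.last n) * g ∈ I → g ∈ I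
  th0 : θ (X (Fin.last k)) = X (Fin.last n)
  thh : ∀ i, (θ (X i)).IsHomogeneous 1
  fin : ∀ q, β < q → ∀ g : MvPolynomial (Fin (n+1)) K, g.IsHomogeneous q → g ∈ I ⊔ Ideal.span (Set.range fun i => θ (X i))
  rank : ∀ q (u : Fin q → MvPolynomial (Fin (n+1)) K), (∀ b : Fin q → MvPolynomial (Fin (k+1)) K,
    ∑ i, θ (b i) * u i ∈ I → ∀ i, b i = 0) → q ≤ D
  reg : ∀ z : List (MvPolynomial (Fin (k+1)) K), IsWeaklyRegular (MvPolynomial (Fin (k+1)) K) z →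
    ∃ L : List (MvPolynomial (Fin (n+1)) K), IsWeaklyRegular (MvPolynomial (Fin (n+1)) K) L ∧ 
      L.length = j + z.length ∧ ∀ l ∈ L, l ∈ I ⊔ Ideal.span (θ '' {p | p ∈ z})
  cp : CP (X (Fin.last n) : MvPolynomial (Fin (n+1)) K) (MvPolynomial (Fin (n+1)) K ⧸ I) j c

noncomputable abbrev algQ {K : Type u} [Field K] {n k : ℕ} (I : Ideal (MvPolynomial (Fin (n+1)) K))
    (θ : MvPolynomial (Fin (k+1)) K →ₐ[K] MvPolynomial (Fin (n+1)) K) :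
    Algebra (MvPolynomial (Fin (k+1)) K) (MvPolynomial (Fin (n+1)) K ⧸ I) :=
  ((Ideal.Quotient.mkₐ K I).comp θ).toRingHom.toAlgebra

section
variable {K : Type u} [Field K] {n k j : ℕ} {I : Ideal (MvPolynomial (Fin (n+1)) K)}
    {θ : MvPolynomial (Fin (k+1)) K →ₐ[K] MvPolynomial (Fin (n+1)) K} {β D c : ℕ}

theorem Stage.sat_pow (h : Stage k j I θ β D c) (a : ℕ) {g : MvPolynomial (Fin (n+1)) K}
    (hg : X (Fin.last n) ^ a * g ∈ I) : g ∈ I := by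
  induction a with
  | zero => simpa using hg
  | succ a ih => 
    apply ih
    apply h.sat
    rw [← mul_assoc, ← pow_succ']; exact hg

theorem Stage.tors (h : Stage k j I θ β D c) {p : MvPolynomial (Fin (k+1)) K} (hp : p ≠ 0)
    {u : MvPolynomial (Fin (n+1)) K} (hu : θ p * u ∈ I) : u ∈ I := by
  obtain ⟨L, hL, hlen, hmem⟩ := h.reg [p] (reg_one hp)
  have := CP.hom _ h.cp L hL (by simp [hlen]) _ hmem (Ideal.Quotient.mk I u) (by
    intro b hb
    obtain ⟨i, hi, v, hv, rfl⟩ := Submodule.mem_sup.1 hb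
    simp only [List.mem_singleton, Set.setOf_eq_eq_singleton, Set.image_singleton] at hv
    obtain ⟨w, rfl⟩ := Ideal.mem_span_singleton'.1 hv
    rw [← Ideal.Quotient.mk_eq_mk, ← Submodule.Quotient.mk_smul, Ideal.Quotient.mk_eq_mk, Ideal.Quotient.eq_zero_iff_mem, smul_eq_mul, add_mul,
      mul_assoc]
    exact I.add_mem (I.mul_mem_right _ hi) (I.mul_mem_left _ hu))
  rw [← Ideal.Quotient.mk_eq_mk, ← Submodule.Quotient.mk_smul, Ideal.Quotient.mk_eq_mk, Ideal.Quotient.eq_zero_iff_mem, smul_eq_mul] at this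
  exact h.sat_pow _ this

theorem Stage.kap (h : Stage k j I θ β D c) {t s : MvPolynomial (Fin (k+1)) K} (ht : t ≠ 0)
    (hs : ∀ a, t ∣ s * a → t ∣ a)
    {u v : MvPolynomial (Fin (n+1)) K} (hu : θ s * u - θ t * v ∈ I) : 
    ∃ v', X (Fin.last n) ^ c * u - θ t * v' ∈ I := by
  obtain ⟨L, hL, hlen, hmem⟩ := h.reg [t, s] (reg_two ht hs)
  have := CP.ext1 _ h.cp L hL (by simp [hlen]) _ hmem (θ t) (by
      rw [isSMulRegular_iff_right_eq_zero_of_smul]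
      intro x hx
      obtain ⟨x, rfl⟩ := Ideal.Quotient.mk_surjective x
      rw [← Ideal.Quotient.mk_eq_mk, ← Submodule.Quotient.mk_smul, Ideal.Quotient.mk_eq_mk, Ideal.Quotient.eq_zero_iff_mem, smul_eq_mul] at hx
      exact Ideal.Quotient.eq_zero_iff_mem.2 (h.tors ht hx))
    (Ideal.mem_sup_right (Ideal.subset_span ⟨t, by simp, rfl⟩)) (Ideal.Quotient.mk I u) (by
    intro b hb
    obtain ⟨i, hi, w, hw, rfl⟩ := Submodule.mem_sup.1 hb
    have e1 : θ '' {p | p ∈ [t, s]} = {θ t, θ s} := by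
      ext x; simp [eq_comm]
    rw [e1] at hw
    obtain ⟨w1, w2, rfl⟩ := Ideal.mem_span_pair.1 hw
    refine ⟨Ideal.Quotient.mk I (w1 * u + w2 * v), ?_⟩
    simp only [← Ideal.Quotient.mk_eq_mk, ← Submodule.Quotient.mk_smul, smul_eq_mul]
    rw [Ideal.Quotient.mk_eq_mk, Ideal.Quotient.mk_eq_mk, Ideal.Quotient.eq]
    have : (i + (w1 * θ t + w2 * θ s)) * u - θ t * (w1 * u + w2 * v) = i * u + w2 * (θ s * u - θ t * v) := by ring
    rw [this]
    exact I.add_mem (I.mul_mem_right _ hi) (I.mul_mem_left _ hu))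
  obtain ⟨v', hv'⟩ := this
  obtain ⟨v', rfl⟩ := Ideal.Quotient.mk_surjective v'
  refine ⟨v', ?_⟩
  simp only [← Ideal.Quotient.mk_eq_mk, ← Submodule.Quotient.mk_smul, smul_eq_mul] at hv'
  rwa [Ideal.Quotient.mk_eq_mk, Ideal.Quotient.mk_eq_mk, Ideal.Quotient.eq] at hv'

theorem Stage.finite (h : Stage k j I θ β D c) : 
    @Module.Finite (MvPolynomial (Fin (k+1)) K) (MvPolynomial (Fin (n+1)) K ⧸ I) _ _ (algQ I θ).toModule := by
  letI := algQ I θ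
  letI : Module (MvPolynomial (Fin (k+1)) K) (MvPolynomial (Fin (n+1)) K ⧸ I) := (algQ I θ).toModule
  have hsm : ∀ (p : MvPolynomial (Fin (k+1)) K) (g : MvPolynomial (Fin (n+1)) K),
    p • (Ideal.Quotient.mk I g) = Ideal.Quotient.mk I (θ p * g) := fun p g => by
      rw [Algebra.smul_def, map_mul]; rfl
  have hfin : {m : Fin (n+1) →₀ ℕ | m.degree ≤ β}.Finite := Finsupp.finite_of_degree_le β
  let T : Set (MvPolynomial (Fin (n+1)) K ⧸ I) := (fun m => Ideal.Quotient.mk I (monomial m 1)) '' {m : Fin (n+1) →₀ ℕ | m.degree ≤ β}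
  have key : ∀ q, ∀ g : MvPolynomial (Fin (n+1)) K, g.IsHomogeneous q → 
      Ideal.Quotient.mk I g ∈ Submodule.span (MvPolynomial (Fin (k+1)) K) T := by
    intro q
    induction q with
    | zero =>
      intro g hg
      rw [← totalDegree_zero_iff_isHomogeneous, totalDegree_eq_zero_iff_eq_C] at hg
      have : Ideal.Quotient.mk I g = (C (coeff 0 g) : MvPolynomial (Fin (k+1)) K) • Ideal.Quotient.mk I (monomial 0 1) := by
        rw [hsm, algHom_C, algebraMap_eq]
        nth_rewrite 1 [hg]
        simp
      rw [this]
      exact Submodule.smul_mem _ _ (Submodule.subset_span ⟨0, by simp, rfl⟩)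
    | succ q ih =>
      intro g hg
      by_cases hq : q + 1 ≤ β
      · rw [g.as_sum, map_sum]
        refine Submodule.sum_mem _ fun m hm => ?_
        have : Ideal.Quotient.mk I (monomial m (coeff m g)) = (C (coeff m g) : MvPolynomial (Fin (k+1)) K) • Ideal.Quotient.mk I (monomial m 1) := by
          rw [hsm, algHom_C, algebraMap_eq, C_mul_monomial, mul_one]
        rw [this]
        refine Submodule.smul_mem _ _ (Submodule.subset_span ⟨m, ?_, rfl⟩)
        have hd : m.degree = q + 1 := by
          by_contra h
          exact (mem_support_iff.1 hm) (hg.coeff_eq_zero h)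
        simp only [Set.mem_setOf_eq, hd, hq]
      · obtain ⟨v, hv, hvh⟩ := h.hom.sup_lin _ h.thh hg (h.fin _ (by omega) g hg)
        rw [Ideal.Quotient.eq.2 hv, map_sum]
        refine Submodule.sum_mem _ fun i _ => ?_
        rw [mul_comm, ← hsm]
        exact Submodule.smul_mem _ _ (ih _ (hvh i))
  have hT : T.Finite := hfin.image _
  refine ⟨⟨hT.toFinset, ?_⟩⟩
  rw [Set.Finite.coe_toFinset, eq_top_iff]
  rintro g -
  obtain ⟨g, rfl⟩ := Ideal.Quotient.mk_surjective g
  rw [← sum_homogeneousComponent g, map_sum]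
  exact Submodule.sum_mem _ fun q _ => key q _ (homogeneousComponent_isHomogeneous q g)

theorem Stage.tf (h : Stage k j I θ β D c) : 
    @Module.IsTorsionFree (MvPolynomial (Fin (k+1)) K) (MvPolynomial (Fin (n+1)) K ⧸ I) _ _ (algQ I θ).toModule := by
  letI := algQ I θ
  letI : Module (MvPolynomial (Fin (k+1)) K) (MvPolynomial (Fin (n+1)) K ⧸ I) := (algQ I θ).toModule
  refine .of_smul_eq_zero fun p g hpg => ?_
  obtain ⟨g, rfl⟩ := Ideal.Quotient.mk_surjective g
  rw [Algebra.smul_def] at hpg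
  have : Ideal.Quotient.mk I (θ p * g) = 0 := by rw [map_mul]; exact hpg
  rw [Ideal.Quotient.eq_zero_iff_mem] at this
  by_cases hp : p = 0
  · exact Or.inl hp
  · exact Or.inr (Ideal.Quotient.eq_zero_iff_mem.2 (h.tors hp this))

def Hub {P A : Type*} [CommRing P] [CommRing A] [Algebra P A] (F : A) (c : P) : Prop :=
  ∀ (m : ℕ) (b : Fin m → A), GB P b →
      ∀ (t : P) (M : Matrix (Fin m) (Fin m) P), t ≠ 0 → 
      (∀ j, t • (F * b j) = ∑ i, M i j • b i) → t ^ m * c = M.det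

theorem Stage.norm [Infinite K] (h : Stage k j I θ β D c) {F : MvPolynomial (Fin (n+1)) K} {δ : ℕ}
    (hFh : F.IsHomogeneous δ) (hF : ∀ g, F * g ∈ I → g ∈ I) :
    ∃ (e D' : ℕ) (c' : MvPolynomial (Fin (k+1)) K) (g : MvPolynomial (Fin (n+1)) K),
      c'.IsHomogeneous D' ∧ ¬ X (Fin.last k) ∣ c' ∧ e + D' ≤ δ * D ∧ 
      X (Fin.last n) ^ e * θ c' - F * g ∈ I ∧ 
      (letI := algQ I θ; Hub (Ideal.Quotient.mk I F) (X (Fin.last k) ^ e * c')) := by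
  letI := algQ I θ
  letI : Module (MvPolynomial (Fin (k+1)) K) (MvPolynomial (Fin (n+1)) K ⧸ I) := (algQ I θ).toModule
  have hsm : ∀ (p : MvPolynomial (Fin (k+1)) K) (g : MvPolynomial (Fin (n+1)) K),
    p • (Ideal.Quotient.mk I g) = Ideal.Quotient.mk I (θ p * g) := fun p g => by
      rw [Algebra.smul_def, map_mul]; rfl
  haveI := h.finite
  haveI := h.tf
  obtain ⟨c0, hc0, ⟨g, hg⟩, hub⟩ := norm_pkg (P := MvPolynomial (Fin (k+1)) K) (Ideal.Quotient.mk I F) (by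
    intro a ha
    obtain ⟨a, rfl⟩ := Ideal.Quotient.mk_surjective a
    rw [← map_mul, Ideal.Quotient.eq_zero_iff_mem] at ha
    exact Ideal.Quotient.eq_zero_iff_mem.2 (hF a ha))
  obtain ⟨m, b, hb⟩ := GB.exists_gb (MvPolynomial (Fin (k+1)) K) (MvPolynomial (Fin (n+1)) K ⧸ I)
  have hm : m ≤ D := by
    choose u hu using fun i => Ideal.Quotient.mk_surjective (b i)
    refine h.rank m u fun β hβ => ?_
    apply Fintype.linearIndependent_iff.1 hb.1
    rw [← Ideal.Quotient.eq_zero_iff_mem, map_sum] at hβ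
    rw [← hβ]
    refine Finset.sum_congr rfl fun i _ => ?_
    rw [← hsm, hu]
  have hhom : c0.IsHomogeneous (δ * m) := by
    apply homog_of_scal
    intro t ht
    have hmap : I = I.map (scalE t ht).toRingEquiv := by
      apply le_antisymm
      · intro g hg
        have h1 : EN.scal t⁻¹ g ∈ I := h.hom.scal _ hg
        have h2 := Ideal.mem_map_of_mem (scalE t ht).toRingEquiv h1
        have h3 : (scalE t ht).toRingEquiv (EN.scal t⁻¹ g) = g := by
          change EN.scal t (EN.scal t⁻¹ g) = g
          rw [scal_comp, mul_inv_cancel₀ ht, scal_one]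
        rwa [h3] at h2
      · rw [Ideal.map_le_iff_le_comap]
        intro g hg
        exact h.hom.scal t hg
    let e : (MvPolynomial (Fin (n+1)) K ⧸ I) ≃+* (MvPolynomial (Fin (n+1)) K ⧸ I) := Ideal.quotientEquiv I I _ hmap
    have he : ∀ g, e (Ideal.Quotient.mk I g) = Ideal.Quotient.mk I (EN.scal t g) := fun g => rfl
    have hθ : ∀ p, EN.scal t (θ p) = θ (EN.scal t p) := by
      have : (EN.scal t).comp θ = θ.comp (EN.scal t) := by
        apply algHom_ext
        intro i
        simp only [AlgHom.comp_apply]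
        rw [scal_homog t (h.thh i), scal_homog t (isHomogeneous_X _ i), map_mul, algHom_C, algebraMap_eq]
      intro p; exact DFunLike.congr_fun this p
    have := hub_scale (K := K) (Ideal.Quotient.mk I F) c0 hub hb (scalE t ht).toRingEquiv e (by
      intro p a
      obtain ⟨a, rfl⟩ := Ideal.Quotient.mk_surjective a
      rw [hsm, he, he, map_mul, hθ, hsm]; rfl) (C (t^δ)) (by
      rw [he, scal_homog t hFh, hsm, algHom_C, algebraMap_eq])
    rw [← map_pow, ← pow_mul] at this
    exact this
  obtain ⟨e, c', rfl, hc'⟩ := X_factor (Fin.last k) hc0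
  obtain ⟨D', hD', hh'⟩ := homog_factor hhom (by rintro rfl; simp at hc')
  obtain ⟨g, rfl⟩ := Ideal.Quotient.mk_surjective g
  refine ⟨e, D', c', g, hh', hc', ?_, ?_, hub⟩
  · rw [hD']; exact Nat.mul_le_mul_left _ hm
  · rw [← map_mul] at hg
    have : Ideal.Quotient.mk I (θ (X (Fin.last k) ^ e * c')) = Ideal.Quotient.mk I (F * g) := hg
    rw [map_mul, map_pow, h.th0] at this
    exact Ideal.Quotient.eq.1 this
end
end EN

namespace EN
open MvPolynomial RingTheory.Sequence
universe u

/-- saturation of an ideal by the powers of an element -/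
def satI {R : Type*} [CommRing R] (x : R) (J : Ideal R) : Ideal R where
  carrier := {g | ∃ a : ℕ, x ^ a * g ∈ J}
  zero_mem' := ⟨0, by simp⟩
  add_mem' := by
    rintro g h ⟨a, ha⟩ ⟨b, hb⟩
    refine ⟨a + b, ?_⟩
    have : x ^ (a+b) * (g + h) = x^b * (x^a * g) + x^a * (x^b * h) := by ring
    rw [this]
    exact J.add_mem (J.mul_mem_left _ ha) (J.mul_mem_left _ hb)
  smul_mem' := by
    rintro r g ⟨a, ha⟩
    refine ⟨a, ?_⟩
    have : x ^ a * (r • g) = r * (x^a * g) := by rw [smul_eq_mul]; ring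
    rw [this]
    exact J.mul_mem_left _ ha

theorem mem_satI {R : Type*} [CommRing R] {x : R} {J : Ideal R} {g : R} : g ∈ satI x J ↔ ∃ a : ℕ, x ^ a * g ∈ J := Iff.rfl

theorem le_satI {R : Type*} [CommRing R] {x : R} {J : Ideal R} : J ≤ satI x J := fun g hg => ⟨0, by simpa using hg⟩

theorem HI.satI {σ K : Type*} [Field K] {J : Ideal (MvPolynomial σ K)} (hJ : HI J) (i : σ) : HI (satI (X i) J) := by
  rintro g ⟨a, ha⟩ q
  refine ⟨a, ?_⟩
  have hX : (X i ^ a : MvPolynomial σ K).IsHomogeneous a := by simpa using isHomogeneous_X_pow i a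
  have := hJ _ ha (q + a)
  rw [hc_mul hX, if_pos (by omega), Nat.add_sub_cancel] at this
  exact this

section
variable {K : Type u} [Field K] {n k j : ℕ} {I : Ideal (MvPolynomial (Fin (n+1)) K)}
    {β D c : ℕ}

theorem hom_homog {σ τ : Type*} (θ : MvPolynomial σ K →ₐ[K] MvPolynomial τ K) (hθ : ∀ i, (θ (X i)).IsHomogeneous 1)
    {p : MvPolynomial σ K} {q : ℕ} (hp : p.IsHomogeneous q) : (θ p).IsHomogeneous q := by
  have := hp.aeval (fun i => θ (X i)) hθ
  rw [one_mul] at this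
  rw [aeval_unique θ]
  exact this

theorem P4 {I J : Ideal (MvPolynomial (Fin (n+1)) K)} (hJ : HI J) {y : MvPolynomial (Fin (n+1)) K} (hy : y.IsHomogeneous 1)
    (h : ∀ q, β < q → ∀ g : MvPolynomial (Fin (n+1)) K, g.IsHomogeneous q → g ∈ J ⊔ Ideal.span {y}) (s : ℕ) :
    ∀ q, β + s ≤ q → ∀ g : MvPolynomial (Fin (n+1)) K, g.IsHomogeneous q → g ∈ J ⊔ Ideal.span {y ^ s} := by
  induction s with
  | zero => intro q _ g _; simp [Ideal.span_singleton_one]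
  | succ s ih =>
    intro q hq g hg
    obtain ⟨v, hv, hvh, -⟩ := hJ.sup1 hy hg (h q (by omega) g hg)
    have h1 := ih (q-1) (by omega) v hvh
    obtain ⟨a, ha, b, hb, hab⟩ := Submodule.mem_sup.1 h1
    obtain ⟨w, rfl⟩ := Ideal.mem_span_singleton'.1 hb
    have : g = (g - y * v) + y * a + w * y^(s+1) := by rw [← hab]; ring
    rw [this]
    exact Ideal.add_mem _ (Ideal.mem_sup_left (J.add_mem hv (J.mul_mem_left _ ha)))
      (Ideal.mem_sup_right (Ideal.mul_mem_left _ _ (Ideal.mem_span_singleton_self _)))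

theorem Stage.kill {θ : MvPolynomial (Fin (k+1)) K →ₐ[K] MvPolynomial (Fin (n+1)) K} 
    (h : Stage k j I θ β D c) {F : MvPolynomial (Fin (n+1)) K} 
    (hF : ∀ g, F * g ∈ I → g ∈ I) {e : ℕ} {c' : MvPolynomial (Fin (k+1)) K} {g : MvPolynomial (Fin (n+1)) K}
    (hc' : ¬ X (Fin.last k) ∣ c') (hg : X (Fin.last n) ^ e * θ c' - F * g ∈ I)
    {u : MvPolynomial (Fin (n+1)) K} (hu : u ∈ satI (X (Fin.last n)) (I ⊔ Ideal.span {F})) : 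
    X (Fin.last n) ^ (e + c) * u ∈ I ⊔ Ideal.span {F} := by
  obtain ⟨s, hs⟩ := hu
  have hs' : X (Fin.last n) ^ (s + e) * u ∈ I ⊔ Ideal.span {F} := by
    rw [pow_add, mul_comm (_ ^ s), mul_assoc]; exact Ideal.mul_mem_left _ _ hs
  obtain ⟨a, ha, b, hb, hab⟩ := Submodule.mem_sup.1 hs'
  obtain ⟨v, rfl⟩ := Ideal.mem_span_singleton'.1 hb
  -- x^(s+e) u = a + v F
  have h1 : θ c' * v - θ (X (Fin.last k) ^ s) * (g * u) ∈ I := by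
    apply hF
    apply h.sat_pow e
    rw [map_pow, h.th0]
    have : X (Fin.last n) ^ e * (F * (θ c' * v - X (Fin.last n) ^ s * (g * u)))
      = - (X (Fin.last n) ^ e * θ c') * a + (X (Fin.last n) ^ e * θ c' - F * g) * (a + v * F) := by
      have : X (Fin.last n) ^ e * (F * (θ c' * v - X (Fin.last n) ^ s * (g * u)))
        = X (Fin.last n) ^ e * θ c' * (v * F) - F * g * (X (Fin.last n) ^ (s + e) * u) := by ring
      rw [this, ← hab]; ring
    rw [this]
    exact I.add_mem (I.mul_mem_left _ ha) (I.mul_mem_right _ hg)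
  obtain ⟨v', hv'⟩ := h.kap (pow_ne_zero _ (X_ne_zero _)) (pow_dvd_of_not_dvd (X_prime) hc' s) h1
  rw [map_pow, h.th0] at hv'
  have h3 : X (Fin.last n) ^ (e + c) * u - F * v' ∈ I := by
    apply h.sat_pow s
    have : X (Fin.last n) ^ s * (X (Fin.last n) ^ (e + c) * u - F * v') 
      = X (Fin.last n) ^ c * a + F * (X (Fin.last n) ^ c * v - X (Fin.last n) ^ s * v') := by
      have : X (Fin.last n) ^ s * (X (Fin.last n) ^ (e + c) * u - F * v') 
        = X (Fin.last n) ^ c * (X (Fin.last n) ^ (s + e) * u) - F * (X (Fin.last n) ^ s * v') := by ring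
      rw [this, ← hab]; ring
    rw [this]
    exact I.add_mem (I.mul_mem_left _ ha) (I.mul_mem_left _ hv')
  have : X (Fin.last n) ^ (e + c) * u = (X (Fin.last n) ^ (e + c) * u - F * v') + v' * F := by ring
  rw [this]
  exact Ideal.add_mem _ (Ideal.mem_sup_left h3) (Ideal.mem_sup_right (Ideal.mul_mem_left _ _ (Ideal.mem_span_singleton_self _)))

theorem Stage.cp' {θ : MvPolynomial (Fin (k+1)) K →ₐ[K] MvPolynomial (Fin (n+1)) K} 
    (h : Stage k j I θ β D c) {F : MvPolynomial (Fin (n+1)) K} 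
    (hF : ∀ g, F * g ∈ I → g ∈ I) {a : ℕ} {I' : Ideal (MvPolynomial (Fin (n+1)) K)} 
    (hle : I ⊔ Ideal.span {F} ≤ I') (hk : ∀ u ∈ I', X (Fin.last n) ^ a * u ∈ I ⊔ Ideal.span {F}) : 
    CP (X (Fin.last n) : MvPolynomial (Fin (n+1)) K) (MvPolynomial (Fin (n+1)) K ⧸ I') (j+1) (2*c+a) := by
  refine CP.step _ F ?_ h.cp (Submodule.factor (le_sup_left.trans hle)) (Submodule.factor_surjective _) ?_ ?_
  · rw [isSMulRegular_iff_right_eq_zero_of_smul]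
    intro x hx
    obtain ⟨x, rfl⟩ := Ideal.Quotient.mk_surjective x
    rw [← Ideal.Quotient.mk_eq_mk, ← Submodule.Quotient.mk_smul, Ideal.Quotient.mk_eq_mk, Ideal.Quotient.eq_zero_iff_mem, smul_eq_mul] at hx
    exact Ideal.Quotient.eq_zero_iff_mem.2 (hF x hx)
  · intro t
    obtain ⟨t, rfl⟩ := Submodule.Quotient.mk_surjective _ t
    rw [← Submodule.Quotient.mk_smul]
    change Submodule.Quotient.mk (F • t) = _
    rw [Submodule.Quotient.mk_eq_zero, smul_eq_mul]
    exact I'.mul_mem_right _ (hle (Ideal.mem_sup_right (Ideal.mem_span_singleton_self _)))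
  · intro t ht
    obtain ⟨t, rfl⟩ := Submodule.Quotient.mk_surjective _ t
    change Submodule.Quotient.mk t = _ at ht
    rw [Submodule.Quotient.mk_eq_zero] at ht
    obtain ⟨i, hi, b, hb, hib⟩ := Submodule.mem_sup.1 (hk t ht)
    obtain ⟨v, rfl⟩ := Ideal.mem_span_singleton'.1 hb
    refine ⟨Submodule.Quotient.mk v, ?_⟩
    rw [← Submodule.Quotient.mk_smul, ← Submodule.Quotient.mk_smul, Submodule.Quotient.eq, smul_eq_mul, smul_eq_mul, ← hib]
    have : i + v * F - F * v = i := by ring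
    rwa [this]
end
end EN

namespace EN
open MvPolynomial RingTheory.Sequence
universe u
section
variable {K : Type u} [Field K] {n k j : ℕ} {I : Ideal (MvPolynomial (Fin (n+1)) K)}
    {β D c : ℕ}

theorem Stage.rank' {θ : MvPolynomial (Fin (k+2)) K →ₐ[K] MvPolynomial (Fin (n+1)) K} 
    (h : Stage (k+1) j I θ β D c) {F : MvPolynomial (Fin (n+1)) K} 
    (ψ : MvPolynomial (Fin (k+2)) K ≃ₐ[K] Polynomial (MvPolynomial (Fin (k+1)) K)) 
    (c0 : MvPolynomial (Fin (k+2)) K) (hc0 : c0 ≠ 0)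
    (hub : letI := algQ I θ; Hub (Ideal.Quotient.mk I F) c0)
    (q : ℕ) (u : Fin q → MvPolynomial (Fin (n+1)) K) 
    (hu : ∀ b : Fin q → MvPolynomial (Fin (k+1)) K,
      ∑ i, θ (ψ.symm (Polynomial.C (b i))) * u i ∈ I ⊔ Ideal.span {F} → ∀ i, b i = 0) : q ≤ (ψ c0).natDegree := by
  let φ : Polynomial (MvPolynomial (Fin (k+1)) K) →+* (MvPolynomial (Fin (n+1)) K ⧸ I) :=
    (((Ideal.Quotient.mkₐ K I).comp θ).toRingHom).comp ψ.symm.toAlgHom.toRingHom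
  letI alg : Algebra (Polynomial (MvPolynomial (Fin (k+1)) K)) (MvPolynomial (Fin (n+1)) K ⧸ I) := φ.toAlgebra
  letI : Module (Polynomial (MvPolynomial (Fin (k+1)) K)) (MvPolynomial (Fin (n+1)) K ⧸ I) := alg.toModule
  have hsm : ∀ (p : Polynomial (MvPolynomial (Fin (k+1)) K)) (g : MvPolynomial (Fin (n+1)) K),
    p • (Ideal.Quotient.mk I g) = Ideal.Quotient.mk I (θ (ψ.symm p) * g) := fun p g => by
      rw [Algebra.smul_def, map_mul]; rfl
  haveI : Module.Finite (Polynomial (MvPolynomial (Fin (k+1)) K)) (MvPolynomial (Fin (n+1)) K ⧸ I) := by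
    have h1 : (((Ideal.Quotient.mkₐ K I).comp θ).toRingHom).Finite := h.finite
    have h2 : φ.Finite := RingHom.Finite.comp h1 (RingHom.Finite.of_surjective _ ψ.symm.surjective)
    exact h2
  haveI : Module.IsTorsionFree (Polynomial (MvPolynomial (Fin (k+1)) K)) (MvPolynomial (Fin (n+1)) K ⧸ I) := by
    refine .of_smul_eq_zero fun p g hpg => ?_
    obtain ⟨g, rfl⟩ := Ideal.Quotient.mk_surjective g
    rw [hsm, Ideal.Quotient.eq_zero_iff_mem] at hpg
    by_cases hp : p = 0
    · exact Or.inl hp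
    · exact Or.inr (Ideal.Quotient.eq_zero_iff_mem.2 (h.tors (by simpa using hp) hpg))
  refine rank_le (Ideal.Quotient.mk I F) (ψ c0) (by simpa using hc0) ?_ (fun i => Ideal.Quotient.mk I (u i)) ?_
  · intro m b hb t M ht hM
    letI algP := algQ I θ
    letI : Module (MvPolynomial (Fin (k+2)) K) (MvPolynomial (Fin (n+1)) K ⧸ I) := algP.toModule
    have hsmP : ∀ (p : MvPolynomial (Fin (k+2)) K) (g : MvPolynomial (Fin (n+1)) K),
      p • (Ideal.Quotient.mk I g) = Ideal.Quotient.mk I (θ p * g) := fun p g => by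
        rw [Algebra.smul_def, map_mul]; rfl
    have hs2 : ∀ (p : Polynomial (MvPolynomial (Fin (k+1)) K)) (a : MvPolynomial (Fin (n+1)) K ⧸ I),
        p • a = ψ.symm p • a := by
      intro p a
      obtain ⟨a, rfl⟩ := Ideal.Quotient.mk_surjective a
      rw [hsm, hsmP]
    have hb' : GB (MvPolynomial (Fin (k+2)) K) b := 
      GB.map ψ.symm.toRingEquiv (AddEquiv.refl (MvPolynomial (Fin (n+1)) K ⧸ I)) (fun p a => hs2 p a) hb
    have := hub m b hb' (ψ.symm t) (M.map ψ.symm) (by simpa using ht) (by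
      intro j
      rw [← hs2, hM]
      exact Finset.sum_congr rfl fun i _ => hs2 _ _)
    have h3 := congrArg ψ this
    rw [map_mul, map_pow, AlgEquiv.apply_symm_apply] at h3
    rw [h3, show (M.map ψ.symm).det = ψ.symm M.det from (AlgEquiv.map_det ψ.symm M).symm, AlgEquiv.apply_symm_apply]
  · rintro b ⟨s, hs, v, hv⟩
    obtain ⟨v, rfl⟩ := Ideal.Quotient.mk_surjective v
    have h1 : ∑ i, θ (ψ.symm (Polynomial.C (s * b i))) * u i ∈ I ⊔ Ideal.span {F} := by
      have h2 : Ideal.Quotient.mk I (∑ i, θ (ψ.symm (Polynomial.C (s * b i))) * u i) = Ideal.Quotient.mk I (F * v) := by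
        rw [map_mul, ← hv, map_sum, Finset.smul_sum]
        refine Finset.sum_congr rfl fun i _ => ?_
        rw [hsm, hsm, Polynomial.C_mul, map_mul ψ.symm, map_mul θ, mul_assoc]
      have h3 := Ideal.Quotient.eq.1 h2
      rw [← sub_add_cancel (∑ i, θ (ψ.symm (Polynomial.C (s * b i))) * u i) (F * v)]
      exact Ideal.add_mem _ (Ideal.mem_sup_left h3) (Ideal.mem_sup_right (Ideal.mul_mem_right _ _ (Ideal.mem_span_singleton_self _)))
    intro i
    exact (mul_eq_zero.1 (hu _ h1 i)).resolve_left hs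

theorem Stage.step [Infinite K] {θ : MvPolynomial (Fin (k+2)) K →ₐ[K] MvPolynomial (Fin (n+1)) K} 
    (h : Stage (k+1) j I θ β D c) {F : MvPolynomial (Fin (n+1)) K} {δ : ℕ}
    (hFh : F.IsHomogeneous δ) (hF : ∀ g, F * g ∈ I → g ∈ I) :
    ∃ (e D' : ℕ) (c' : MvPolynomial (Fin (k+2)) K) (g : MvPolynomial (Fin (n+1)) K)
      (I' : Ideal (MvPolynomial (Fin (n+1)) K)) (θ' : MvPolynomial (Fin (k+1)) K →ₐ[K] MvPolynomial (Fin (n+1)) K),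
      c'.IsHomogeneous D' ∧ ¬ X (Fin.last (k+1)) ∣ c' ∧ e + D' ≤ δ * D ∧ 
      X (Fin.last n) ^ e * θ c' - F * g ∈ I ∧ I ⊔ Ideal.span {F} ≤ I' ∧ θ c' ∈ I' ∧
      (∀ u ∈ I', X (Fin.last n) ^ (e + c) * u ∈ I ⊔ Ideal.span {F}) ∧
      Stage k (j+1) I' θ' (β + D' - 1) D' (2 * c + (e + c)) := by
  obtain ⟨e, D', c', g, hc'h, hc', hle, hg, hub⟩ := h.norm hFh hF
  obtain ⟨ψ, hψ0, hψh, hψs, a, p, ha, hpm, hpd, hψc, hψm⟩ := coord hc'h hc'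
  have hIF : HI (I ⊔ Ideal.span {F}) := h.hom.sup (HI.span (by rintro x rfl; exact ⟨δ, hFh⟩))
  let I' := satI (X (Fin.last n)) (I ⊔ Ideal.span {F})
  have hleI : I ⊔ Ideal.span {F} ≤ I' := le_satI
  let θ' : MvPolynomial (Fin (k+1)) K →ₐ[K] MvPolynomial (Fin (n+1)) K := 
    θ.comp (ψ.symm.toAlgHom.comp (Polynomial.CAlgHom (R := K) (A := MvPolynomial (Fin (k+1)) K)))
  have hθ' : ∀ b, θ' b = θ (ψ.symm (Polynomial.C b)) := fun b => rfl
  have hcI : θ c' ∈ I' := by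
    refine ⟨e, ?_⟩
    rw [← sub_add_cancel (X (Fin.last n) ^ e * θ c') (F * g)]
    exact Ideal.add_mem _ (Ideal.mem_sup_left hg) (Ideal.mem_sup_right (Ideal.mul_mem_right _ _ (Ideal.mem_span_singleton_self _)))
  have hkill : ∀ u ∈ I', X (Fin.last n) ^ (e + c) * u ∈ I ⊔ Ideal.span {F} := fun u hu => h.kill hF hc' hg hu
  have hc'0 : c' ≠ 0 := by rintro rfl; simp at hc'
  have hth : ∀ i, (θ' (X i)).IsHomogeneous 1 := fun i => hom_homog θ h.thh (hψh i)
  have hp' : θ (ψ.symm p) ∈ I' := by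
    have h1 : c' = C a * ψ.symm p := by
      apply ψ.injective
      rw [hψc, map_mul, AlgEquiv.apply_symm_apply]
      congr 1
      exact (ψ.commutes a).symm
    have h2 : ψ.symm p = C a⁻¹ * c' := by
      rw [h1, ← mul_assoc, ← C_mul, inv_mul_cancel₀ ha, C_1, one_mul]
    rw [h2, map_mul]
    exact Ideal.mul_mem_left _ _ hcI
  have hmapspan : ∀ z, z ∈ Ideal.span (Set.range fun i => ψ.symm (Polynomial.C (X i))) → θ z ∈ Ideal.span (Set.range fun i => θ' (X i)) := by
    intro z hz
    have := Ideal.mem_map_of_mem θ hz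
    rw [Ideal.map_span, ← Set.range_comp] at this
    exact this
  refine ⟨e, D', c', g, I', θ', hc'h, hc', hle, hg, hleI, hcI, hkill, ?_⟩
  refine ⟨hIF.satI _, ?_, ?_, hth, ?_, ?_, ?_, h.cp' hF hleI hkill⟩
  · rintro u ⟨s, hs⟩
    refine ⟨s+1, ?_⟩
    rw [pow_succ, mul_assoc]; exact hs
  · rw [hθ', ← hψ0, AlgEquiv.symm_apply_apply, h.th0]
  · let J := I' ⊔ Ideal.span (Set.range fun i => θ' (X i))
    have hJ : HI J := (hIF.satI _).sup (HI.span (by rintro x ⟨i, rfl⟩; exact ⟨1, hth i⟩))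
    have hyD : θ (X 0) ^ D' ∈ J := by
      have h1 := hmapspan _ hψm
      rw [map_sub, map_mul, map_pow, algHom_C, algebraMap_eq] at h1
      have h2 : C a * θ (X 0) ^ D' ∈ J := by
        have : C a * θ (X 0) ^ D' = θ c' - (θ c' - C a * θ (X 0) ^ D') := by ring
        rw [this]
        exact J.sub_mem (Ideal.mem_sup_left hcI) (Ideal.mem_sup_right h1)
      have h3 := J.mul_mem_left (C a⁻¹) h2
      rwa [← mul_assoc, ← C_mul, inv_mul_cancel₀ ha, C_1, one_mul] at h3
    intro q hq g hg
    by_cases hD : D' = 0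
    · rw [hD, pow_zero] at hyD
      have : J = ⊤ := (Ideal.eq_top_iff_one _).2 hyD
      change g ∈ J
      rw [this]; trivial
    have := P4 (I := I) hJ (h.thh 0) (by
      intro q hq g hg
      have h1 := h.fin q hq g hg
      refine (?_ : I ⊔ Ideal.span (Set.range fun i => θ (X i)) ≤ J ⊔ Ideal.span {θ (X 0)}) h1
      refine sup_le (fun x hx => Ideal.mem_sup_left (Ideal.mem_sup_left (hleI (Ideal.mem_sup_left hx)))) ?_
      rw [Ideal.span_le]
      rintro _ ⟨i, rfl⟩
      obtain ⟨a1, ha1, a2, ha2, h3⟩ := Submodule.mem_sup.1 (hψs i)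
      obtain ⟨w, rfl⟩ := Ideal.mem_span_singleton'.1 ha1
      change θ (X i) ∈ J ⊔ Ideal.span {θ (X 0)}
      rw [← h3, map_add, map_mul]
      exact Ideal.add_mem _ (Ideal.mem_sup_right (Ideal.mul_mem_left _ _ (Ideal.mem_span_singleton_self _)))
        (Ideal.mem_sup_left (Ideal.mem_sup_right (hmapspan _ ha2)))) D' q (by omega) g hg
    refine (?_ : J ⊔ Ideal.span {θ (X 0) ^ D'} ≤ J) this
    exact sup_le le_rfl (by rw [Ideal.span_singleton_le_iff_mem]; exact hyD)
  · intro q u hu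
    have hcc : (X (Fin.last (k+1)) ^ e * c') ≠ 0 := mul_ne_zero (pow_ne_zero _ (X_ne_zero _)) hc'0
    have := h.rank' ψ _ hcc hub q u (fun b hb => hu b (hleI hb))
    rw [map_mul, map_pow, hψ0, hψc, ← Polynomial.C_pow] at this
    rw [Polynomial.natDegree_C_mul (pow_ne_zero _ (X_ne_zero _)), Polynomial.natDegree_C_mul (by simpa using ha), hpd] at this
    exact this
  · intro z hz
    obtain ⟨L, hL, hlen, hmem⟩ := h.reg _ (reg_equiv ψ.symm.toRingEquiv (reg_monic p hpm hz))
    refine ⟨L, hL, ?_, ?_⟩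
    · rw [hlen]; simp; ring
    · intro l hl
      have hl1 := hmem l hl
      revert l
      suffices hS : I ⊔ Ideal.span (θ '' {x | x ∈ (p :: z.map Polynomial.C).map ψ.symm.toRingEquiv}) ≤ I' ⊔ Ideal.span (θ' '' {x | x ∈ z}) from
        fun l _ hl1 => hS hl1
      refine sup_le (fun x hx => Ideal.mem_sup_left (hleI (Ideal.mem_sup_left hx))) ?_
      rw [Ideal.span_le]
      rintro _ ⟨x, hx, rfl⟩
      simp only [List.map_cons, List.mem_cons, List.map_map, List.mem_map, Set.mem_setOf_eq, Function.comp_apply] at hx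
      rcases hx with rfl | ⟨b, hb, rfl⟩
      · exact Ideal.mem_sup_left hp'
      · exact Ideal.mem_sup_right (Ideal.subset_span ⟨b, hb, rfl⟩)
end
end EN

namespace EN
open MvPolynomial RingTheory.Sequence
universe u

theorem mem1 {R : Type*} [CommRing R] {J : Ideal R} {a x : R} (r : R) (ha : a ∈ J) (h : x = r * a) : x ∈ J := by
  rw [h]; exact J.mul_mem_left _ ha

theorem mem2 {R : Type*} [CommRing R] {J : Ideal R} {a b x : R} (r s : R) (ha : a ∈ J) (hb : b ∈ J)
    (h : x = r * a + s * b) : x ∈ J := by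
  rw [h]; exact J.add_mem (J.mul_mem_left _ ha) (J.mul_mem_left _ hb)

theorem mem_sup1 {R : Type*} [CommRing R] {J : Ideal R} {F x : R} : x ∈ J ⊔ Ideal.span {F} ↔ ∃ v, x - F * v ∈ J := by
  constructor
  · intro h
    obtain ⟨a, ha, b, hb, rfl⟩ := Submodule.mem_sup.1 h
    obtain ⟨v, rfl⟩ := Ideal.mem_span_singleton'.1 hb
    exact ⟨v, by rwa [mul_comm F, add_sub_cancel_right]⟩
  · rintro ⟨v, hv⟩
    rw [← sub_add_cancel x (F * v)]
    exact Ideal.add_mem _ (Ideal.mem_sup_left hv) (Ideal.mem_sup_right (Ideal.mul_mem_right _ _ (Ideal.mem_span_singleton_self _)))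

theorem aeval_congr_mod {σ K : Type*} [Field K] {J : Ideal (MvPolynomial σ K)} (f : σ → MvPolynomial σ K)
    (hf : ∀ i, X i - f i ∈ J) (p : MvPolynomial σ K) : p - aeval f p ∈ J := by
  have : (Ideal.Quotient.mkₐ K J).comp (aeval f) = Ideal.Quotient.mkₐ K J := by
    apply algHom_ext
    intro i
    simp only [AlgHom.comp_apply, aeval_X]
    exact (Ideal.Quotient.eq.2 (hf i)).symm
  have h2 := DFunLike.congr_fun this p
  exact Ideal.Quotient.eq.1 h2.symm

section
variable {K : Type u} [Field K] {n j : ℕ} {I : Ideal (MvPolynomial (Fin (n+1)) K)}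
    {β D c : ℕ}

theorem two_var [Infinite K] {c' : MvPolynomial (Fin 2) K} {D : ℕ} (hc : c'.IsHomogeneous D) (hx : ¬ X 1 ∣ c') :
    ∃ α γ : K, γ ≠ 0 ∧ c' - C γ * X 1 ^ D ∈ Ideal.span {(X 0 - C α * X 1 : MvPolynomial (Fin 2) K)} := by
  have hc0 : c' ≠ 0 := by rintro rfl; simp at hx
  obtain ⟨a, ha⟩ := exists_eval_ne (mul_ne_zero hc0 (X_ne_zero (R := K) (1 : Fin 2)))
  rw [map_mul, eval_X] at ha
  have ha1 : a 1 ≠ 0 := right_ne_zero_of_mul ha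
  have ha0 : eval a c' ≠ 0 := left_ne_zero_of_mul ha
  refine ⟨(a 1)⁻¹ * a 0, eval (fun i => (a 1)⁻¹ * a i) c', ?_, ?_⟩
  · rw [homog_eval_smul hc]
    exact mul_ne_zero (pow_ne_zero _ (inv_ne_zero ha1)) ha0
  · have h1 := homog_line hc (fun i => (a 1)⁻¹ * a i) (X 1 : MvPolynomial (Fin 2) K)
    rw [algebraMap_eq] at h1
    rw [← h1]
    apply aeval_congr_mod
    intro i
    fin_cases i
    · exact Ideal.mem_span_singleton_self _
    · simp [ha1]

theorem two_var' {c' : MvPolynomial (Fin 2) K} {D : ℕ} (hc : c'.IsHomogeneous D) (hx : ¬ X 1 ∣ c') :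
    ∃ γ : K, γ ≠ 0 ∧ c' - C γ * X 0 ^ D ∈ Ideal.span {(X 1 : MvPolynomial (Fin 2) K)} := by
  have h0 : c' - C (eval ![1, 0] c') * X 0 ^ D ∈ Ideal.span {(X 1 : MvPolynomial (Fin 2) K)} := by
    have h1 := homog_line hc ![1, 0] (X 0 : MvPolynomial (Fin 2) K)
    rw [algebraMap_eq] at h1
    rw [← h1]
    apply aeval_congr_mod
    intro i
    fin_cases i
    · simp
    · simpa using Ideal.mem_span_singleton_self _
  refine ⟨_, ?_, h0⟩
  intro hz
  rw [hz, C_0, zero_mul, sub_zero, Ideal.mem_span_singleton] at h0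
  exact hx h0

theorem one_var {c' : MvPolynomial (Fin 1) K} {D : ℕ} (hc : c'.IsHomogeneous D) (hx : ¬ X 0 ∣ c') :
    ∃ γ : K, γ ≠ 0 ∧ c' = C γ := by
  have h1 := homog_line hc (fun _ => 1) (X 0 : MvPolynomial (Fin 1) K)
  have h2 : (fun i : Fin 1 => algebraMap K (MvPolynomial (Fin 1) K) 1 * X 0) = X := by
    funext i; rw [map_one, one_mul, Subsingleton.elim i 0]
  rw [h2, aeval_X_left_apply, algebraMap_eq] at h1
  rcases Nat.eq_zero_or_pos D with rfl | hD
  · rw [pow_zero, mul_one] at h1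
    refine ⟨_, ?_, h1⟩
    intro hz
    rw [hz, C_0] at h1
    rw [h1] at hx
    simp at hx
  · exfalso
    apply hx
    rw [h1]
    exact Dvd.dvd.mul_left (dvd_pow_self _ hD.ne') _

/-- the algebra modulo a linear form `Y` -/
theorem Stage.surj {θ : MvPolynomial (Fin 2) K →ₐ[K] MvPolynomial (Fin (n+1)) K} 
    (h : Stage 1 j I θ β D c) (α : K) (s q : ℕ) (hq : β + s ≤ q) {g : MvPolynomial (Fin (n+1)) K} (hg : g.IsHomogeneous q) :
    ∃ v, g - X (Fin.last n) ^ s * v ∈ I ⊔ Ideal.span {θ (X 0 - C α * X 1)} ∧ v.IsHomogeneous (q - s) := by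
  have hYh : (θ (X 0 - C α * X 1)).IsHomogeneous 1 := hom_homog θ h.thh (by
    refine (isHomogeneous_X _ _).sub ?_
    simpa using (isHomogeneous_C (Fin 2) α).mul (isHomogeneous_X K (1 : Fin 2)))
  have hJ : HI (I ⊔ Ideal.span {θ (X 0 - C α * X 1)}) := h.hom.sup (HI.span (by rintro x rfl; exact ⟨1, hYh⟩))
  have h1 : θ (X 1) = X (Fin.last n) := h.th0
  have := P4 (I := I) hJ (isHomogeneous_X K (Fin.last n)) (β := β) (by
    intro q hq g hg
    have h2 := h.fin q hq g hg
    revert g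
    suffices hS : I ⊔ Ideal.span (Set.range fun i => θ (X i)) ≤ I ⊔ Ideal.span {θ (X 0 - C α * X 1)} ⊔ Ideal.span {X (Fin.last n)} from
      fun g _ hg => hS hg
    refine sup_le (fun x hx => Ideal.mem_sup_left (Ideal.mem_sup_left hx)) ?_
    rw [Ideal.span_le]
    have hx0 : X (Fin.last n) ∈ I ⊔ Ideal.span {θ (X 0 - C α * X 1)} ⊔ Ideal.span {(X (Fin.last n) : MvPolynomial (Fin (n+1)) K)} := 
      Ideal.mem_sup_right (Ideal.mem_span_singleton_self _)
    have hy0 : θ (X 0 - C α * X 1) ∈ I ⊔ Ideal.span {θ (X 0 - C α * X 1)} ⊔ Ideal.span {(X (Fin.last n) : MvPolynomial (Fin (n+1)) K)} := 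
      Ideal.mem_sup_left (Ideal.mem_sup_right (Ideal.mem_span_singleton_self _))
    rintro _ ⟨i, rfl⟩
    fin_cases i
    · refine mem2 1 (C α) hy0 hx0 ?_
      simp only [map_sub, map_mul, h1, algHom_C, algebraMap_eq]
      simp
    · simpa [h1] using hx0) s q hq g hg
  obtain ⟨v, hv, hvh, -⟩ := hJ.sup1 (by simpa using isHomogeneous_X_pow (Fin.last n) s) hg this
  exact ⟨v, hv, hvh⟩

theorem not_dvd_eta (α : K) : ¬ (X 1 : MvPolynomial (Fin 2) K) ∣ X 0 - C α * X 1 := by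
  rintro ⟨w, hw⟩
  have := congrArg (eval ![1, 0]) hw
  simp at this

theorem eta_ne (α : K) : (X 0 - C α * X 1 : MvPolynomial (Fin 2) K) ≠ 0 := by
  intro h
  apply not_dvd_eta α
  rw [h]; simp

theorem Stage.inj {θ : MvPolynomial (Fin 2) K →ₐ[K] MvPolynomial (Fin (n+1)) K} 
    (h : Stage 1 j I θ β D c) (α : K) (s q : ℕ) (hq : β + c ≤ q) {g : MvPolynomial (Fin (n+1)) K} (hg : g.IsHomogeneous q)
    (hz : X (Fin.last n) ^ s * g ∈ I ⊔ Ideal.span {θ (X 0 - C α * X 1)}) :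
    g ∈ I ⊔ Ideal.span {θ (X 0 - C α * X 1)} := by
  obtain ⟨v, hv, hvh⟩ := h.surj α c q hq hg
  have h1 : X (Fin.last n) ^ (s + c) * v ∈ I ⊔ Ideal.span {θ (X 0 - C α * X 1)} := 
    mem2 1 (- X (Fin.last n) ^ s) hz hv (by ring)
  obtain ⟨w, hw⟩ := mem_sup1.1 h1
  have h0 : θ (X 1) = X (Fin.last n) := h.th0
  rw [← h0, ← map_pow] at hw
  obtain ⟨v', hv'⟩ := h.kap (eta_ne α) (by
    intro a ha
    obtain ⟨b, hb⟩ := ha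
    have := pow_dvd_of_not_dvd (X_prime (R := K)) (not_dvd_eta α) (s + c) b ⟨a, hb.symm⟩
    obtain ⟨b', rfl⟩ := this
    refine ⟨b', ?_⟩
    apply mul_left_cancel₀ (pow_ne_zero (s+c) (X_ne_zero (R := K) (1 : Fin 2)))
    rw [hb]; ring) hw
  have h2 : X (Fin.last n) ^ c * v ∈ I ⊔ Ideal.span {θ (X 0 - C α * X 1)} := mem_sup1.2 ⟨v', hv'⟩
  exact mem2 1 1 hv h2 (by ring)
end
end EN

namespace EN
open MvPolynomial RingTheory.Sequence
universe u

section
variable {K : Type u} [Field K] {n j : ℕ} {I : Ideal (MvPolynomial (Fin (n+1)) K)}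
    {β D c : ℕ}

/-- data of the last step -/
theorem Stage.lastF {θ : MvPolynomial (Fin 2) K →ₐ[K] MvPolynomial (Fin (n+1)) K} 
    (h : Stage 1 j I θ β D c) {F : MvPolynomial (Fin (n+1)) K} {δ : ℕ} (hFh : F.IsHomogeneous δ)
    {e D' : ℕ} {c' : MvPolynomial (Fin 2) K} {g : MvPolynomial (Fin (n+1)) K} (hc'h : c'.IsHomogeneous D')
    (hc' : ¬ X 1 ∣ c') (hg : X (Fin.last n) ^ e * θ c' - F * g ∈ I) (h1 : (1 : MvPolynomial (Fin (n+1)) K) ∉ I)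
    {α γ : K} (hγ : γ ≠ 0) (hαγ : c' - C γ * X 1 ^ D' ∈ Ideal.span {(X 0 - C α * X 1 : MvPolynomial (Fin 2) K)}) :
    (∀ q, β + c ≤ q → ∀ w : MvPolynomial (Fin (n+1)) K, w.IsHomogeneous q → F * w ∈ I ⊔ Ideal.span {θ (X 0 - C α * X 1)} →
      w ∈ I ⊔ Ideal.span {θ (X 0 - C α * X 1)}) ∧
    (∀ q, β + c ≤ q → ∀ w : MvPolynomial (Fin (n+1)) K, w.IsHomogeneous (q + δ) → ∃ v, 
      w - F * v ∈ I ⊔ Ideal.span {θ (X 0 - C α * X 1)}) := by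
  have hx0 : (X (Fin.last n) : MvPolynomial (Fin (n+1)) K).IsHomogeneous 1 := isHomogeneous_X K _
  have hth1 : θ (X 1) = X (Fin.last n) := h.th0
  have hEh : (X (Fin.last n) ^ e * θ c').IsHomogeneous (e + D') := 
    (by simpa using isHomogeneous_X_pow (Fin.last n) e : (X (Fin.last n) ^ e : MvPolynomial (Fin (n+1)) K).IsHomogeneous e).mul (hom_homog θ h.thh hc'h)
  obtain ⟨g', hg', hg'h, hg'0⟩ := h.hom.sup1 hFh hEh (mem_sup1.2 ⟨g, hg⟩)
  have hδ : δ ≤ e + D' := by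
    by_contra hlt
    rw [hg'0 (by omega), mul_zero, sub_zero] at hg'
    have h2 := h.sat_pow e hg'
    rw [← mul_one (θ c')] at h2
    exact h1 (h.tors (by rintro rfl; simp at hc') h2)
  have hcJ : θ c' - C γ * X (Fin.last n) ^ D' ∈ I ⊔ Ideal.span {θ (X 0 - C α * X 1)} := by
    obtain ⟨w, hw⟩ := Ideal.mem_span_singleton'.1 hαγ
    have := congrArg θ hw
    rw [map_mul, map_sub θ c', map_mul θ (C γ), map_pow, hth1, algHom_C, algebraMap_eq] at this
    rw [← this]
    exact Ideal.mem_sup_right (Ideal.mul_mem_left _ _ (Ideal.mem_span_singleton_self _))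
  have hFg : F * g' - C γ * X (Fin.last n) ^ (e + D') ∈ I ⊔ Ideal.span {θ (X 0 - C α * X 1)} :=
    mem2 (-1) (X (Fin.last n) ^ e) (Ideal.mem_sup_left hg') hcJ (by ring)
  have hγi : ∀ p : MvPolynomial (Fin (n+1)) K, C γ⁻¹ * (C γ * p) = p := by
    intro p; rw [← mul_assoc, ← C_mul, inv_mul_cancel₀ hγ, C_1, one_mul]
  constructor
  · intro q hq w hw hFw
    have h2 : C γ * (X (Fin.last n) ^ (e + D') * w) ∈ I ⊔ Ideal.span {θ (X 0 - C α * X 1)} := 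
      mem2 (-w) g' hFg hFw (by ring)
    have h3 := Ideal.mul_mem_left _ (C γ⁻¹) h2
    rw [hγi] at h3
    exact h.inj α _ q hq hw h3
  · intro q hq w hw
    have hgw : (g' * w).IsHomogeneous (q + (e + D')) := by
      have := hg'h.mul hw
      rwa [show e + D' - δ + (q + δ) = q + (e + D') by omega] at this
    obtain ⟨v, hv, hvh⟩ := h.surj α (e + D') _ (by omega) hgw
    rw [Nat.add_sub_cancel] at hvh
    have h4 : C γ * w - F * v ∈ I ⊔ Ideal.span {θ (X 0 - C α * X 1)} := by
      refine h.inj α (e + D') (q + δ) (by omega) ?_ ?_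
      · refine IsHomogeneous.sub ?_ ?_
        · simpa using (isHomogeneous_C (Fin (n+1)) γ).mul hw
        · have := hFh.mul hvh
          rwa [add_comm δ q] at this
      · exact mem2 (-w) F hFg hv (by ring)
    refine ⟨C γ⁻¹ * v, ?_⟩
    refine mem1 (C γ⁻¹) h4 ?_
    rw [mul_sub, hγi]; ring

theorem Stage.final [Infinite K] {θ : MvPolynomial (Fin 2) K →ₐ[K] MvPolynomial (Fin (n+1)) K} 
    (h : Stage 1 j I θ β D c) {F H : MvPolynomial (Fin (n+1)) K} {δ d' : ℕ} (hδ : 1 ≤ δ) (hFh : F.IsHomogeneous δ)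
    (hHh : H.IsHomogeneous d')
    {e D' : ℕ} {c' : MvPolynomial (Fin 2) K} {g : MvPolynomial (Fin (n+1)) K} (hc'h : c'.IsHomogeneous D')
    (hc' : ¬ X 1 ∣ c') (hg : X (Fin.last n) ^ e * θ c' - F * g ∈ I) 
    {I' : Ideal (MvPolynomial (Fin (n+1)) K)} (hle : I ⊔ Ideal.span {F} ≤ I') (hcI : θ c' ∈ I')
    (hkill : ∀ u ∈ I', X (Fin.last n) ^ (e + c) * u ∈ I ⊔ Ideal.span {F})
    {θ' : MvPolynomial (Fin 1) K →ₐ[K] MvPolynomial (Fin (n+1)) K} {j' β' D'' c'' : ℕ}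
    (h' : Stage 0 j' I' θ' β' D'' c'') (hH : ∀ g, H * g ∈ I' → g ∈ I') :
    X (Fin.last n) ^ (max (e + c) (β + c + δ - 1 + d')) ∈ I ⊔ Ideal.span {F} ⊔ Ideal.span {H} := by
  by_cases h1' : (1 : MvPolynomial (Fin (n+1)) K) ∈ I'
  · have := hkill 1 h1'
    obtain ⟨s, hs⟩ := Nat.exists_eq_add_of_le (le_max_left (e + c) (β + c + δ - 1 + d'))
    rw [hs]
    exact mem1 (X (Fin.last n) ^ s) (Ideal.mem_sup_left this) (by ring)
  have h1 : (1 : MvPolynomial (Fin (n+1)) K) ∉ I := fun hh => h1' (hle (Ideal.mem_sup_left hh))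
  have hxh : ∀ a, (X (Fin.last n) ^ a : MvPolynomial (Fin (n+1)) K).IsHomogeneous a := fun a => by
    simpa using isHomogeneous_X_pow (Fin.last n) a
  have hth1 : θ (X 1) = X (Fin.last n) := h.th0
  obtain ⟨α, γ, hγ, hαγ⟩ := two_var hc'h hc'
  obtain ⟨hinj, hsurj⟩ := h.lastF hFh hc'h hc' hg h1 hγ hαγ
  have hYh : (θ (X 0 - C α * X 1)).IsHomogeneous 1 := hom_homog θ h.thh (by
    refine (isHomogeneous_X _ _).sub ?_
    simpa using (isHomogeneous_C (Fin 2) α).mul (isHomogeneous_X K (1 : Fin 2)))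
  have htors : ∀ u, θ (X 0 - C α * X 1) * u ∈ I → u ∈ I := fun u hu => h.tors (eta_ne α) hu
  have hYx : θ (X 0 - C α * X 1) - θ (X 0) ∈ Ideal.span {(X (Fin.last n) : MvPolynomial (Fin (n+1)) K)} := by
    rw [map_sub, map_mul, hth1, sub_sub_cancel_left]
    exact Ideal.neg_mem_iff _ |>.2 (Ideal.mul_mem_left _ _ (Ideal.mem_span_singleton_self _))
  set Y := θ (X 0 - C α * X 1) with hY
  set x : MvPolynomial (Fin (n+1)) K := X (Fin.last n) with hx
  set a := e + c with ha
  set ρ := β + c + δ - 1 with hρ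
  have hIF : HI (I ⊔ Ideal.span {F}) := h.hom.sup (HI.span (by rintro x rfl; exact ⟨δ, hFh⟩))
  -- injectivity of Y
  have injY : ∀ m q, ρ ≤ q → ∀ u : MvPolynomial (Fin (n+1)) K, u.IsHomogeneous q → Y ^ m * u ∈ I ⊔ Ideal.span {F} → 
      u ∈ I ⊔ Ideal.span {F} := by
    intro m
    induction m with
    | zero => intro q _ u _ hu; simpa using hu
    | succ m ih =>
      intro q hq u hu hYu
      apply ih q hq u hu
      have hYmu : (Y ^ m * u).IsHomogeneous (m + q) := by
        have := (hYh.pow m).mul hu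
        rwa [one_mul] at this
      have hYmu' : (Y ^ (m+1) * u).IsHomogeneous (m + 1 + q) := by
        have := (hYh.pow (m+1)).mul hu
        rwa [one_mul] at this
      obtain ⟨v, hv, hvh, -⟩ := h.hom.sup1 hFh hYmu' hYu
      have h2 := hinj _ (by omega) v hvh (mem_sup1.2 ⟨Y^m * u, mem1 (-1) hv (by ring)⟩)
      obtain ⟨v', hv'⟩ := mem_sup1.1 h2
      refine mem_sup1.2 ⟨v', htors _ ?_⟩
      exact mem2 1 F hv hv' (by ring)
  have surY : ∀ m, ∀ w : MvPolynomial (Fin (n+1)) K, w.IsHomogeneous (ρ + m) → ∃ v : MvPolynomial (Fin (n+1)) K, v.IsHomogeneous ρ ∧ 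
      w - Y ^ m * v ∈ I ⊔ Ideal.span {F} := by
    intro m
    induction m with
    | zero => intro w hw; exact ⟨w, hw, by simp⟩
    | succ m ih =>
      intro w hw
      obtain ⟨v, hv⟩ := hsurj (ρ + (m+1) - δ) (by omega) w (by
        rwa [show ρ + (m+1) - δ + δ = ρ + (m+1) by omega])
      have h2 : w ∈ (I ⊔ Ideal.span {F}) ⊔ Ideal.span {Y} := by
        obtain ⟨v2, hv2⟩ := mem_sup1.1 hv
        refine mem_sup1.2 ⟨v2, mem_sup1.2 ⟨v, ?_⟩⟩
        exact mem1 1 hv2 (by ring)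
      obtain ⟨w1, hw1, hw1h, -⟩ := hIF.sup1 hYh hw h2
      obtain ⟨w2, hw2h, hw2⟩ := ih w1 (by rwa [show ρ + (m+1) - 1 = ρ + m by omega] at hw1h)
      exact ⟨w2, hw2h, mem2 1 Y hw1 hw2 (by ring)⟩
  -- the relation for `H`
  have hI'x : ∀ s, x ^ s ∉ I' := fun s hs => h1' (h'.sat_pow s (by rwa [mul_one]))
  obtain ⟨s0, u0, hu0, hu0h, hs0⟩ : ∃ s0 u0, x ^ s0 - H * u0 ∈ I' ∧ u0.IsHomogeneous (s0 - d') ∧ d' ≤ s0 := by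
    obtain ⟨e0, D0, c0, g0, hc0h, hc0, -, hg0, -⟩ := h'.norm hHh hH
    obtain ⟨γ0, hγ0, rfl⟩ := one_var hc0h hc0
    rw [algHom_C, algebraMap_eq] at hg0
    have h2 : x ^ e0 ∈ I' ⊔ Ideal.span {H} := by
      refine mem_sup1.2 ⟨C γ0⁻¹ * g0, mem1 (C γ0⁻¹) hg0 ?_⟩
      have hcc : (C γ0⁻¹ * C γ0 : MvPolynomial (Fin (n+1)) K) = 1 := by rw [← C_mul, inv_mul_cancel₀ hγ0, C_1]
      linear_combination - x ^ e0 * hcc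
    obtain ⟨u0, hu0, hu0h, hu00⟩ := h'.hom.sup1 hHh (hxh e0) h2
    refine ⟨e0, u0, hu0, hu0h, ?_⟩
    by_contra hlt
    rw [hu00 (by omega), mul_zero, sub_zero] at hu0
    exact hI'x _ hu0
  -- the relation for `Y`
  obtain ⟨g1, hg1, hg1h, hD'⟩ : ∃ g1, Y ^ D' - x * g1 ∈ I' ∧ g1.IsHomogeneous (D' - 1) ∧ 1 ≤ D' := by
    have h2 : Y ^ D' ∈ I' ⊔ Ideal.span {x} := by
      obtain ⟨γ1, hγ1, hm⟩ := two_var' hc'h hc'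
      obtain ⟨w, hw⟩ := Ideal.mem_span_singleton'.1 hm
      have hw' := congrArg θ hw
      rw [map_mul, map_sub θ c', map_mul θ (C γ1), map_pow, hth1, algHom_C, algebraMap_eq] at hw'
      have h3 : C γ1 * θ (X 0) ^ D' ∈ I' ⊔ Ideal.span {x} := 
        mem_sup1.2 ⟨- θ w, mem1 1 hcI (by linear_combination hw')⟩
      have h4 := Ideal.mul_mem_left _ (C γ1⁻¹) h3
      rw [← mul_assoc, ← C_mul, inv_mul_cancel₀ hγ1, C_1, one_mul] at h4
      obtain ⟨w2, hw2⟩ := sub_dvd_pow_sub_pow Y (θ (X 0)) D'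
      refine mem2 1 w2 h4 (Ideal.mem_sup_right hYx) (by linear_combination hw2)
    obtain ⟨g1, hg1, hg1h, hg10⟩ := h'.hom.sup1 (isHomogeneous_X K (Fin.last n)) (by simpa using hYh.pow D') h2
    refine ⟨g1, hg1, hg1h, ?_⟩
    by_contra hlt
    have hz : D' = 0 := by omega
    rw [hg10 (by omega), mul_zero, sub_zero, hz, pow_zero] at hg1
    exact h1' hg1
  -- conclusion
  set t := max a (ρ + d') with ht
  have hta : a ≤ t := le_max_left _ _
  have htρ : ρ + d' ≤ t := le_max_right _ _
  have hEh : (x ^ (ρ + d' + a) * g1 ^ (a + s0) * u0).IsHomogeneous (ρ + D' * (a + s0)) := by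
    have := ((hxh (ρ + d' + a)).mul (hg1h.pow (a + s0))).mul hu0h
    have hd : ρ + d' + a + (D' - 1) * (a + s0) + (s0 - d') = ρ + D' * (a + s0) := by
      obtain ⟨m, rfl⟩ := Nat.exists_eq_add_of_le hD'
      obtain ⟨m', rfl⟩ := Nat.exists_eq_add_of_le hs0
      rw [Nat.add_sub_cancel_left, Nat.add_sub_cancel_left]; ring
    rwa [hd] at this
  obtain ⟨v, hvh, hv⟩ := surY _ _ hEh
  obtain ⟨t1, ht1⟩ := Nat.exists_eq_add_of_le hta
  obtain ⟨t2, ht2⟩ := Nat.exists_eq_add_of_le htρ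
  have hζ : Y ^ (D' * (a + s0)) * x ^ t1 - x ^ t * g1 ^ (a + s0) * (H * u0) ∈ I' := by
    obtain ⟨w, hw⟩ := sub_dvd_pow_sub_pow (Y ^ D') (x * g1) (a + s0)
    have hYw : Y ^ (D' * (a + s0)) - (x * g1) ^ (a + s0) ∈ I' := mem1 w hg1 (by rw [pow_mul, hw]; ring)
    refine mem2 (x ^ t1) (x ^ t * g1 ^ (a + s0)) hYw hu0 ?_
    rw [ht1]; ring
  have hζ2 := hkill _ hζ
  have hfin : Y ^ (D' * (a + s0)) * (x ^ t - x ^ t2 * (H * v)) ∈ I ⊔ Ideal.span {F} := by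
    refine mem2 1 (x ^ t2 * H) hζ2 hv ?_
    have e1 : x ^ t = x ^ a * x ^ t1 := by rw [ht1]; ring
    have e2 : x ^ t2 * x ^ (ρ + d' + a) = x ^ a * x ^ t := by rw [ht2]; ring
    have e3 : x ^ t2 * H * (x ^ (ρ + d' + a) * g1 ^ (a + s0) * u0) = x ^ a * x ^ t * g1 ^ (a + s0) * (H * u0) := by
      rw [← e2]; ring
    linear_combination Y ^ (D' * (a + s0)) * e1 - e3
  have hth : (x ^ t - x ^ t2 * (H * v)).IsHomogeneous t := by
    refine (hxh t).sub ?_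
    have := (hxh t2).mul (hHh.mul hvh)
    rwa [show t2 + (d' + ρ) = t by omega] at this
  have hres := injY _ t (by omega) _ hth hfin
  exact mem_sup1.2 ⟨x ^ t2 * v, mem1 1 hres (by ring)⟩
end
end EN

namespace EN
open MvPolynomial RingTheory.Sequence
universe u

section
variable {K : Type u} [Field K] {n : ℕ}

noncomputable def dehom (K : Type u) [Field K] (n : ℕ) : MvPolynomial (Fin (n+1)) K →ₐ[K] MvPolynomial (Fin n) K :=
  aeval (Fin.lastCases (motive := fun _ => MvPolynomial (Fin n) K) 1 X)

noncomputable def hz (d : ℕ) (p : MvPolynomial (Fin n) K) : MvPolynomial (Fin (n+1)) K :=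
  ∑ q ∈ Finset.range (d+1), X (Fin.last n) ^ (d - q) * rename Fin.castSucc (homogeneousComponent q p)

theorem dehom_last : dehom K n (X (Fin.last n)) = 1 := by simp [dehom]

theorem x0_homog (a : ℕ) : (X (Fin.last n) ^ a : MvPolynomial (Fin (n+1)) K).IsHomogeneous a := by
  simpa using isHomogeneous_X_pow (Fin.last n) a

theorem hz_homog (d : ℕ) (p : MvPolynomial (Fin n) K) : (hz d p).IsHomogeneous d := by
  refine IsHomogeneous.sum _ _ _ fun q hq => ?_
  have := (x0_homog (K := K) (n := n) (d - q)).mul ((homogeneousComponent_isHomogeneous q p).rename_isHomogeneous (f := Fin.castSucc))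
  have hq := Finset.mem_range.1 hq
  rwa [show d - q + q = d by omega] at this

theorem dehom_hz {d : ℕ} {p : MvPolynomial (Fin n) K} (h : p.totalDegree ≤ d) : dehom K n (hz d p) = p := by
  have h1 : ∀ b : MvPolynomial (Fin n) K, dehom K n (rename Fin.castSucc b) = b := by
    intro b
    rw [dehom, aeval_rename]
    have : (Fin.lastCases (motive := fun _ => MvPolynomial (Fin n) K) 1 X) ∘ Fin.castSucc = X := by
      funext i; simp
    rw [this, aeval_X_left, AlgHom.id_apply]
  unfold hz
  simp only [map_sum, map_mul, map_pow, dehom_last, one_pow, one_mul, h1]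
  conv_rhs => rw [← sum_homogeneousComponent p]
  symm
  apply Finset.sum_subset
  · intro x; simp; omega
  · intro q _ hq
    apply homogeneousComponent_eq_zero
    simp at hq; omega

theorem dehom_deg {q : ℕ} {g : MvPolynomial (Fin (n+1)) K} (hg : g.IsHomogeneous q) : (dehom K n g).totalDegree ≤ q := by
  rw [dehom, aeval_def, eval₂_eq]
  refine totalDegree_finsetSum_le fun s hs => ?_
  refine (totalDegree_mul _ _).trans ?_
  rw [MvPolynomial.algebraMap_eq, totalDegree_C, zero_add]
  refine (totalDegree_finset_prod _ _).trans ?_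
  have h1 := hg (mem_support_iff.1 hs)
  rw [Finsupp.weight_apply, Finsupp.sum] at h1
  rw [← h1]
  refine Finset.sum_le_sum fun i _ => ?_
  refine (totalDegree_pow _ _).trans ?_
  refine Nat.mul_le_mul_left _ ?_
  refine Fin.lastCases ?_ (fun i => ?_) i
  · simp
  · simp

theorem eval_dehom (g : MvPolynomial (Fin (n+1)) K) (c : Fin n → K) :
    eval c (dehom K n g) = eval (Fin.lastCases (motive := fun _ => K) 1 c) g := by
  have : ((aeval c : MvPolynomial (Fin n) K →ₐ[K] K).comp (dehom K n)) = aeval (Fin.lastCases (motive := fun _ => K) 1 c) := by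
    apply algHom_ext
    intro i
    refine Fin.lastCases ?_ (fun i => ?_) i
    · simp [dehom_last]
    · simp [dehom]
  exact DFunLike.congr_fun this g

theorem dehom_inj [Infinite K] {q : ℕ} {g : MvPolynomial (Fin (n+1)) K} (hg : g.IsHomogeneous q)
    (h : dehom K n g = 0) : g = 0 := by
  by_contra hne
  obtain ⟨c, hc⟩ := exists_eval_ne (mul_ne_zero (X_ne_zero (Fin.last n)) hne)
  simp only [map_mul, eval_X] at hc
  obtain ⟨hc0, hc1⟩ := mul_ne_zero_iff.1 hc
  apply hc1
  have h1 := homog_eval_smul hg (c (Fin.last n)) (fun i => (c (Fin.last n))⁻¹ * c i)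
  have h2 := eval_dehom g (fun i => (c (Fin.last n))⁻¹ * c i.castSucc)
  rw [h, map_zero] at h2
  have h3 : (Fin.lastCases (motive := fun _ => K) 1 (fun i : Fin n => (c (Fin.last n))⁻¹ * c i.castSucc)) = 
      (fun i => (c (Fin.last n))⁻¹ * c i) := by
    funext i
    refine Fin.lastCases ?_ (fun i => ?_) i
    · simp [hc0]
    · simp
  rw [h3] at h2
  rw [← h2, mul_zero] at h1
  rw [← h1]
  congr 2
  funext i
  field_simp

theorem x0_mem [Infinite K] {r : ℕ} (f : Fin r → MvPolynomial (Fin n) K) (h : Ideal.span (Set.range f) = ⊤)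
    (d : ℕ → ℕ) (hdeg : ∀ i : Fin r, d i = (f i).totalDegree) :
    ∃ M, X (Fin.last n) ^ M ∈ Ideal.span (Set.range fun i : Fin r => hz (d i) (f i)) := by
  have h1 : (1 : MvPolynomial (Fin n) K) ∈ Ideal.span (Set.range f) := by rw [h]; trivial
  obtain ⟨b, hb⟩ := (Ideal.mem_span_range_iff_exists_fun).1 h1
  let M := ∑ i : Fin r, (d i + (b i).totalDegree)
  have hM : ∀ i : Fin r, d i + (b i).totalDegree ≤ M := fun i => 
    Finset.single_le_sum (f := fun i : Fin r => d i + (b i).totalDegree) (fun _ _ => Nat.zero_le _) (Finset.mem_univ i)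
  refine ⟨M, ?_⟩
  have h2 : X (Fin.last n) ^ M - ∑ i : Fin r, hz (M - d i) (b i) * hz (d i) (f i) = 0 := by
    apply dehom_inj (q := M)
    · refine (x0_homog M).sub (IsHomogeneous.sum _ _ _ fun i _ => ?_)
      have := (hz_homog (M - d i) (b i)).mul (hz_homog (d i) (f i))
      have h3 := hM i
      rwa [show M - d i + d i = M by omega] at this
    · rw [map_sub, map_pow, dehom_last, one_pow, map_sum, sub_eq_zero, ← hb]
      refine Finset.sum_congr rfl fun i _ => ?_
      rw [map_mul, dehom_hz (by have := hM i; omega), dehom_hz (hdeg i).ge]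
  rw [sub_eq_zero.1 h2]
  exact Ideal.sum_mem _ fun i _ => Ideal.mul_mem_left _ _ (Ideal.subset_span ⟨i, rfl⟩)

end
end EN

namespace EN
open MvPolynomial RingTheory.Sequence
universe u

section
variable {K : Type u} [Field K] {n r : ℕ}

theorem nzd_generic {A : Type u} [CommRing A] [Algebra K A] [IsNoetherianRing A] [Infinite K] {I : Ideal A} {x : A}
    (hsat : ∀ g, x * g ∈ I → g ∈ I) {M m : ℕ} (g : ℕ → A) 
    (hx : x ^ M ∈ I ⊔ Ideal.span {y | ∃ i < m, y = g i}) : 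
    ∃ t : K, ∀ u, (∑ i ∈ Finset.range m, algebraMap K A (t ^ i) * g i) * u ∈ I → u ∈ I := by
  have hsatp : ∀ a u, x ^ a * u ∈ I → u ∈ I := by
    intro a
    induction a with
    | zero => intro u; simp
    | succ a ih => intro u hu; exact ih _ (hsat _ (by rwa [← mul_assoc, ← pow_succ']))
  have hfin := associatedPrimes.finite A (A ⧸ I)
  have hcol : ∀ (u a : A), a ∈ (⊥ : Submodule A (A ⧸ I)).colon {Ideal.Quotient.mk I u} ↔ a * u ∈ I := by
    intro u a
    rw [Submodule.mem_colon_singleton, Submodule.mem_bot, ← Ideal.Quotient.mk_eq_mk, ← Submodule.Quotient.mk_smul, 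
      Ideal.Quotient.mk_eq_mk, Ideal.Quotient.eq_zero_iff_mem, smul_eq_mul]
  have h1 := generic (K := K) (associatedPrimes A (A ⧸ I)) hfin (fun p hp => hp.1) m g (by
    intro p hp
    by_contra! hcon
    obtain ⟨hp1, y, hy⟩ := isAssociatedPrime_iff.1 hp
    obtain ⟨u, rfl⟩ := Ideal.Quotient.mk_surjective y
    have hle : I ⊔ Ideal.span {y | ∃ i < m, y = g i} ≤ p := by
      refine sup_le (fun a ha => ?_) (Ideal.span_le.2 ?_)
      · rw [hy, hcol]; exact I.mul_mem_right _ ha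
      · rintro _ ⟨i, hi, rfl⟩; exact hcon i hi
    have h2 := hle hx
    rw [hy, hcol] at h2
    apply hp1.ne_top
    rw [Ideal.eq_top_iff_one, hy, hcol, one_mul]
    exact hsatp _ _ h2)
  obtain ⟨t, ht⟩ := h1.exists_notMem
  refine ⟨t, fun u hu => ?_⟩
  by_contra hne
  obtain ⟨P, hP, hle⟩ := exists_le_isAssociatedPrime_of_isNoetherianRing A (Ideal.Quotient.mk I u) (by
    rwa [Ne, Ideal.Quotient.eq_zero_iff_mem])
  exact ht ⟨P, hP, hle ((hcol _ _).2 hu)⟩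

theorem Stage.base : Stage (K := K) (n := n) n 0 ⊥ (AlgHom.id K _) 0 1 0 where
  hom := HI.bot
  sat := by
    intro g hg
    rw [Ideal.mem_bot] at hg ⊢
    exact (mul_eq_zero.1 hg).resolve_left (X_ne_zero _)
  th0 := rfl
  thh := fun i => isHomogeneous_X _ _
  fin := by
    intro q hq g hg
    refine Ideal.mem_sup_right ?_
    have : (Set.range fun i => AlgHom.id K (MvPolynomial (Fin (n+1)) K) (X i)) = X '' Set.univ := by simp
    rw [this, mem_ideal_span_X_image]
    intro m hm
    by_contra! hcon
    have h0 : m = 0 := by ext i; exact hcon i trivial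
    have := hg (mem_support_iff.1 hm)
    simp [h0] at this
    omega
  rank := by
    intro q u hu
    have : LinearIndependent (MvPolynomial (Fin (n+1)) K) u := by
      rw [Fintype.linearIndependent_iff]
      intro b hb
      exact hu b (by simpa using hb)
    simpa using this.fintype_card_le_finrank
  reg := by
    intro z hz
    refine ⟨z, hz, by simp, fun l hl => Ideal.mem_sup_right (Ideal.subset_span ⟨l, hl, rfl⟩)⟩
  cp := CP.equiv _ (Submodule.quotEquivOfEqBot ⊥ rfl).symm (CP.base _)

def Lam (f : Fin r → MvPolynomial (Fin n) K) (I : Ideal (MvPolynomial (Fin (n+1)) K)) (Λ : ℕ) : Prop :=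
  ∀ q g, g ∈ I → g.IsHomogeneous q → IFm f (q + Λ) (dehom K n g)

theorem Lam.bot (f : Fin r → MvPolynomial (Fin n) K) : Lam f ⊥ 0 := by
  intro q g hg _
  rw [Ideal.mem_bot.1 hg, map_zero]
  exact IFm.zero

theorem Lam.sup {f : Fin r → MvPolynomial (Fin n) K} {I : Ideal (MvPolynomial (Fin (n+1)) K)} {Λ δ : ℕ}
    (h : Lam f I Λ) (hI : HI I) {F : MvPolynomial (Fin (n+1)) K} (hF : F.IsHomogeneous δ) (hFf : IFm f δ (dehom K n F)) :
    Lam f (I ⊔ Ideal.span {F}) Λ := by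
  intro q g hg hgq
  obtain ⟨v, hv, hvh, hv0⟩ := hI.sup1 hF hgq hg
  by_cases hq : q < δ
  · rw [hv0 hq, mul_zero, sub_zero] at hv
    exact h q g hv hgq
  · have h1 := (hF.mul hvh)
    rw [show δ + (q - δ) = q by omega] at h1
    have h2 := h q _ hv (hgq.sub h1)
    have h3 := hFf.mul (dehom_deg hvh)
    have h4 := h2.add (h3.mono (show δ + (q - δ) ≤ q + Λ by omega))
    rwa [map_sub, map_mul, sub_add_cancel] at h4

theorem Lam.kill {f : Fin r → MvPolynomial (Fin n) K} {J I : Ideal (MvPolynomial (Fin (n+1)) K)} {Λ a : ℕ}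
    (h : Lam f J Λ) (hk : ∀ u ∈ I, X (Fin.last n) ^ a * u ∈ J) : Lam f I (Λ + a) := by
  intro q g hg hgq
  have := h _ _ (hk g hg) ((x0_homog a).mul hgq)
  rw [map_mul, map_pow, dehom_last, one_pow, one_mul] at this
  exact this.mono (by omega)

theorem Lam.one {f : Fin r → MvPolynomial (Fin n) K} {J : Ideal (MvPolynomial (Fin (n+1)) K)} {Λ a : ℕ}
    (h : Lam f J Λ) (hk : X (Fin.last n) ^ a ∈ J) : IFm f (a + Λ) 1 := by
  have := h _ _ hk (x0_homog a)
  rwa [map_pow, dehom_last, one_pow] at this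

theorem Stage.D_pos {k j β D c : ℕ} {I : Ideal (MvPolynomial (Fin (n+1)) K)}
    {θ : MvPolynomial (Fin (k+1)) K →ₐ[K] MvPolynomial (Fin (n+1)) K} (h : Stage k j I θ β D c)
    (h1 : (1 : MvPolynomial (Fin (n+1)) K) ∉ I) : 1 ≤ D := by
  refine h.rank 1 (fun _ => 1) fun b hb i => ?_
  by_contra hne
  apply h1
  rw [Fin.sum_univ_one] at hb
  obtain rfl : i = 0 := Subsingleton.elim _ _
  exact h.tors hne hb

/-- homogenised generators -/
noncomputable def ph (f : Fin r → MvPolynomial (Fin n) K) (d : ℕ → ℕ) (l : ℕ) : MvPolynomial (Fin (n+1)) K :=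
  hz (d l) (ext f l)

noncomputable def FF (f : Fin r → MvPolynomial (Fin n) K) (d : ℕ → ℕ) (j : ℕ) (t : K) : MvPolynomial (Fin (n+1)) K :=
  ∑ i ∈ Finset.range (r - j), algebraMap K _ (t ^ i) * (X (Fin.last n) ^ (d j - d (j+i)) * ph f d (j+i))

/-- span of the tail -/
noncomputable def TL (f : Fin r → MvPolynomial (Fin n) K) (d : ℕ → ℕ) (j : ℕ) : Ideal (MvPolynomial (Fin (n+1)) K) :=
  Ideal.span {y | ∃ l, j ≤ l ∧ l < r ∧ y = ph f d l}

variable {f : Fin r → MvPolynomial (Fin n) K} {d : ℕ → ℕ}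

theorem dehom_ph (hdeg : ∀ i : Fin r, d i = (f i).totalDegree) (l : ℕ) : dehom K n (ph f d l) = ext f l := by
  refine dehom_hz ?_
  unfold ext
  split_ifs with h
  · exact (hdeg ⟨l, h⟩).ge
  · simp

theorem FF_homog (hsort : ∀ i j, i ≤ j → j < r → d j ≤ d i) (j : ℕ) (t : K) : (FF f d j t).IsHomogeneous (d j) := by
  refine IsHomogeneous.sum _ _ _ fun i hi => ?_
  have hi := Finset.mem_range.1 hi
  have h1 := hsort j (j+i) (by omega) (by omega)
  have h2 := (isHomogeneous_C (Fin (n+1)) (t^i)).mul ((x0_homog (K := K) (n := n) (d j - d (j+i))).mul (hz_homog (d (j+i)) (ext f (j+i))))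
  rwa [show 0 + (d j - d (j+i) + d (j+i)) = d j by omega] at h2

theorem dehom_FF (hdeg : ∀ i : Fin r, d i = (f i).totalDegree) (j : ℕ) (t : K) :
    dehom K n (FF f d j t) = comb f j t := by
  unfold FF comb
  rw [map_sum]
  refine Finset.sum_congr rfl fun i _ => ?_
  rw [map_mul, AlgHom.commutes, map_mul, map_pow (dehom K n), dehom_last, one_pow, one_mul, dehom_ph hdeg]

theorem FF_nzd [Infinite K] {I : Ideal (MvPolynomial (Fin (n+1)) K)} (hsat : ∀ g, X (Fin.last n) * g ∈ I → g ∈ I) 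
    (hdeg : ∀ i : Fin r, d i = (f i).totalDegree)
    {M j : ℕ} (hsort : ∀ i j, i ≤ j → j < r → d j ≤ d i) (hx : X (Fin.last n) ^ M ∈ I ⊔ TL f d j) : 
    ∃ t : K, ∀ u, FF f d j t * u ∈ I → u ∈ I := by
  have hle : ∀ l < r, d l ≤ d 0 := fun l hl => hsort 0 l (Nat.zero_le _) hl
  refine nzd_generic (x := X (Fin.last n)) hsat (M := M + d j) (fun i => X (Fin.last n) ^ (d j - d (j+i)) * ph f d (j+i)) ?_
  obtain ⟨a, ha, b, hb, hab⟩ := Submodule.mem_sup.1 hx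
  rw [pow_add, ← hab, add_mul]
  refine Ideal.add_mem _ (Ideal.mem_sup_left (I.mul_mem_right _ ha)) (Ideal.mem_sup_right ?_)
  clear hab hx
  unfold TL at hb
  induction hb using Submodule.span_induction with
  | mem y hy =>
    obtain ⟨l, hl, hlr, rfl⟩ := hy
    obtain ⟨i, rfl⟩ := Nat.exists_eq_add_of_le hl
    have h1 := hsort j (j+i) (by omega) hlr
    refine mem1 (X (Fin.last n) ^ (d (j+i))) (Ideal.subset_span ⟨i, by omega, rfl⟩) ?_
    rw [← mul_assoc, ← pow_add, show d (j+i) + (d j - d (j+i)) = d j by omega, mul_comm]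
  | zero => simp
  | add x y _ _ hx hy => rw [add_mul]; exact Ideal.add_mem _ hx hy
  | smul a x _ hx => rw [smul_eq_mul, mul_assoc]; exact Ideal.mul_mem_left _ _ hx

theorem TL_step {j : ℕ} (hj : j < r) (t : K) : TL f d j ≤ Ideal.span {FF f d j t} ⊔ TL f d (j+1) := by
  refine Ideal.span_le.2 ?_
  rintro _ ⟨l, hl, hlr, rfl⟩
  have h2 : ∀ l, j + 1 ≤ l → l < r → ph f d l ∈ TL f d (j+1) := fun l hl hlr => Ideal.subset_span ⟨l, hl, hlr, rfl⟩
  rcases Nat.eq_or_lt_of_le hl with rfl | h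
  · have h1 : FF f d j t = ∑ i ∈ Finset.range (r - j - 1), 
        algebraMap K _ (t ^ (i+1)) * (X (Fin.last n) ^ (d j - d (j+(i+1))) * ph f d (j+(i+1))) + ph f d j := by
      rw [FF, show r - j = (r - j - 1) + 1 by omega, Finset.sum_range_succ']
      simp
    rw [eq_comm, ← eq_sub_iff_add_eq'] at h1
    rw [h1]
    refine Ideal.sub_mem _ (Ideal.mem_sup_left (Ideal.mem_span_singleton_self _)) (Ideal.mem_sup_right ?_)
    refine Ideal.sum_mem _ fun i hi => Ideal.mul_mem_left _ _ (Ideal.mul_mem_left _ _ (h2 _ (by omega) ?_))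
    have := Finset.mem_range.1 hi
    omega
  · exact Ideal.mem_sup_right (h2 l h hlr)

theorem TL_zero [Infinite K] (h : Ideal.span (Set.range f) = ⊤)
     (hdeg : ∀ i : Fin r, d i = (f i).totalDegree) : ∃ M, X (Fin.last n) ^ M ∈ TL f d 0 := by
  obtain ⟨M, hM⟩ := x0_mem f h d hdeg
  refine ⟨M, Ideal.span_mono ?_ hM⟩
  rintro _ ⟨i, rfl⟩
  refine ⟨i, Nat.zero_le _, i.2, ?_⟩
  simp [ph, ext_lt f i.2]

end
end EN

namespace EN
open MvPolynomial RingTheory.Sequence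
universe u

section
variable {K : Type u} [Field K] {n r : ℕ}
variable {f : Fin r → MvPolynomial (Fin n) K} {d : ℕ → ℕ}

theorem chain_step [Infinite K] {k j β D c Λ P δ : ℕ} {I : Ideal (MvPolynomial (Fin (n+1)) K)}
    {θ : MvPolynomial (Fin (k+2)) K →ₐ[K] MvPolynomial (Fin (n+1)) K} (h : Stage (k+1) j I θ β D c)
    (hL : Lam f I Λ) {F : MvPolynomial (Fin (n+1)) K} (hF : F.IsHomogeneous δ) (hFn : ∀ u, F * u ∈ I → u ∈ I)
    (hFf : IFm f δ (dehom K n F)) (hδ : 3 ≤ δ) (h1 : c + D ≤ P) (h2 : Λ + D ≤ P) (h3 : 2 * β + 3 ≤ 2 * D + P) :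
    IFm f (P * δ) 1 ∨ ∃ (I' : Ideal (MvPolynomial (Fin (n+1)) K)) 
      (θ' : MvPolynomial (Fin (k+1)) K →ₐ[K] MvPolynomial (Fin (n+1)) K) (β' D' c' Λ' : ℕ),
      Stage k (j+1) I' θ' β' D' c' ∧ I ⊔ Ideal.span {F} ≤ I' ∧ Lam f I' Λ' ∧ 1 ≤ D' ∧ c' + D' ≤ P * δ ∧ 
      Λ' + D' ≤ P * δ ∧ 2 * β' + 5 ≤ 2 * D' + P * δ := by
  obtain ⟨e, D', c', g, I', θ', hc'h, hc', hle, hg, hIF, hcI, hkill, hs⟩ := h.step hF hFn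
  have hL' := (hL.sup h.hom hF hFf).kill hkill
  obtain ⟨C, rfl⟩ := Nat.exists_eq_add_of_le h1
  have hΛ : Λ ≤ c + C := by omega
  have e1 : (c + D + C) * δ = c * δ + δ * D + C * δ := by ring
  have e2 : c * 3 ≤ c * δ := Nat.mul_le_mul_left _ hδ
  have e3 : C * 3 ≤ C * δ := Nat.mul_le_mul_left _ hδ
  have e4 : D * 3 ≤ δ * D := by rw [mul_comm]; exact Nat.mul_le_mul_right _ hδ
  have hΛ' : Λ + (e + c) + D' ≤ (c + D + C) * δ := by omega
  by_cases hone : (1 : MvPolynomial (Fin (n+1)) K) ∈ I'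
  · left
    have := hL'.one (a := 0) (by simpa using hone)
    exact this.mono (by omega)
  · right
    have hD := hs.D_pos hone
    exact ⟨I', θ', _, D', _, _, hs, hIF, hL', hD, by omega, hΛ', by omega⟩

theorem chain [Infinite K] (hsp : Ideal.span (Set.range f) = ⊤) (hr : n < r) 
    (hdeg : ∀ i : Fin r, d i = (f i).totalDegree)
    (hsort : ∀ i j, i ≤ j → j < r → d j ≤ d i) (hd : ∀ i < r, 3 ≤ d i) (m k : ℕ) (hk : k + (m + 1) = n) :
    IFm f (d (r-1) * ∏ i ∈ Finset.range m, d i) 1 ∨ ∃ (I : Ideal (MvPolynomial (Fin (n+1)) K)) 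
      (θ : MvPolynomial (Fin (k+1)) K →ₐ[K] MvPolynomial (Fin (n+1)) K) (β D c Λ M : ℕ),
      Stage k (m+1) I θ β D c ∧ X (Fin.last n) ^ M ∈ I ⊔ TL f d m ∧ Lam f I Λ ∧ 1 ≤ D ∧ 
      c + D ≤ d (r-1) * ∏ i ∈ Finset.range m, d i ∧ 
      Λ + D ≤ d (r-1) * ∏ i ∈ Finset.range m, d i ∧ 2 * β + 5 ≤ 2 * D + d (r-1) * ∏ i ∈ Finset.range m, d i := by
  induction m generalizing k with
  | zero =>
    obtain rfl : k + 1 = n := hk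
    have hne : ph f d (r-1) ≠ 0 := by
      intro h0
      have h1 := dehom_ph (f := f) hdeg (r-1)
      rw [h0, map_zero, ext_lt f (show r - 1 < r by omega)] at h1
      have h2 := hdeg ⟨r-1, by omega⟩
      rw [← h1, totalDegree_zero] at h2
      have h3 := hd (r-1) (by omega)
      simp only at h2
      omega
    have := chain_step (P := 1) (F := ph f d (r-1)) (Stage.base (K := K) (n := k+1)) (Lam.bot f) (hz_homog _ _) (by
      intro u hu
      rw [Ideal.mem_bot] at hu ⊢
      exact (mul_eq_zero.1 hu).resolve_left hne) (by
      have := IFm_ext f d hdeg (r-1)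
      rwa [← dehom_ph (f := f) hdeg] at this) (hd (r-1) (by omega)) (by omega) (by omega) (by omega)
    rw [Finset.prod_range_zero, mul_one]
    rw [one_mul] at this
    rcases this with h | ⟨I', θ', β', D', c', Λ', hs, hle, hL, h1, h2, h3, h4⟩
    · exact Or.inl h
    · right
      obtain ⟨M, hM⟩ := TL_zero hsp hdeg
      exact ⟨I', θ', β', D', c', Λ', M, hs, Ideal.mem_sup_right hM, hL, h1, h2, h3, h4⟩
  | succ m ih =>
    have hprod : d (r-1) * ∏ i ∈ Finset.range (m+1), d i = (d (r-1) * ∏ i ∈ Finset.range m, d i) * d m := by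
      rw [Finset.prod_range_succ, mul_assoc]
    rw [hprod]
    have hdm := hd m (by omega)
    rcases ih (k+1) (by omega) with h | ⟨I, θ, β, D, c, Λ, M, hs, hM, hL, h1, h2, h3, h4⟩
    · left; exact h.mono (Nat.le_mul_of_pos_right _ (by omega))
    · obtain ⟨t, ht⟩ := FF_nzd hs.sat hdeg hsort hM
      have := chain_step hs hL (FF_homog hsort m t) ht (by
        rw [dehom_FF hdeg]; exact IFm_comb f d hdeg hsort m t) hdm h2 h3 (by omega)
      rcases this with h | ⟨I', θ', β', D', c', Λ', hs', hle, hL', h1', h2', h3', h4'⟩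
      · exact Or.inl h
      · right
        refine ⟨I', θ', β', D', c', Λ', M, hs', ?_, hL', h1', h2', h3', h4'⟩
        have : I ⊔ TL f d m ≤ I' ⊔ TL f d (m+1) := by
          refine sup_le ((le_sup_left.trans hle).trans le_sup_left) ((TL_step (by omega) t).trans ?_)
          exact sup_le_sup_right (le_sup_right.trans hle) _
        exact this hM

theorem partK [Infinite K] (hsp : Ideal.span (Set.range f) = ⊤) (hn : 1 < n) (hr : n < r) 
    (hdeg : ∀ i : Fin r, d i = (f i).totalDegree)
    (hsort : ∀ i j, i ≤ j → j < r → d j ≤ d i) (hd : ∀ i < r, 3 ≤ d i) :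
    IFm f (d (r-1) * ∏ i ∈ Finset.range (n-1), d i) 1 := by
  obtain ⟨m, hm⟩ : ∃ m, n = 1 + (m + 1) := ⟨n - 2, by omega⟩
  have hprod : d (r-1) * ∏ i ∈ Finset.range (n-1), d i = (d (r-1) * ∏ i ∈ Finset.range m, d i) * d m := by
    rw [show n - 1 = m + 1 by omega, Finset.prod_range_succ, mul_assoc]
  rw [hprod]
  have hdm := hd m (by omega)
  have hP3 : 3 ≤ d (r-1) * ∏ i ∈ Finset.range m, d i := by
    refine (hd (r-1) (by omega)).trans (Nat.le_mul_of_pos_right _ ?_)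
    exact Finset.prod_pos fun i hi => by
      have := hd i (by have := Finset.mem_range.1 hi; omega)
      omega
  rcases chain hsp hr hdeg hsort hd m 1 hm.symm with h | ⟨I, θ, β, D, c, Λ, M, hs, hM, hL, h1, h2, h3, h4⟩
  · exact h.mono (Nat.le_mul_of_pos_right _ (by omega))
  generalize d (r-1) * ∏ i ∈ Finset.range m, d i = P at *
  obtain ⟨t, ht⟩ := FF_nzd hs.sat hdeg hsort hM
  have hFh := FF_homog (f := f) hsort m t
  have hFf : IFm f (d m) (dehom K n (FF f d m t)) := by
    rw [dehom_FF hdeg]; exact IFm_comb f d hdeg hsort m t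
  obtain ⟨e, D', c', g, I', θ', hc'h, hc', hle, hg, hIF, hcI, hkill, hs'⟩ := hs.step hFh ht
  have hM' : X (Fin.last n) ^ M ∈ I' ⊔ TL f d (m+1) := by
    have : I ⊔ TL f d m ≤ I' ⊔ TL f d (m+1) := by
      refine sup_le ((le_sup_left.trans hIF).trans le_sup_left) ((TL_step (by omega) t).trans ?_)
      exact sup_le_sup_right (le_sup_right.trans hIF) _
    exact this hM
  obtain ⟨s, hs2⟩ := FF_nzd hs'.sat hdeg hsort hM'
  have hHh := FF_homog (f := f) hsort (m+1) s
  have hHf : IFm f (d (m+1)) (dehom K n (FF f d (m+1) s)) := by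
    rw [dehom_FF hdeg]; exact IFm_comb f d hdeg hsort (m+1) s
  have hfin := hs.final (by omega) hFh hHh hc'h hc' hg hIF hcI hkill hs' hs2
  have hL2 := (hL.sup hs.hom hFh hFf).sup (hs.hom.sup (HI.span (by rintro x rfl; exact ⟨_, hFh⟩))) hHh hHf
  have hone := hL2.one hfin
  refine hone.mono ?_
  have hdd := hsort m (m+1) (by omega) (by omega)
  obtain ⟨a, ha⟩ := Nat.exists_eq_add_of_le hP3
  obtain ⟨b, hb⟩ := Nat.exists_eq_add_of_le hdm
  rw [← max_add_add_right, max_le_iff]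
  constructor
  · obtain ⟨C, rfl⟩ := Nat.exists_eq_add_of_le h2
    have e1 : (c + D + C) * d m = c * d m + d m * D + C * d m := by ring
    have e2 : c * 3 ≤ c * d m := Nat.mul_le_mul_left _ hdm
    have e3 : C * 3 ≤ C * d m := Nat.mul_le_mul_left _ hdm
    omega
  · have e1 : P * d m = 9 + 3 * a + 3 * b + a * b := by rw [ha, hb]; ring
    omega

end
end EN

/-- **Effective Nullstellensatz (Kollár–Jelonek).**
If `f 0, …, f (r-1) ∈ F[x₁, …, x_n]` have no common zero over an algebraically closed
field `F`, their total degrees `d 0 ≥ d 1 ≥ … ≥ d (r-1) ≥ 1`, then there are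
`h 0, …, h (r-1)` with `1 = ∑ h i * f i` and `deg (h i * f i) ≤ N'(n, d₁, …, d_r)`. -/
theorem effective_nullstellensatz {F : Type*} [Field F] [IsAlgClosed F]
    (n r : ℕ) (hn : 0 < n) (hr : 0 < r)
    (f : Fin r → MvPolynomial (Fin n) F) (d : ℕ → ℕ)
    (hdeg : ∀ i : Fin r, d (i : ℕ) = (f i).totalDegree)
    (hsorted : ∀ i j : Fin r, i ≤ j → d (j : ℕ) ≤ d (i : ℕ))
    (hpos : 1 ≤ d (r - 1))
    (hnocommon : ∀ x : Fin n → F, ∃ i : Fin r, MvPolynomial.eval x (f i) ≠ 0) :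
    ∃ h : Fin r → MvPolynomial (Fin n) F,
      (1 : MvPolynomial (Fin n) F) = ∑ i : Fin r, h i * f i ∧
      ∀ i : Fin r, (h i * f i).totalDegree ≤ KJboundN' n r d := by
  have hsort : ∀ i j, i ≤ j → j < r → d j ≤ d i := fun i j hij hj =>
    hsorted ⟨i, by omega⟩ ⟨j, hj⟩ hij
  have hd1 : ∀ i < r, d (r - 1) ≤ d i := fun i hi => hsort i (r - 1) (by omega) (by omega)
  have hd : ∀ i < r, 1 ≤ d i := fun i hi => hpos.trans (hd1 i hi)
  suffices EN.IFm f (KJboundN' n r d) 1 from this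
  haveI : Infinite F := IsAlgClosed.instInfinite
  unfold KJboundN' KJboundN
  by_cases hrn : r ≤ n
  · simp only [if_pos hrn]
    exact EN.partJ_le hn hrn f d hdeg hd hnocommon
  simp only [if_neg hrn]
  have hJ := EN.partJ_gt f d hn (by omega) hdeg hsort hd hnocommon
  have h0 := hd1 0 hr
  by_cases h1 : 1 < n
  · simp only [if_pos h1]
    rw [if_neg (by omega), mul_comm (d (r - 1))] at hJ
    split_ifs with h2
    · rw [mul_comm]
      exact EN.partK (EN.span_top f hnocommon) h1 (by omega) hdeg hsort fun i hi => le_trans h2 (hd1 i hi)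
    · exact hJ.mono (by omega)
  · obtain rfl : n = 1 := by omega
    simp only [if_neg h1]
    simp only [if_true, Nat.sub_self, Finset.prod_range_zero, mul_one] at hJ
    split_ifs with h2
    · exact hJ.mono (by omega)
    · exact hJ.mono (by omega)
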